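/- Let f be a minface on an open set U ⊆ R^2 with real Weierstrass data (g1, g2, ω1 du, ω2 dv) (so ω1 and ω2 are nowhere zero on U), and let p ∈ U be a singular point of f, i.e. g1(p)g2(p) = 1. Write φ1 = (g1)_u/(g1^2 ω1), φ2 = (g2)_v/(g2^2 ω2), Φ1 = (g1/(g1)_u)(φ1)_u, Φ2 = (g2/(g2)_v)(φ2)_v. Then f is A-equivalent at p to the cuspidal butterfly f_CBF(u,v) = (u, 5v^4 + 2uv, 4v^5 + uv^2 - u^2) at the origin if and only if, at p: φ1 - φ2 ≠ 0, φ1 + φ2 = 0, Φ1 - Φ2 = 0, and (g1/(g1)_u)(Φ1)_u + (g2/(g2)_v)(Φ2)_v ≠ 0. -/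

import Mathlib

noncomputable section

open Real Filter

abbrev R2 : Type := ℝ × ℝ
abbrev R3 : Type := ℝ × ℝ × ℝ

/-- The partial derivative in the `u`-direction. -/
def pu (f : R2 → R3) (p : R2) : R3 := fderiv ℝ f p (1, 0)
/-- The partial derivative in the `v`-direction. -/
def pv (f : R2 → R3) (p : R2) : R3 := fderiv ℝ f p (0, 1)

/-- Determinant of three column vectors in ℝ³. -/
def det3 (a b c : R3) : ℝ :=
  a.1 * (b.2.1 * c.2.2 - b.2.2 * c.2.1)
  - b.1 * (a.2.1 * c.2.2 - a.2.2 * c.2.1)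
  + c.1 * (a.2.1 * b.2.2 - a.2.2 * b.2.1)

/-- Determinant of two vectors in ℝ². -/
def det2 (a b : R2) : ℝ := a.1 * b.2 - a.2 * b.1

/-- Euclidean inner product on ℝ³. -/
def ip3 (a b : R3) : ℝ := a.1 * b.1 + a.2.1 * b.2.1 + a.2.2 * b.2.2

/-- `f : ℝ² → ℝ³ = 𝕃³` is the generalized timelike minimal surface with real Weierstrass
data `(g1, g2, w1 du, w2 dv)`: it is smooth, its partial derivatives are
`f_u = (ω1/2)·(-1-g1², 1-g1², 2g1)` and `f_v = (ω2/2)·(1+g2², 1-g2², -2g2)`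
(which encodes the Weierstrass-type integral representation), and it is an immersion
on an open dense set. -/
structure IsGTMS (f : R2 → R3) (g1 g2 w1 w2 : ℝ → ℝ) : Prop where
  smooth_f : ContDiff ℝ (⊤ : ℕ∞) f
  smooth_g1 : ContDiff ℝ (⊤ : ℕ∞) g1
  smooth_g2 : ContDiff ℝ (⊤ : ℕ∞) g2
  smooth_w1 : ContDiff ℝ (⊤ : ℕ∞) w1
  smooth_w2 : ContDiff ℝ (⊤ : ℕ∞) w2
  deriv_u : ∀ p : R2, pu f p =
    ((-1 - g1 p.1 ^ 2) * w1 p.1 / 2, (1 - g1 p.1 ^ 2) * w1 p.1 / 2, g1 p.1 * w1 p.1)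
  deriv_v : ∀ p : R2, pv f p =
    ((1 + g2 p.2 ^ 2) * w2 p.2 / 2, (1 - g2 p.2 ^ 2) * w2 p.2 / 2, -(g2 p.2 * w2 p.2))
  dense_immersion : Dense {p : R2 | Function.Injective (fderiv ℝ f p)}

/-- `Φ` is a germ of diffeomorphism at `p`. -/
def IsLocalDiffeoAt {E F : Type*} [NormedAddCommGroup E] [NormedSpace ℝ E]
    [NormedAddCommGroup F] [NormedSpace ℝ F] (Φ : E → F) (p : E) : Prop :=
  ∃ (U : Set E) (V : Set F) (Φinv : F → E),
    IsOpen U ∧ p ∈ U ∧ IsOpen V ∧ Φ p ∈ V ∧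
    ContDiffOn ℝ (⊤ : ℕ∞) Φ U ∧ ContDiffOn ℝ (⊤ : ℕ∞) Φinv V ∧
    Set.MapsTo Φ U V ∧ Set.MapsTo Φinv V U ∧
    (∀ x ∈ U, Φinv (Φ x) = x) ∧ (∀ y ∈ V, Φ (Φinv y) = y)

/-- 𝒜-equivalence of the germ of `f1` at `p1` and the germ of `f2` at `p2`. -/
def AEquiv (f1 : R2 → R3) (p1 : R2) (f2 : R2 → R3) (p2 : R2) : Prop :=
  ∃ (Φ : R2 → R2) (Ψ : R3 → R3),
    IsLocalDiffeoAt Φ p1 ∧ Φ p1 = p2 ∧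
    IsLocalDiffeoAt Ψ (f1 p1) ∧ Ψ (f1 p1) = f2 p2 ∧
    ∀ᶠ x in nhds p1, Ψ (f1 x) = f2 (Φ x)

/-- The canonical unit normal of a generalized timelike minimal surface. -/
def gtmsNormal (g1 g2 : ℝ → ℝ) (p : R2) : R3 :=
  (Real.sqrt ((1 - g1 p.1 * g2 p.2) ^ 2 + 2 * (g1 p.1 + g2 p.2) ^ 2))⁻¹ •
    (g1 p.1 + g2 p.2, -g1 p.1 + g2 p.2, 1 + g1 p.1 * g2 p.2)

/-- The signed area density function `λ = det(f_u, f_v, n)`. -/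
def areaDensity (f : R2 → R3) (g1 g2 : ℝ → ℝ) (p : R2) : ℝ :=
  det3 (pu f p) (pv f p) (gtmsNormal g1 g2 p)

/-- `f` is a front at `p`: the Legendrian lift `(f, n)` is an immersion at `p`,
where `n` is the canonical unit normal. -/
def IsFrontAt (f : R2 → R3) (g1 g2 : ℝ → ℝ) (p : R2) : Prop :=
  Function.Injective (fderiv ℝ (fun q => (f q, gtmsNormal g1 g2 q)) p)

/-- The differential of `f` at `p` has rank one. -/
def RankOne (f : R2 → R3) (p : R2) : Prop :=
  LinearMap.rank (fderiv ℝ f p).toLinearMap = 1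

/-- Directional derivative of `F` along the vector field `X`. -/
def vD (X : R2 → R2) (F : R2 → R3) : R2 → R3 := fun q => fderiv ℝ F q (X q)

/-- `φ_i = g_i' / (g_i² ω_i)`. -/
def phiW (g w : ℝ → ℝ) : ℝ → ℝ := fun t => deriv g t / (g t ^ 2 * w t)
/-- `Φ_i = (g_i/g_i') φ_i'`. -/
def PhiW (g w : ℝ → ℝ) : ℝ → ℝ := fun t => g t / deriv g t * deriv (phiW g w) t

/-- standard cuspidal butterfly -/
def fCBF : R2 → R3 := fun q =>
  (q.1, 5 * q.2 ^ 4 + 2 * q.1 * q.2, 4 * q.2 ^ 5 + q.1 * q.2 ^ 2 - q.1 ^ 2)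
/-- standard cuspidal S₁⁺ singularity -/
def fCS1p : R2 → R3 := fun q => (q.1, q.2 ^ 2, q.2 ^ 3 * (q.1 ^ 2 + q.2 ^ 2))
/-- standard cuspidal S₁⁻ singularity -/
def fCS1m : R2 → R3 := fun q => (q.1, q.2 ^ 2, q.2 ^ 3 * (q.1 ^ 2 - q.2 ^ 2))
/-- standard cuspidal edge -/
def fCE : R2 → R3 := fun q => (q.1, q.2 ^ 2, q.2 ^ 3)
/-- standard (2,5)-cuspidal edge -/
def fCE25 : R2 → R3 := fun q => (q.1, q.2 ^ 2, q.2 ^ 5)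
/-- standard cuspidal beaks -/
def fCBK : R2 → R3 := fun q =>
  (q.2, q.1 ^ 3 - q.1 * q.2 ^ 2, 3 * q.1 ^ 4 - 2 * q.1 ^ 2 * q.2 ^ 2)
/-- standard cuspidal lips -/
def fCLP : R2 → R3 := fun q =>
  (q.2, q.1 ^ 3 + q.1 * q.2 ^ 2, 3 * q.1 ^ 4 + 2 * q.1 ^ 2 * q.2 ^ 2)
/-- standard D₄⁺ singularity -/
def fD4p : R2 → R3 := fun q =>
  (q.1 * q.2, q.1 ^ 2 + 3 * q.2 ^ 2, q.1 ^ 2 * q.2 + q.2 ^ 3)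
/-- standard D₄⁻ singularity -/
def fD4m : R2 → R3 := fun q =>
  (q.1 * q.2, q.1 ^ 2 - 3 * q.2 ^ 2, q.1 ^ 2 * q.2 - q.2 ^ 3)

section CuspidalButterfly

open Topology ContDiff MeasureTheory
open scoped FourierTransform SchwartzMap

theorem hasFDerivAt_integral_of_dominated_iteratedFDeriv {Ω E F : Type} [MeasurableSpace Ω]
    {μ : Measure Ω}
    [NormedAddCommGroup E] [NormedSpace ℝ E] [NormedAddCommGroup F] [NormedSpace ℝ F]
    {h : Ω → E → F} (hs : ∀ a, ContDiff ℝ ∞ (h a))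
    (hm : ∀ k x, AEStronglyMeasurable (fun a => iteratedFDeriv ℝ k (h a) x) μ)
    (hb : ∀ k x₀, ∃ s ∈ 𝓝 x₀, ∃ b : Ω → ℝ, Integrable b μ ∧
      ∀ a, ∀ x ∈ s, ‖iteratedFDeriv ℝ k (h a) x‖ ≤ b a) (x₀ : E) :
    HasFDerivAt (fun x => ∫ a, h a x ∂μ) (∫ a, fderiv ℝ (h a) x₀ ∂μ) x₀ := by
  have h0 : ∀ x, AEStronglyMeasurable (fun a => h a x) μ := fun x => by
    simpa [iteratedFDeriv_zero_eq_comp] using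
      (continuousMultilinearCurryFin0 ℝ E F).continuous.comp_aestronglyMeasurable (hm 0 x)
  have h1 : ∀ x, AEStronglyMeasurable (fun a => fderiv ℝ (h a) x) μ := fun x => by
    have := (continuousMultilinearCurryFin1 ℝ E F).continuous.comp_aestronglyMeasurable (hm 1 x)
    refine this.congr (Eventually.of_forall fun a => ?_)
    ext v
    simp
  obtain ⟨s, hsx, b, hbi, hbb⟩ := hb 1 x₀
  obtain ⟨s', hsx', b', hbi', hbb'⟩ := hb 0 x₀
  refine hasFDerivAt_integral_of_dominated_of_fderiv_le (F := fun x a => h a x)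
    (F' := fun x a => fderiv ℝ (h a) x) hsx
    (Eventually.of_forall h0) ?_ (h1 x₀) (bound := b) ?_ hbi ?_
  · refine hbi'.mono' (h0 x₀) (Eventually.of_forall fun a => ?_)
    simpa using hbb' a x₀ (mem_of_mem_nhds hsx')
  · refine Eventually.of_forall fun a x hx => ?_
    simpa [norm_iteratedFDeriv_one] using hbb a x hx
  · refine Eventually.of_forall fun a x _ => ?_
    exact ((hs a).differentiable (by simp)).differentiableAt.hasFDerivAt

theorem contDiff_integral_of_dominated_iteratedFDeriv {Ω E F : Type} [MeasurableSpace Ω]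
    {μ : Measure Ω}
    [NormedAddCommGroup E] [NormedSpace ℝ E] [NormedAddCommGroup F] [NormedSpace ℝ F]
    {h : Ω → E → F} (hs : ∀ a, ContDiff ℝ ∞ (h a))
    (hm : ∀ k x, AEStronglyMeasurable (fun a => iteratedFDeriv ℝ k (h a) x) μ)
    (hb : ∀ k x₀, ∃ s ∈ 𝓝 x₀, ∃ b : Ω → ℝ, Integrable b μ ∧
      ∀ a, ∀ x ∈ s, ‖iteratedFDeriv ℝ k (h a) x‖ ≤ b a) :
    ContDiff ℝ ∞ (fun x => ∫ a, h a x ∂μ) := by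
  refine contDiff_infty.2 fun n => ?_
  induction n generalizing F with
  | zero =>
    exact contDiff_zero.2 <| continuous_iff_continuousAt.2 fun x =>
      (hasFDerivAt_integral_of_dominated_iteratedFDeriv hs hm hb x).continuousAt
  | succ n ih =>
    push_cast
    refine contDiff_succ_iff_hasFDerivAt.2 ⟨fun x => ∫ a, fderiv ℝ (h a) x ∂μ, ?_,
      fun x => hasFDerivAt_integral_of_dominated_iteratedFDeriv hs hm hb x⟩
    refine ih (h := fun a => fderiv ℝ (h a)) (fun a => (hs a).fderiv_right (by simp)) ?_ ?_
    · intro k x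
      have := (continuousMultilinearCurryRightEquiv' ℝ k E F).continuous.comp_aestronglyMeasurable
        (hm (k + 1) x)
      refine this.congr (Eventually.of_forall fun a => ?_)
      simp [iteratedFDeriv_succ_eq_comp_right]
    · intro k x₀
      obtain ⟨s, hsx, b, hbi, hbb⟩ := hb (k + 1) x₀
      refine ⟨s, hsx, b, hbi, fun a x hx => ?_⟩
      rw [norm_iteratedFDeriv_fderiv]
      exact hbb a x hx

theorem contDiff_uncurry_iteratedFDeriv {Ω E F : Type} [NormedAddCommGroup Ω] [NormedSpace ℝ Ω]
    [NormedAddCommGroup E] [NormedSpace ℝ E] [NormedAddCommGroup F] [NormedSpace ℝ F]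
    {h : Ω → E → F} (hs : ContDiff ℝ ∞ (fun q : Ω × E => h q.1 q.2)) (k : ℕ) :
    ContDiff ℝ ∞ (fun q : Ω × E => iteratedFDeriv ℝ k (h q.1) q.2) := by
  induction k with
  | zero =>
    exact (continuousMultilinearCurryFin0 ℝ E F).symm.contDiff.comp hs
  | succ k ih =>
    have h1 : ContDiff ℝ ∞ (fun q : Ω × E => fderiv ℝ (iteratedFDeriv ℝ k (h q.1)) q.2) := by
      refine ContDiff.fderiv (n := ∞) (f := fun q : Ω × E => iteratedFDeriv ℝ k (h q.1)) ?_
        contDiff_snd (m := ∞) (by simp)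
      exact ih.comp ((contDiff_fst.fst).prodMk contDiff_snd)
    exact
      (continuousMultilinearCurryLeftEquiv ℝ (fun _ : Fin (k + 1) => E) F).symm.contDiff.comp h1

theorem contDiff_intervalIntegral {E F : Type}
    [NormedAddCommGroup E] [NormedSpace ℝ E] [FiniteDimensional ℝ E]
    [NormedAddCommGroup F] [NormedSpace ℝ F]
    {h : ℝ → E → F} (hs : ContDiff ℝ ∞ (fun q : ℝ × E => h q.1 q.2)) :
    ContDiff ℝ ∞ (fun x => ∫ r in (0 : ℝ)..1, h r x) := by
  have : ProperSpace E := FiniteDimensional.proper ℝ E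
  simp only [intervalIntegral.integral_of_le zero_le_one, ← integral_Icc_eq_integral_Ioc]
  let χ : ℝ → ℝ := fun r => max 0 (min r 1)
  have hχ : ∀ r, χ r ∈ Set.Icc (0 : ℝ) 1 := fun r => by simp [χ]
  have hχ' : ∀ r ∈ Set.Icc (0 : ℝ) 1, χ r = r := fun r hr => by
    simp [χ, hr.1, hr.2]
  have e : (fun x => ∫ r in Set.Icc (0 : ℝ) 1, h r x) =
      fun x => ∫ r in Set.Icc (0 : ℝ) 1, h (χ r) x := by
    ext x
    exact setIntegral_congr_fun measurableSet_Icc fun r hr => by simp only [hχ' r hr]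
  rw [e]
  refine contDiff_integral_of_dominated_iteratedFDeriv ?_ ?_ ?_
  · intro r
    exact hs.comp (contDiff_const.prodMk contDiff_id)
  · intro k x
    refine Continuous.aestronglyMeasurable ?_
    exact (contDiff_uncurry_iteratedFDeriv hs k).continuous.comp
      (Continuous.prodMk (by fun_prop) continuous_const)
  · intro k x₀
    obtain ⟨C, hC⟩ := ((isCompact_Icc (a := (0 : ℝ)) (b := 1)).prod
      (isCompact_closedBall x₀ 1)).exists_bound_of_continuousOn
      (contDiff_uncurry_iteratedFDeriv hs k).continuous.continuousOn
    refine ⟨Metric.closedBall x₀ 1, Metric.closedBall_mem_nhds _ one_pos, fun _ => C,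
      integrable_const _, fun r x hx => hC (χ r, x) ⟨hχ r, hx⟩⟩

theorem exists_eq_add_mul_of_contDiff {E : Type} [NormedAddCommGroup E] [NormedSpace ℝ E]
    [FiniteDimensional ℝ E]
    {f : ℝ → E → ℝ} (hf : ContDiff ℝ ∞ (fun q : ℝ × E => f q.1 q.2)) :
    ∃ g : ℝ → E → ℝ, ContDiff ℝ ∞ (fun q : ℝ × E => g q.1 q.2) ∧
      ∀ t y, f t y = f 0 y + t * g t y := by
  have hd : ContDiff ℝ ∞ (fun q : ℝ × E => deriv (fun s => f s q.2) q.1) := by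
    have : ContDiff ℝ ∞ (fun q : ℝ × E => fderiv ℝ (fun s => f s q.2) q.1) := by
      refine ContDiff.fderiv (n := ∞) (f := fun (q : ℝ × E) s => f s q.2) ?_ contDiff_fst (m := ∞) (by simp)
      exact hf.comp (contDiff_snd.prodMk (contDiff_fst.snd))
    exact this.clm_apply contDiff_const
  refine ⟨fun t y => ∫ r in (0 : ℝ)..1, deriv (fun s => f s y) (r * t), ?_, fun t y => ?_⟩
  · refine contDiff_intervalIntegral (E := ℝ × E)
      (h := fun r q => deriv (fun s => f s q.2) (r * q.1)) ?_
    exact hd.comp ((contDiff_fst.mul contDiff_snd.fst).prodMk contDiff_snd.snd)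
  · have hfy : ContDiff ℝ ∞ (fun s => f s y) := hf.comp (contDiff_id.prodMk contDiff_const)
    have h1 : ∀ r : ℝ, HasDerivAt (fun r => f (r * t) y) (deriv (fun s => f s y) (r * t) * t) r :=
      fun r => HasDerivAt.comp (h := fun r => r * t) r
        ((hfy.differentiable (by simp)).differentiableAt.hasDerivAt (x := r * t))
        (by simpa using (hasDerivAt_id r).mul_const t)
    have h2 := intervalIntegral.integral_eq_sub_of_hasDerivAt (a := 0) (b := 1)
      (fun r _ => h1 r) (by
        refine Continuous.intervalIntegrable ?_ _ _
        have : Continuous (deriv (fun s => f s y)) := hfy.continuous_deriv (by simp)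
        fun_prop)
    rw [intervalIntegral.integral_mul_const] at h2
    simp only [one_mul, zero_mul] at h2
    linarith

theorem exists_eq_pow_mul_of_deriv_eq {g ρ : ℝ → ℝ} {j : ℕ} (hg : ContDiff ℝ ∞ g)
    (hρ : ContDiff ℝ ∞ ρ) (h0 : g 0 = 0) (h : ∀ᶠ m in 𝓝 0, deriv g m = m ^ j * ρ m) :
    ∃ κ : ℝ → ℝ, ContDiff ℝ ∞ κ ∧ κ 0 = ρ 0 / (j + 1) ∧ ∀ᶠ m in 𝓝 0, g m = m ^ (j + 1) * κ m := by
  refine ⟨fun m => ∫ r in (0 : ℝ)..1, r ^ j * ρ (r * m), ?_, ?_, ?_⟩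
  · refine contDiff_intervalIntegral (h := fun r m => r ^ j * ρ (r * m)) ?_
    fun_prop
  · simp [intervalIntegral.integral_mul_const]
    ring
  · obtain ⟨ε, hε, hb⟩ := Metric.eventually_nhds_iff_ball.1 h
    filter_upwards [Metric.ball_mem_nhds 0 hε] with m hm
    have h1 : ∀ r : ℝ, HasDerivAt (fun r => g (r * m)) (deriv g (r * m) * m) r :=
      fun r => HasDerivAt.comp (h := fun r => r * m) r
        ((hg.differentiable (by simp)).differentiableAt.hasDerivAt (x := r * m))
        (by simpa using (hasDerivAt_id r).mul_const m)
    have h2 := intervalIntegral.integral_eq_sub_of_hasDerivAt (a := 0) (b := 1)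
      (fun r _ => h1 r) (by
        refine Continuous.intervalIntegrable ?_ _ _
        have : Continuous (deriv g) := hg.continuous_deriv (by simp)
        fun_prop)
    simp only [one_mul, zero_mul, h0, sub_zero] at h2
    rw [← h2, ← intervalIntegral.integral_const_mul]
    refine intervalIntegral.integral_congr fun r hr => ?_
    rw [Set.uIcc_of_le zero_le_one] at hr
    rw [hb (r * m) ?_]
    · ring
    · simp only [Metric.mem_ball, dist_zero_right, norm_mul, Real.norm_eq_abs] at hm ⊢
      rw [abs_of_nonneg hr.1]
      nlinarith [abs_nonneg m, hr.1, hr.2]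

/-- A family of smooth maps each of whose derivatives is, locally uniformly in the variable,
bounded by a power of the weight `N` of the parameter. -/
structure PolyBounded {Ω E F : Type} [NormedAddCommGroup E] [NormedSpace ℝ E]
    [NormedAddCommGroup F] [NormedSpace ℝ F] (N : Ω → ℝ) (h : Ω → E → F) : Prop where
  smooth : ∀ a, ContDiff ℝ ∞ (h a)
  bound : ∀ (k : ℕ) (ρ : ℝ), ∃ (C : ℝ) (M : ℕ), ∀ a x, ‖x‖ ≤ ρ →
    ‖iteratedFDeriv ℝ k (h a) x‖ ≤ C * N a ^ M

namespace PolyBounded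

variable {Ω E F G A : Type} [NormedAddCommGroup E] [NormedSpace ℝ E]
    [NormedAddCommGroup F] [NormedSpace ℝ F] [NormedAddCommGroup G] [NormedSpace ℝ G]
    [NormedRing A] [NormedAlgebra ℝ A] {N : Ω → ℝ}

theorem bound_le (hN : ∀ a, 1 ≤ N a) {h : Ω → E → F} (H : PolyBounded N h) (k : ℕ) (ρ : ℝ) :
    ∃ (C : ℝ) (M : ℕ), 1 ≤ C ∧ ∀ i ≤ k, ∀ a x, ‖x‖ ≤ ρ →
      ‖iteratedFDeriv ℝ i (h a) x‖ ≤ C * N a ^ M := by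
  choose C M hCM using fun k => H.bound k ρ
  refine ⟨1 + ∑ i ∈ Finset.range (k + 1), |C i|, ∑ i ∈ Finset.range (k + 1), M i, ?_, ?_⟩
  · have : 0 ≤ ∑ i ∈ Finset.range (k + 1), |C i| := Finset.sum_nonneg fun i _ => abs_nonneg _
    linarith
  · intro i hi a x hx
    have hi' : i ∈ Finset.range (k + 1) := by simp; omega
    refine (hCM i a x hx).trans ?_
    have h1 : C i ≤ 1 + ∑ i ∈ Finset.range (k + 1), |C i| :=
      (le_abs_self _).trans <| (Finset.single_le_sum (f := fun i => |C i|)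
        (fun i _ => abs_nonneg _) hi').trans (by simp)
    have h2 : N a ^ M i ≤ N a ^ ∑ i ∈ Finset.range (k + 1), M i :=
      pow_le_pow_right₀ (hN a) (Finset.single_le_sum (f := M) (fun i _ => Nat.zero_le _) hi')
    have h3 : (0 : ℝ) ≤ N a ^ M i := pow_nonneg (zero_le_one.trans (hN a)) _
    have h4 : 0 ≤ 1 + ∑ i ∈ Finset.range (k + 1), |C i| :=
      add_nonneg zero_le_one (Finset.sum_nonneg fun i _ => abs_nonneg _)
    exact mul_le_mul h1 h2 h3 h4

theorem const {c : Ω → F} (C : ℝ) (M : ℕ) (hc : ∀ a, ‖c a‖ ≤ C * N a ^ M) :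
    PolyBounded N (fun a (_ : E) => c a) where
  smooth _ := contDiff_const
  bound k ρ := by
    rcases Nat.eq_zero_or_pos k with rfl | hk
    · exact ⟨C, M, fun a x _ => by simpa using hc a⟩
    · refine ⟨0, 0, fun a x _ => ?_⟩
      rw [iteratedFDeriv_const_of_ne hk.ne']
      simp

theorem of_contDiff [FiniteDimensional ℝ E] {f : E → F}
    (hf : ContDiff ℝ ∞ f) : PolyBounded N (fun _ => f) where
  smooth _ := hf
  bound k ρ := by
    have : ProperSpace E := FiniteDimensional.proper ℝ E
    obtain ⟨C, hC⟩ := (isCompact_closedBall (0 : E) ρ).exists_bound_of_continuousOn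
      (hf.continuous_iteratedFDeriv (m := k) (by exact_mod_cast le_top)).continuousOn
    exact ⟨C, 0, fun a x hx => by simpa using hC x (by simpa using hx)⟩

theorem add (hN : ∀ a, 1 ≤ N a) {h h' : Ω → E → F} (H : PolyBounded N h)
    (H' : PolyBounded N h') : PolyBounded N (fun a x => h a x + h' a x) where
  smooth a := (H.smooth a).add (H'.smooth a)
  bound k ρ := by
    obtain ⟨C, M, hC, hM⟩ := H.bound_le hN k ρ
    obtain ⟨C', M', hC', hM'⟩ := H'.bound_le hN k ρ
    refine ⟨C + C', M + M', fun a x hx => ?_⟩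
    have e : iteratedFDeriv ℝ k (fun x => h a x + h' a x) x =
        iteratedFDeriv ℝ k (h a) x + iteratedFDeriv ℝ k (h' a) x :=
      iteratedFDeriv_add_apply ((H.smooth a).of_le (by exact_mod_cast le_top)).contDiffAt
        ((H'.smooth a).of_le (by exact_mod_cast le_top)).contDiffAt
    rw [e]
    refine (norm_add_le _ _).trans ?_
    rw [add_mul]
    have h1 : N a ^ M ≤ N a ^ (M + M') := pow_le_pow_right₀ (hN a) (by omega)
    have h2 : N a ^ M' ≤ N a ^ (M + M') := pow_le_pow_right₀ (hN a) (by omega)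
    exact add_le_add ((hM k le_rfl a x hx).trans (by gcongr))
      ((hM' k le_rfl a x hx).trans (by gcongr))

theorem mul (hN : ∀ a, 1 ≤ N a) {h h' : Ω → E → A} (H : PolyBounded N h)
    (H' : PolyBounded N h') : PolyBounded N (fun a x => h a x * h' a x) where
  smooth a := (H.smooth a).mul (H'.smooth a)
  bound k ρ := by
    obtain ⟨C, M, hC, hM⟩ := H.bound_le hN k ρ
    obtain ⟨C', M', hC', hM'⟩ := H'.bound_le hN k ρ
    refine ⟨∑ i ∈ Finset.range (k + 1), (k.choose i : ℝ) * C * C', M + M', fun a x hx => ?_⟩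
    refine (norm_iteratedFDeriv_mul_le (H.smooth a) (H'.smooth a) x
      (by exact_mod_cast le_top)).trans ?_
    rw [Finset.sum_mul]
    refine Finset.sum_le_sum fun i hi => ?_
    have hi : i ≤ k := by simp at hi; omega
    have h1 := hM i hi a x hx
    have h2 := hM' (k - i) (by omega) a x hx
    have h3 : (0 : ℝ) ≤ N a ^ M := pow_nonneg (zero_le_one.trans (hN a)) _
    calc _ ≤ (k.choose i : ℝ) * (C * N a ^ M) * (C' * N a ^ M') := by gcongr
      _ = _ := by ring

theorem comp (hN : ∀ a, 1 ≤ N a) {g : Ω → F → G} (hg : ∀ a, ContDiff ℝ ∞ (g a))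
    (hgb : ∀ k : ℕ, ∃ C, ∀ a y, ‖iteratedFDeriv ℝ k (g a) y‖ ≤ C) {h : Ω → E → F}
    (H : PolyBounded N h) : PolyBounded N (fun a x => g a (h a x)) where
  smooth a := (hg a).comp (H.smooth a)
  bound k ρ := by
    obtain ⟨C, M, hC, hM⟩ := H.bound_le hN k ρ
    choose B hB using hgb
    refine ⟨k.factorial * (∑ i ∈ Finset.range (k + 1), |B i|) * C ^ k, M * k, fun a x hx => ?_⟩
    have h1 : 1 ≤ C * N a ^ M := one_le_mul_of_one_le_of_one_le hC (one_le_pow₀ (hN a))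
    refine (norm_iteratedFDeriv_comp_le (C := ∑ i ∈ Finset.range (k + 1), |B i|)
      (D := C * N a ^ M) (hg a) (H.smooth a) (by exact_mod_cast le_top) x ?_ ?_).trans ?_
    · intro i hi
      exact (hB i a _).trans <| (le_abs_self _).trans <| Finset.single_le_sum (f := fun i => |B i|)
        (fun i _ => abs_nonneg _) (by simp; omega)
    · intro i hi1 hi
      exact (hM i hi a x hx).trans (le_self_pow₀ h1 (by omega))
    · rw [mul_pow, ← pow_mul, ← mul_assoc]

theorem clm {L : Ω → E →L[ℝ] F} (C : ℝ) (M : ℕ) (hL : ∀ a, ‖L a‖ ≤ C * N a ^ M) :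
    PolyBounded N (fun a x => L a x) where
  smooth a := (L a).contDiff
  bound k ρ := by
    rcases k with _ | _ | k
    · refine ⟨C * |ρ|, M, fun a x hx => ?_⟩
      rw [norm_iteratedFDeriv_zero]
      calc ‖L a x‖ ≤ ‖L a‖ * ‖x‖ := (L a).le_opNorm x
        _ ≤ (C * N a ^ M) * |ρ| :=
          mul_le_mul (hL a) (hx.trans (le_abs_self ρ)) (norm_nonneg _) ((norm_nonneg _).trans (hL a))
        _ = _ := by ring
    · refine ⟨C, M, fun a x hx => ?_⟩
      rw [zero_add, norm_iteratedFDeriv_one, ContinuousLinearMap.fderiv]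
      exact hL a
    · refine ⟨0, 0, fun a x hx => ?_⟩
      have : fderiv ℝ (fun x => L a x) = fun _ => L a := funext fun x => (L a).fderiv
      rw [← norm_iteratedFDeriv_fderiv, this, iteratedFDeriv_const_of_ne (by simp)]
      simp

end PolyBounded

theorem exists_contDiff_eq_inv : ∃ G : ℂ → ℂ, ContDiff ℝ ∞ G ∧ (∀ z, 1 ≤ ‖z‖ → G z = z⁻¹) ∧
    ∀ k : ℕ, ∃ C, ∀ z, ‖iteratedFDeriv ℝ k G z‖ ≤ C := by
  let χ : ContDiffBump (0 : ℂ) := ⟨1 / 4, 1 / 2, by norm_num, by norm_num⟩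
  let G : ℂ → ℂ := fun z => ((1 - χ z : ℝ) : ℂ) * z⁻¹
  have hG1 : ∀ z, 1 / 2 ≤ ‖z‖ → G z = z⁻¹ := fun z hz => by
    have : χ z = 0 := χ.zero_of_le_dist (by rw [dist_zero_right]; exact hz)
    simp [G, this]
  have hG : ContDiff ℝ ∞ G := by
    refine contDiff_iff_contDiffAt.2 fun z => ?_
    by_cases hz : z = 0
    · subst hz
      refine (contDiffAt_const (c := (0 : ℂ))).congr_of_eventuallyEq ?_
      filter_upwards [χ.eventuallyEq_one] with z hz
      simp [G, hz]
    · have h1 : ContDiffAt ℝ ∞ (fun z : ℂ => z⁻¹) z := (contDiffAt_inv ℂ hz).restrict_scalars ℝ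
      have h2 : ContDiffAt ℝ ∞ (fun z : ℂ => ((1 - χ z : ℝ) : ℂ)) z :=
        Complex.ofRealCLM.contDiff.contDiffAt.comp z (contDiffAt_const.sub χ.contDiffAt)
      exact h2.mul h1
  refine ⟨G, hG, fun z hz => hG1 z (by linarith), fun k => ?_⟩
  have hcpt : ∀ k : ℕ, ∃ C, ∀ z ∈ Metric.closedBall (0 : ℂ) 1, ‖iteratedFDeriv ℝ k G z‖ ≤ C :=
    fun k => (isCompact_closedBall (0 : ℂ) 1).exists_bound_of_continuousOn
      (hG.continuous_iteratedFDeriv (m := k) (by exact_mod_cast le_top)).continuousOn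
  suffices H : ∀ k : ℕ, ∃ C, ∀ z, 1 < ‖z‖ → ‖iteratedFDeriv ℝ k G z‖ ≤ C by
    obtain ⟨C, hC⟩ := H k
    obtain ⟨C', hC'⟩ := hcpt k
    refine ⟨max C C', fun z => ?_⟩
    rcases lt_or_ge 1 ‖z‖ with h | h
    · exact (hC z h).trans (le_max_left _ _)
    · exact (hC' z (by simpa using h)).trans (le_max_right _ _)
  intro k
  induction k using Nat.strong_induction_on with
  | _ k ih =>
    rcases k with _ | k
    · refine ⟨1, fun z hz => ?_⟩
      rw [norm_iteratedFDeriv_zero, hG1 z (by linarith), norm_inv]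
      exact inv_le_one_of_one_le₀ hz.le
    · choose! C hC using ih
      let L : ℂ →L[ℝ] (ℂ →L[ℝ] ℂ) := ContinuousLinearMap.mul ℝ ℂ
      refine ⟨‖L‖ * ∑ i ∈ Finset.range (k + 1), (k.choose i : ℝ) * C i * C (k - i),
        fun z hz => ?_⟩
      rw [← norm_iteratedFDeriv_fderiv]
      have e : fderiv ℝ G =ᶠ[𝓝 z] fun z => (-L) (G z * G z) := by
        have ho : IsOpen {z : ℂ | 1 < ‖z‖} := isOpen_lt continuous_const continuous_norm
        filter_upwards [ho.mem_nhds hz] with y hy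
        have hy0 : y ≠ 0 := norm_pos_iff.1 (zero_lt_one.trans hy)
        have e1 : G =ᶠ[𝓝 y] fun z => z⁻¹ := by
          filter_upwards [ho.mem_nhds hy] with x hx
          exact hG1 x (by have : 1 < ‖x‖ := hx; linarith)
        rw [e1.fderiv_eq]
        have := ((hasDerivAt_inv hy0).hasFDerivAt.restrictScalars ℝ).fderiv
        rw [this, hG1 y (by have : 1 < ‖y‖ := hy; linarith)]
        (ext; simp [L]; field_simp)
      have hGG : ContDiff ℝ ∞ fun z => G z * G z := hG.mul hG
      rw [(Filter.EventuallyEq.iteratedFDeriv ℝ e k).eq_of_nhds]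
      have := (-L).norm_iteratedFDeriv_comp_left (f := fun z => G z * G z) (x := z)
        hGG.contDiffAt (n := k) (by exact_mod_cast le_top)
      rw [norm_neg] at this
      refine this.trans ?_
      gcongr
      refine (norm_iteratedFDeriv_mul_le hG hG z (by exact_mod_cast le_top)).trans ?_
      refine Finset.sum_le_sum fun i hi => ?_
      have hi : i ≤ k := by simp at hi; omega
      have h1 := hC i (by omega) z hz
      have h2 := hC (k - i) (by omega) z hz
      have h0 : 0 ≤ C i := (norm_nonneg _).trans h1
      gcongr

theorem contDiff_integral_of_polyBounded {Ω E ι : Type} [NormedAddCommGroup Ω] [NormedSpace ℝ Ω]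
    [MeasurableSpace Ω] [BorelSpace Ω] [SecondCountableTopology Ω] {μ : Measure Ω}
    [NormedAddCommGroup E] [NormedSpace ℝ E] [Countable ι] {N : Ω → ℝ}
    {idx : Ω → ι} (hidx : ∀ i, MeasurableSet (idx ⁻¹' {i})) {J : ι → Ω → E → ℂ}
    (hJ : ∀ i, ContDiff ℝ ∞ (fun q : Ω × E => J i q.1 q.2)) {w : Ω → ℂ} (hw : Continuous w)
    (hPB : PolyBounded N (fun a => J (idx a) a))
    (hint : ∀ M : ℕ, Integrable (fun a => ‖w a‖ * N a ^ M) μ) :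
    ContDiff ℝ ∞ (fun x => ∫ a, w a * J (idx a) a x ∂μ) ∧
      ∀ x, Integrable (fun a => w a * J (idx a) a x) μ := by
  have hm : ∀ k x, AEStronglyMeasurable
      (fun a => iteratedFDeriv ℝ k (fun x => w a * J (idx a) a x) x) μ := by
    intro k x
    have hU : (⋃ i, idx ⁻¹' {i}) = Set.univ := by
      ext a
      simp
    rw [← Measure.restrict_univ (μ := μ), ← hU, aestronglyMeasurable_iUnion_iff]
    intro i
    have h1 : Continuous fun a => w a • iteratedFDeriv ℝ k (J i a) x :=
      hw.smul ((contDiff_uncurry_iteratedFDeriv (hJ i) k).continuous.comp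
        (continuous_id.prodMk continuous_const))
    refine h1.aestronglyMeasurable.congr ?_
    filter_upwards [ae_restrict_mem (hidx i)] with a ha
    have ha : idx a = i := ha
    have := iteratedFDeriv_const_smul_apply (i := k) (a := w a) (f := J (idx a) a) (x := x)
      ((hPB.smooth a).contDiffAt.of_le (by exact_mod_cast le_top))
    simp only [smul_eq_mul, ← ha, Pi.smul_def] at this ⊢
    exact this.symm
  have hb : ∀ (k : ℕ) (ρ : ℝ), ∃ b : Ω → ℝ, Integrable b μ ∧
      ∀ a x, ‖x‖ ≤ ρ → ‖iteratedFDeriv ℝ k (fun x => w a * J (idx a) a x) x‖ ≤ b a := by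
    intro k ρ
    obtain ⟨C, M, hCM⟩ := hPB.bound k ρ
    refine ⟨fun a => ‖w a‖ * N a ^ M * C, (hint M).mul_const C, fun a x hx => ?_⟩
    have := iteratedFDeriv_const_smul_apply (i := k) (a := w a) (f := J (idx a) a) (x := x)
      ((hPB.smooth a).contDiffAt.of_le (by exact_mod_cast le_top))
    simp only [smul_eq_mul, Pi.smul_def] at this
    rw [this, norm_smul]
    refine le_of_le_of_eq (b := ‖w a‖ * (C * N a ^ M)) ?_ (by ring)
    exact mul_le_mul_of_nonneg_left (hCM a x hx) (norm_nonneg _)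
  refine ⟨contDiff_integral_of_dominated_iteratedFDeriv
    (fun a => contDiff_const.mul (hPB.smooth a)) hm fun k x₀ => ?_, fun x => ?_⟩
  · obtain ⟨b, hb1, hb2⟩ := hb k (‖x₀‖ + 1)
    refine ⟨Metric.ball x₀ 1, Metric.ball_mem_nhds _ one_pos, b, hb1, fun a x hx => hb2 a x ?_⟩
    have := norm_le_norm_add_norm_sub' x x₀
    rw [Metric.mem_ball, dist_eq_norm] at hx
    linarith
  · obtain ⟨b, hb1, hb2⟩ := hb 0 ‖x‖
    have h0 := hm 0 x
    refine hb1.mono' ?_ (Eventually.of_forall fun a => by simpa using hb2 a x le_rfl)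
    simpa [iteratedFDeriv_zero_eq_comp] using
      (continuousMultilinearCurryFin0 ℝ E ℂ).continuous.comp_aestronglyMeasurable h0

/-- The versal unfolding `z⁵ + xz² + yz + t` of the quintic monomial. -/
def quintic (ξ : R3) (z : ℂ) : ℂ := z ^ 5 + ξ.1 * z ^ 2 + ξ.2.1 * z + ξ.2.2

theorem exists_quintic_eq_prod (ξ : R3) :
    ∃ r : Fin 5 → ℂ, ∀ z, quintic ξ z = ∏ j, (z - r j) := by
  open Polynomial in
  let q : ℂ[X] := X ^ 5 + (C (ξ.1 : ℂ) * X ^ 2 + C (ξ.2.1 : ℂ) * X + C (ξ.2.2 : ℂ))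
  have hd : (C (ξ.1 : ℂ) * X ^ 2 + C (ξ.2.1 : ℂ) * X + C (ξ.2.2 : ℂ)).degree < 5 :=
    lt_of_le_of_lt degree_quadratic_le (by norm_num)
  have hm : q.Monic := monic_X_pow_add hd
  have hdeg : q.natDegree = 5 := by
    refine natDegree_eq_of_degree_eq_some ?_
    simp only [q]
    rw [add_comm, degree_add_eq_right_of_degree_lt (by simpa using hd)]
    simp
  have hs := IsAlgClosed.splits q
  have hc : q.roots.card = 5 := by rw [← hdeg]; exact hs.natDegree_eq_card_roots.symm
  have hp := hs.eq_prod_roots_of_monic hm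
  obtain ⟨l, hl⟩ := Quot.exists_rep q.roots
  have hl' : q.roots = (l : Multiset ℂ) := hl.symm
  have hlen : l.length = 5 := by rw [← hc, hl']; rfl
  obtain ⟨a, b, c, d, e, rfl⟩ : ∃ a b c d e, l = [a, b, c, d, e] :=
    match l, hlen with
    | [a, b, c, d, e], _ => ⟨a, b, c, d, e, rfl⟩
  refine ⟨![a, b, c, d, e], fun z => ?_⟩
  have h1 : quintic ξ z = q.eval z := by simp [q, quintic]; ring
  rw [h1, hp, hl']
  simp [Fin.prod_univ_five]
  ring

/-- Radius of one of the circles used as contours. -/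
def contourRadius (n : ℝ) (a : ℕ) : ℝ := n + (a + 1) / n

theorem exists_contour_avoiding {n : ℝ} (hn : 1 ≤ n) (c : ℂ) (ξ : R3) :
    ∃ a < 6, ∀ z : ℂ, ‖z - c‖ = contourRadius n a → (1 / (3 * n)) ^ 5 ≤ ‖quintic ξ z‖ := by
  obtain ⟨r, hr⟩ := exists_quintic_eq_prod ξ
  by_contra! H
  have H2 : ∀ a : Fin 6, ∃ j : Fin 5, |‖r j - c‖ - contourRadius n a| < 1 / (3 * n) := by
    intro a
    by_contra! H3
    obtain ⟨z, hz, hz'⟩ := H a a.2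
    refine absurd hz' (not_lt.2 ?_)
    rw [hr, norm_prod]
    have : ∏ _j : Fin 5, (1 / (3 * n)) = (1 / (3 * n)) ^ 5 := by simp
    rw [← this]
    refine Finset.prod_le_prod (fun _ _ => by positivity) fun j _ => (H3 j).trans ?_
    rw [← hz, abs_sub_comm]
    refine (abs_norm_sub_norm_le _ _).trans (le_of_eq ?_)
    congr 1
    ring
  choose J hJ using H2
  obtain ⟨a, a', hne, he⟩ := Fintype.exists_ne_map_eq_of_card_lt J (by simp)
  have h1 := hJ a
  have h2 := hJ a'
  rw [← he] at h2
  have h3 : |contourRadius n a - contourRadius n a'| < 2 * (1 / (3 * n)) := by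
    rw [abs_lt] at *
    constructor <;> linarith
  have h4 : contourRadius n a - contourRadius n a' = ((a : ℝ) - a') * (1 / n) := by
    simp only [contourRadius]
    ring
  have h5 : (1 : ℝ) ≤ |(a : ℝ) - a'| := by
    have : (a : ℤ) - a' ≠ 0 := fun h => hne (Fin.ext (by omega))
    exact_mod_cast Int.one_le_abs this
  rw [h4, abs_mul, abs_of_pos (by positivity : 0 < 1 / n)] at h3
  have h6 : 2 * (1 / (3 * n)) = 2 / 3 * (1 / n) := by field_simp
  have h7 : 0 < 1 / n := by positivity
  nlinarith

/-- Scale of the contour with index `i`. -/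
def contourScale (i : Bool × ℕ × ℕ) : ℝ := i.2.1 + 1

/-- Center of the contour with index `i`. -/
def contourCenter (i : Bool × ℕ × ℕ) : ℂ :=
  (((if i.1 then 1 else -1) * contourScale i : ℝ) : ℂ) * Complex.I

/-- Parametrization of the contour with index `i`. -/
def contour (i : Bool × ℕ × ℕ) (θ : ℝ) : ℂ :=
  circleMap (contourCenter i) (contourRadius (contourScale i) i.2.2) θ

theorem one_le_contourScale (i : Bool × ℕ × ℕ) : 1 ≤ contourScale i := by
  simp [contourScale]

theorem contourScale_le_radius (i : Bool × ℕ × ℕ) :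
    contourScale i ≤ contourRadius (contourScale i) i.2.2 := by
  have := one_le_contourScale i
  have : 0 ≤ ((i.2.2 : ℝ) + 1) / contourScale i := by positivity
  simp only [contourRadius]
  linarith

theorem norm_contour_sub_center (i : Bool × ℕ × ℕ) (θ : ℝ) :
    ‖contour i θ - contourCenter i‖ = contourRadius (contourScale i) i.2.2 := by
  have := contourScale_le_radius i
  have := one_le_contourScale i
  rw [contour, circleMap_sub_center, norm_circleMap_zero, abs_of_nonneg (by linarith)]

/-- The contour with index `i` is adapted to the frequency `τ` and to the quintic at `ξ`. -/
structure AdaptedContour (i : Bool × ℕ × ℕ) (τ : ℝ) (ξ : R3) : Prop where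
  sign : i.1 = decide (0 ≤ τ)
  scale : i.2.1 = ⌈|τ|⌉₊
  lt_six : i.2.2 < 6
  le_quintic : ∀ θ, (1 / (3 * contourScale i)) ^ 5 ≤ ‖quintic ξ (contour i θ)‖

theorem continuous_quintic : Continuous fun q : R3 × ℂ => quintic q.1 q.2 := by
  simp only [quintic]
  fun_prop

theorem exists_measurable_adaptedContour :
    ∃ idx : ℝ × R3 → Bool × ℕ × ℕ, Measurable idx ∧ ∀ q, AdaptedContour (idx q) q.1 q.2 := by
  classical
  have hex : ∀ (bk : Bool × ℕ) (ξ : R3), ∃ a, a < 6 ∧ ∀ θ,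
      (1 / (3 * contourScale (bk.1, bk.2, a))) ^ 5 ≤ ‖quintic ξ (contour (bk.1, bk.2, a) θ)‖ := by
    intro bk ξ
    obtain ⟨a, ha, h⟩ := exists_contour_avoiding (one_le_contourScale (bk.1, bk.2, 0))
      (contourCenter (bk.1, bk.2, 0)) ξ
    exact ⟨a, ha, fun θ => h _ (norm_contour_sub_center (bk.1, bk.2, a) θ)⟩
  obtain ⟨A, hms, hspec⟩ : ∃ A : Bool × ℕ → R3 → ℕ, (∀ bk, Measurable (A bk)) ∧
      ∀ bk ξ, A bk ξ < 6 ∧ ∀ θ, (1 / (3 * contourScale (bk.1, bk.2, A bk ξ))) ^ 5 ≤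
        ‖quintic ξ (contour (bk.1, bk.2, A bk ξ) θ)‖ := by
    refine ⟨fun bk ξ => Nat.find (hex bk ξ), fun bk => ?_, fun bk ξ => Nat.find_spec (hex bk ξ)⟩
    refine measurable_find _ fun a => ?_
    refine (MeasurableSet.const _).inter (IsClosed.measurableSet ?_)
    have h1 : IsClosed (⋂ θ, {ξ : R3 | (1 / (3 * contourScale (bk.1, bk.2, a))) ^ 5 ≤
        ‖quintic ξ (contour (bk.1, bk.2, a) θ)‖}) :=
      isClosed_iInter fun θ => isClosed_le continuous_const
        (continuous_quintic.comp (continuous_id.prodMk continuous_const)).norm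
    rw [← Set.ofPred_forall] at h1
    exact h1
  have hm2 : Measurable fun q : (Bool × ℕ) × R3 => A q.1 q.2 :=
    measurable_from_prod_countable_right hms
  have hmb : Measurable fun τ : ℝ => (decide (0 ≤ τ), ⌈|τ|⌉₊) := by
    refine Measurable.prodMk (measurable_to_bool ?_)
      (Nat.measurable_ceil.comp (measurable_id.norm))
    convert! (measurableSet_Ici (a := (0 : ℝ))) using 1
    ext; simp
  refine ⟨fun q => (decide (0 ≤ q.1), ⌈|q.1|⌉₊, A (decide (0 ≤ q.1), ⌈|q.1|⌉₊) q.2),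
    ?_, fun q => ⟨rfl, rfl, ?_, ?_⟩⟩
  · have h1 : Measurable fun q : ℝ × R3 => (decide (0 ≤ q.1), ⌈|q.1|⌉₊) :=
      hmb.comp measurable_fst
    exact h1.fst.prodMk (h1.snd.prodMk (hm2.comp (h1.prodMk measurable_snd)))
  · exact (hspec (decide (0 ≤ q.1), ⌈|q.1|⌉₊) q.2).1
  · exact (hspec (decide (0 ≤ q.1), ⌈|q.1|⌉₊) q.2).2

namespace AdaptedContour

variable {i : Bool × ℕ × ℕ} {τ : ℝ} {ξ : R3}

theorem abs_le_scale (H : AdaptedContour i τ ξ) : |τ| ≤ contourScale i := by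
  have := Nat.le_ceil |τ|
  simp only [contourScale, H.scale]
  linarith

theorem scale_le (H : AdaptedContour i τ ξ) : contourScale i ≤ |τ| + 2 := by
  have := Nat.ceil_lt_add_one (abs_nonneg τ)
  simp only [contourScale, H.scale]
  linarith

theorem radius_le (H : AdaptedContour i τ ξ) :
    contourRadius (contourScale i) i.2.2 ≤ contourScale i + 6 / contourScale i := by
  have h1 := one_le_contourScale i
  have h2 : (i.2.2 : ℝ) + 1 ≤ 6 := by exact_mod_cast H.lt_six
  simp only [contourRadius]
  gcongr

theorem radius_le' (H : AdaptedContour i τ ξ) :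
    contourRadius (contourScale i) i.2.2 ≤ 7 * contourScale i := by
  have h1 := one_le_contourScale i
  have h2 : 6 / contourScale i ≤ 6 * contourScale i := by
    rw [div_le_iff₀ (by linarith)]
    nlinarith
  linarith [H.radius_le]

theorem norm_le (H : AdaptedContour i τ ξ) (θ : ℝ) : ‖contour i θ‖ ≤ 8 * contourScale i := by
  have h1 := one_le_contourScale i
  have h2 : ‖contourCenter i‖ = contourScale i := by
    rw [contourCenter, norm_mul, Complex.norm_I, mul_one, Complex.norm_real, norm_mul,
      Real.norm_of_nonneg (by linarith : 0 ≤ contourScale i)]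
    split_ifs <;> simp
  have h3 := norm_le_norm_add_norm_sub' (contour i θ) (contourCenter i)
  rw [norm_contour_sub_center, h2] at h3
  linarith [H.radius_le']

theorem norm_exp_le (H : AdaptedContour i τ ξ) (θ : ℝ) :
    ‖Complex.exp (2 * π * τ * contour i θ * Complex.I)‖ ≤ rexp (12 * π) := by
  have h1 := one_le_contourScale i
  have hr := H.radius_le
  have hrn := contourScale_le_radius i
  set r := contourRadius (contourScale i) i.2.2
  have him : (contour i θ).im = (if i.1 then 1 else -1) * contourScale i + r * Real.sin θ := by
    simp [contour, contourCenter, circleMap, Complex.exp_ofReal_mul_I_im, r]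
  have hτ := H.abs_le_scale
  rw [Complex.norm_exp]
  refine Real.exp_le_exp.2 ?_
  have e : (2 * π * τ * contour i θ * Complex.I).re = 2 * π * (-(τ * (contour i θ).im)) := by
    simp
    ring
  rw [e]
  have key : -(τ * (contour i θ).im) ≤ 6 := by
    have h6 : |τ| * (6 / contourScale i) ≤ 6 := by
      rw [mul_div_assoc', div_le_iff₀ (by linarith)]
      linarith
    have hs1 := Real.sin_le_one θ
    have hs2 := Real.neg_one_le_sin θ
    rcases le_or_gt 0 τ with h | h
    · have hb : i.1 = true := by simp [H.sign, h]
      rw [him, hb]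
      rw [abs_of_nonneg h] at h6
      have : -(6 / contourScale i) ≤ contourScale i + r * Real.sin θ := by nlinarith
      simp only [if_true, one_mul]
      nlinarith
    · have hb : i.1 = false := by simp [H.sign, h]
      rw [him, hb]
      rw [abs_of_neg h] at h6
      have : -contourScale i + r * Real.sin θ ≤ 6 / contourScale i := by nlinarith
      simp only [Bool.false_eq_true, if_false, neg_mul, one_mul]
      nlinarith
  nlinarith [Real.pi_pos]

theorem le_quintic_of_norm_sub_le (H : AdaptedContour i τ ξ) {ξ' : R3}
    (h : ‖ξ' - ξ‖ ≤ (97200 * contourScale i ^ 7)⁻¹) (θ : ℝ) :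
    (486 * contourScale i ^ 5)⁻¹ ≤ ‖quintic ξ' (contour i θ)‖ := by
  have h1 := one_le_contourScale i
  have hz := H.norm_le θ
  have hq := H.le_quintic θ
  set n := contourScale i
  set z := contour i θ
  have hd : ‖quintic ξ z - quintic ξ' z‖ ≤ ‖ξ' - ξ‖ * (3 * (8 * n) ^ 2) := by
    have e : quintic ξ z - quintic ξ' z = -(((ξ' - ξ).1 : ℝ) * z ^ 2 + ((ξ' - ξ).2.1 : ℝ) * z
        + ((ξ' - ξ).2.2 : ℝ)) := by
      simp [quintic]
      ring
    rw [e, norm_neg]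
    have a1 : ‖(ξ' - ξ).1‖ ≤ ‖ξ' - ξ‖ := norm_fst_le _
    have a2 : ‖(ξ' - ξ).2.1‖ ≤ ‖ξ' - ξ‖ := (norm_fst_le _).trans (norm_snd_le _)
    have a3 : ‖(ξ' - ξ).2.2‖ ≤ ‖ξ' - ξ‖ := (norm_snd_le _).trans (norm_snd_le _)
    have b1 : ‖z‖ ^ 2 ≤ (8 * n) ^ 2 := by gcongr
    have b2 : ‖z‖ ≤ (8 * n) ^ 2 := by nlinarith
    have b3 : 1 ≤ (8 * n) ^ 2 := by nlinarith
    calc _ ≤ ‖(ξ' - ξ).1‖ * ‖z‖ ^ 2 + ‖(ξ' - ξ).2.1‖ * ‖z‖ + ‖(ξ' - ξ).2.2‖ * 1 := by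
          refine (norm_add₃_le).trans (le_of_eq ?_)
          simp only [norm_mul, norm_pow, Complex.norm_real, mul_one]
      _ ≤ ‖ξ' - ξ‖ * (8 * n) ^ 2 + ‖ξ' - ξ‖ * (8 * n) ^ 2 + ‖ξ' - ξ‖ * (8 * n) ^ 2 := by gcongr
      _ = _ := by ring
  have h2 : ‖ξ' - ξ‖ * (3 * (8 * n) ^ 2) ≤ (486 * n ^ 5)⁻¹ := by
    calc _ ≤ (97200 * n ^ 7)⁻¹ * (3 * (8 * n) ^ 2) := by gcongr
      _ = 192 / 200 * (486 * n ^ 5)⁻¹ := by field_simp; norm_num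
      _ ≤ 1 * (486 * n ^ 5)⁻¹ := by gcongr; norm_num
      _ = _ := one_mul _
  have h3 : (1 / (3 * n)) ^ 5 = 2 * (486 * n ^ 5)⁻¹ := by field_simp; norm_num
  have h4 := norm_sub_norm_le (quintic ξ z) (quintic ξ' z)
  linarith

end AdaptedContour

theorem norm_ofReal_sub_contourCenter_le (i : Bool × ℕ × ℕ) {T : ℝ} (hT : |T| ≤ 1) :
    ‖(T : ℂ) - contourCenter i‖ + (2 * contourScale i)⁻¹
      ≤ contourRadius (contourScale i) i.2.2 := by
  have h1 := one_le_contourScale i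
  have hsq : ‖(T : ℂ) - contourCenter i‖ ^ 2 = T ^ 2 + contourScale i ^ 2 := by
    rw [← Complex.normSq_eq_norm_sq, Complex.normSq_apply]
    simp [contourCenter]
    split_ifs <;> ring
  have hT2 : T ^ 2 ≤ 1 := by rw [← sq_abs]; nlinarith [abs_nonneg T]
  set n := contourScale i
  have h2 : ‖(T : ℂ) - contourCenter i‖ ≤ n + (2 * n)⁻¹ := by
    refine abs_le_of_sq_le_sq' ?_ (by positivity) |>.2
    have : (n + (2 * n)⁻¹) ^ 2 = n ^ 2 + 1 + ((2 * n)⁻¹) ^ 2 := by field_simp; ring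
    nlinarith [sq_nonneg ((2 * n)⁻¹)]
  have h3 : n + (2 * n)⁻¹ + (2 * n)⁻¹ ≤ contourRadius n i.2.2 := by
    have : (2 * n)⁻¹ + (2 * n)⁻¹ = 1 / n := by field_simp; norm_num
    have : 1 / n ≤ ((i.2.2 : ℝ) + 1) / n := by gcongr; simp
    simp only [contourRadius]
    linarith
  linarith

theorem le_norm_contour_sub (i : Bool × ℕ × ℕ) {T : ℝ} (hT : |T| ≤ 1) (θ : ℝ) :
    (2 * contourScale i)⁻¹ ≤ ‖contour i θ - T‖ := by
  have h1 := norm_ofReal_sub_contourCenter_le i hT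
  have h2 := norm_contour_sub_center i θ
  have h3 := norm_sub_norm_le (contour i θ - contourCenter i) (T - contourCenter i)
  rw [sub_sub_sub_cancel_right] at h3
  linarith

instance : (volume : Measure R3).IsAddHaarMeasure :=
  Measure.prod.instIsAddHaarMeasure (volume : Measure ℝ) (volume : Measure (ℝ × ℝ))

theorem exists_bound_iteratedFDeriv_of_hasCompactSupport {E F : Type} [NormedAddCommGroup E]
    [NormedSpace ℝ E] [NormedAddCommGroup F] [NormedSpace ℝ F] {f : E → F} (hf : ContDiff ℝ ∞ f)
    (hc : HasCompactSupport f) (k : ℕ) : ∃ C, ∀ y, ‖iteratedFDeriv ℝ k f y‖ ≤ C :=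
  (hf.continuous_iteratedFDeriv (m := k) (by exact_mod_cast le_top)).bounded_above_of_compact_support
    (hc.iteratedFDeriv k)

theorem exists_contDiff_mollifier : ∃ φ : R3 → ℂ, ContDiff ℝ ∞ φ ∧ (∀ y, φ y ≠ 0 → ‖y‖ ≤ 1) ∧
    (∀ k, ∃ C, ∀ y, ‖iteratedFDeriv ℝ k φ y‖ ≤ C) ∧ ∫ y, φ y = 1 := by
  let b : ContDiffBump (0 : R3) := ⟨1 / 2, 1, by norm_num, by norm_num⟩
  have h1 : ContDiff ℝ ∞ fun y => ((b.normed volume y : ℝ) : ℂ) :=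
    Complex.ofRealCLM.contDiff.comp b.contDiff_normed
  have h2 : HasCompactSupport fun y => ((b.normed volume y : ℝ) : ℂ) :=
    (b.hasCompactSupport_normed (μ := volume)).comp_left Complex.ofReal_zero
  refine ⟨_, h1, fun y hy => ?_, exists_bound_iteratedFDeriv_of_hasCompactSupport h1 h2, ?_⟩
  · have h3 : y ∈ tsupport (b.normed volume) := subset_tsupport _ fun h => hy (by simp [h])
    rw [b.tsupport_normed_eq] at h3
    simpa using h3
  · rw [integral_complex_ofReal, b.integral_normed]
    simp

theorem exists_bound_iteratedFDeriv_exp_mul_I (k : ℕ) :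
    ∃ C, ∀ t : ℝ, ‖iteratedFDeriv ℝ k (fun t : ℝ => Complex.exp (t * Complex.I)) t‖ ≤ C := by
  have h : ∀ k : ℕ, iteratedDeriv k (fun t : ℝ => Complex.exp (t * Complex.I)) =
      fun t : ℝ => Complex.I ^ k * Complex.exp (t * Complex.I) := by
    intro k
    induction k with
    | zero => simp
    | succ k ih =>
      rw [iteratedDeriv_succ, ih]
      ext t
      have h1 : HasDerivAt (fun t : ℝ => (t : ℂ) * Complex.I) Complex.I t := by
        simpa using (Complex.ofRealCLM.hasDerivAt (x := t)).mul_const Complex.I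
      rw [(h1.cexp.const_mul _).deriv]
      ring
  refine ⟨1, fun t => ?_⟩
  rw [norm_iteratedFDeriv_eq_norm_iteratedDeriv, h]
  simp [Complex.norm_exp_ofReal_mul_I]

/-- The dilated mollifier has integral one. -/
theorem integral_dilate_mollifier {φ : R3 → ℂ} (hφ : ∀ y, φ y ≠ 0 → ‖y‖ ≤ 1)
    (hφ1 : ∫ y, φ y = 1) {c : ℝ} (hc : 1 ≤ c) {ξ : R3} (hξ : ‖ξ‖ ≤ 1) :
    ∫ y in Metric.closedBall (0 : R3) 2, (c : ℂ) ^ 3 * φ (c • (ξ - y)) = 1 := by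
  rw [setIntegral_eq_integral_of_forall_compl_eq_zero]
  · rw [integral_sub_left_eq_self (fun y => (c : ℂ) ^ 3 * φ (c • y)) volume ξ,
      integral_const_mul, Measure.integral_comp_smul volume φ c, hφ1]
    have h3 : Module.finrank ℝ R3 = 3 := by simp
    have hc0 : (c : ℂ) ≠ 0 := by exact_mod_cast (by linarith : c ≠ 0)
    rw [h3, abs_of_pos (by positivity)]
    simp only [Complex.real_smul, mul_one]
    push_cast
    field_simp
  · intro y hy
    by_contra h
    have h1 := hφ _ (right_ne_zero_of_mul h)
    rw [norm_smul, Real.norm_of_nonneg (by linarith)] at h1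
    have h2 : ‖ξ - y‖ ≤ 1 := by nlinarith [norm_nonneg (ξ - y)]
    refine hy ?_
    have := norm_le_norm_add_norm_sub ξ y
    simp only [Metric.mem_closedBall, dist_zero_right]
    linarith

theorem one_le_weight {H : Type} [NormedAddCommGroup H] (a : (H × R3) × ℝ) :
    1 ≤ 2 + 2 * ‖a.1.1‖ := by
  linarith [norm_nonneg a.1.1]

section DivisionKernel

variable {H : Type} [NormedAddCommGroup H] [InnerProductSpace ℝ H]

/-- The integrand whose integrals give quotient and remainder in the division theorem, for
the contour with index `i`, at the frequency `η`, mollification variable `μ` and contour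
angle `θ`. -/
def divisionKernel (φ : R3 → ℂ) (G : ℂ → ℂ) (e : H)
    (P : Bool × ℕ × ℕ → ℝ → ℝ × R3 → ℂ) (i : Bool × ℕ × ℕ) (a : (H × R3) × ℝ)
    (x : H × ℝ × R3) : ℂ :=
  Complex.exp ((2 * π * inner ℝ a.1.1 x.1 : ℝ) * Complex.I) *
    (Complex.exp (2 * π * (inner ℝ a.1.1 e : ℝ) * contour i a.2 * Complex.I) *
      (circleMap 0 (contourRadius (contourScale i) i.2.2) a.2 * Complex.I) /
        (2 * π * Complex.I)) *
    (((97200 * contourScale i ^ 7 : ℝ) : ℂ) ^ 3 *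
      φ ((97200 * contourScale i ^ 7) • (x.2.2 - a.1.2))) *
    (((486 * contourScale i ^ 5 : ℝ) : ℂ) *
      G (((486 * contourScale i ^ 5 : ℝ) : ℂ) * quintic x.2.2 (contour i a.2))) *
    P i a.2 x.2

theorem contDiff_quintic : ContDiff ℝ ∞ fun q : R3 × ℂ => quintic q.1 q.2 := by
  have h : ContDiff ℝ ∞ fun t : ℝ => (t : ℂ) := Complex.ofRealCLM.contDiff
  unfold quintic
  refine ((ContDiff.add ?_ (ContDiff.mul (h.comp ?_) ?_)).add
    (ContDiff.mul (h.comp ?_) ?_)).add (h.comp ?_) <;> fun_prop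

theorem contDiff_contour (i : Bool × ℕ × ℕ) : ContDiff ℝ ∞ (contour i) :=
  contDiff_circleMap _ _

theorem contDiff_divisionKernel {φ : R3 → ℂ} {G : ℂ → ℂ} (hφ : ContDiff ℝ ∞ φ)
    (hG : ContDiff ℝ ∞ G) (e : H) {P : Bool × ℕ × ℕ → ℝ → ℝ × R3 → ℂ}
    (hP : ∀ i, ContDiff ℝ ∞ fun q : ℝ × (ℝ × R3) => P i q.1 q.2) (i : Bool × ℕ × ℕ) :
    ContDiff ℝ ∞ fun q : ((H × R3) × ℝ) × (H × ℝ × R3) => divisionKernel φ G e P i q.1 q.2 := by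
  have h : ContDiff ℝ ∞ fun t : ℝ => (t : ℂ) := Complex.ofRealCLM.contDiff
  have hζ : ContDiff ℝ ∞ fun q : ((H × R3) × ℝ) × (H × ℝ × R3) => contour i q.1.2 :=
    (contDiff_contour i).comp (by fun_prop)
  have h1 : ContDiff ℝ ∞ fun q : ((H × R3) × ℝ) × (H × ℝ × R3) =>
      Complex.exp ((2 * π * inner ℝ q.1.1.1 q.2.1 : ℝ) * Complex.I) :=
    ((h.comp (contDiff_const.mul (ContDiff.inner ℝ (by fun_prop) (by fun_prop)))).mul
      contDiff_const).cexp
  have h2 : ContDiff ℝ ∞ fun q : ((H × R3) × ℝ) × (H × ℝ × R3) =>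
      Complex.exp (2 * π * (inner ℝ q.1.1.1 e : ℝ) * contour i q.1.2 * Complex.I) :=
    (((contDiff_const.mul (h.comp (ContDiff.inner ℝ (by fun_prop) (by fun_prop)))).mul
      hζ).mul contDiff_const).cexp
  have h3 : ContDiff ℝ ∞ fun q : ((H × R3) × ℝ) × (H × ℝ × R3) =>
      circleMap 0 (contourRadius (contourScale i) i.2.2) q.1.2 * Complex.I :=
    ((contDiff_circleMap _ _).comp (by fun_prop)).mul contDiff_const
  have h4 : ∀ c : ℝ, ContDiff ℝ ∞ fun q : ((H × R3) × ℝ) × (H × ℝ × R3) =>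
      (c : ℂ) ^ 3 * φ (c • (q.2.2.2 - q.1.1.2)) := fun c => by
    have hd : ContDiff ℝ ∞ fun q : ((H × R3) × ℝ) × (H × ℝ × R3) =>
      c • (q.2.2.2 - q.1.1.2) := by fun_prop
    have hd' : ContDiff ℝ ∞ fun q : ((H × R3) × ℝ) × (H × ℝ × R3) =>
      φ (c • (q.2.2.2 - q.1.1.2)) := hφ.comp hd
    have hc : ContDiff ℝ ∞ fun _ : ((H × R3) × ℝ) × (H × ℝ × R3) => (c : ℂ) ^ 3 := contDiff_const
    exact hc.mul hd'
  have h5 : ∀ c : ℝ, ContDiff ℝ ∞ fun q : ((H × R3) × ℝ) × (H × ℝ × R3) =>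
      (c : ℂ) * G (c * quintic q.2.2.2 (contour i q.1.2)) := fun c => by
    have hz : ContDiff ℝ ∞ fun q : ((H × R3) × ℝ) × (H × ℝ × R3) =>
      (q.2.2.2, contour i q.1.2) := ContDiff.prodMk (by fun_prop) hζ
    have hz' : ContDiff ℝ ∞ fun q : ((H × R3) × ℝ) × (H × ℝ × R3) =>
      quintic q.2.2.2 (contour i q.1.2) := by
      have h := contDiff_quintic.comp hz
      exact h
    have hq : ContDiff ℝ ∞ fun q : ((H × R3) × ℝ) × (H × ℝ × R3) =>
      (c : ℂ) * quintic q.2.2.2 (contour i q.1.2) := contDiff_const.mul hz'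
    have hq' : ContDiff ℝ ∞ fun q : ((H × R3) × ℝ) × (H × ℝ × R3) =>
      G (c * quintic q.2.2.2 (contour i q.1.2)) := hG.comp hq
    have hc : ContDiff ℝ ∞ fun _ : ((H × R3) × ℝ) × (H × ℝ × R3) => (c : ℂ) := contDiff_const
    exact hc.mul hq'
  have h6 : ContDiff ℝ ∞ fun q : ((H × R3) × ℝ) × (H × ℝ × R3) => P i q.1.2 q.2.2 := by
    have hz : ContDiff ℝ ∞ fun q : ((H × R3) × ℝ) × (H × ℝ × R3) => (q.1.2, q.2.2) := by fun_prop
    have h := (hP i).comp hz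
    exact h
  have h23 := (h2.mul h3).div_const (2 * π * Complex.I)
  exact (((h1.mul h23).mul (h4 (97200 * contourScale i ^ 7))).mul
    (h5 (486 * contourScale i ^ 5))).mul h6

variable {e : H} {idx : (H × R3) × ℝ → Bool × ℕ × ℕ}

theorem AdaptedContour.scale_le_weight (he : ‖e‖ ≤ 1) {i : Bool × ℕ × ℕ} {η : H} {μ : R3}
    (h : AdaptedContour i (inner ℝ η e) μ) : contourScale i ≤ 2 + 2 * ‖η‖ := by
  have h1 := abs_real_inner_le_norm η e
  have := h.scale_le
  nlinarith [norm_nonneg η]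

theorem polyBounded_contour_pow (he : ‖e‖ ≤ 1)
    (hidx : ∀ a, AdaptedContour (idx a) (inner ℝ a.1.1 e) a.1.2) (k : ℕ) :
    PolyBounded (fun a : (H × R3) × ℝ => 2 + 2 * ‖a.1.1‖)
      (fun a (_ : H × ℝ × R3) => contour (idx a) a.2 ^ k) := by
  refine .const (8 ^ k) k fun a => ?_
  rw [norm_pow, ← mul_pow]
  have := (hidx a).norm_le a.2
  have := (hidx a).scale_le_weight he
  gcongr
  linarith

theorem polyBounded_scale_pow (he : ‖e‖ ≤ 1)
    (hidx : ∀ a, AdaptedContour (idx a) (inner ℝ a.1.1 e) a.1.2) (c : ℝ) (k : ℕ) :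
    PolyBounded (fun a : (H × R3) × ℝ => 2 + 2 * ‖a.1.1‖)
      (fun a (_ : H × ℝ × R3) => ((c * contourScale (idx a) ^ k : ℝ) : ℂ)) := by
  refine .const |c| k fun a => ?_
  rw [Complex.norm_real, norm_mul, norm_pow, Real.norm_eq_abs, Real.norm_of_nonneg
    (by linarith [one_le_contourScale (idx a)])]
  have := (hidx a).scale_le_weight he
  have := one_le_contourScale (idx a)
  gcongr

theorem contDiff_ofReal : ContDiff ℝ ∞ fun t : ℝ => (t : ℂ) := Complex.ofRealCLM.contDiff

variable [FiniteDimensional ℝ H]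

theorem polyBounded_quintic (he : ‖e‖ ≤ 1)
    (hidx : ∀ a, AdaptedContour (idx a) (inner ℝ a.1.1 e) a.1.2) :
    PolyBounded (fun a : (H × R3) × ℝ => 2 + 2 * ‖a.1.1‖)
      (fun a (x : H × ℝ × R3) => quintic x.2.2 (contour (idx a) a.2)) := by
  unfold quintic
  have hN := one_le_weight (H := H)
  refine (((polyBounded_contour_pow he hidx 5).add hN (.mul hN (.of_contDiff ?_)
    (polyBounded_contour_pow he hidx 2))).add hN (.mul hN (.of_contDiff ?_) ?_)).add hN
    (.of_contDiff ?_)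
  · exact contDiff_ofReal.comp (by fun_prop)
  · exact contDiff_ofReal.comp (by fun_prop)
  · simpa using polyBounded_contour_pow he hidx 1
  · exact contDiff_ofReal.comp (by fun_prop)

theorem polyBounded_divisionKernel {φ : R3 → ℂ} {G : ℂ → ℂ} (hφ : ContDiff ℝ ∞ φ)
    (hφb : ∀ k, ∃ C, ∀ y, ‖iteratedFDeriv ℝ k φ y‖ ≤ C) (hG : ContDiff ℝ ∞ G)
    (hGb : ∀ k, ∃ C, ∀ y, ‖iteratedFDeriv ℝ k G y‖ ≤ C) (he : ‖e‖ ≤ 1)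
    (hidx : ∀ a, AdaptedContour (idx a) (inner ℝ a.1.1 e) a.1.2)
    {P : Bool × ℕ × ℕ → ℝ → ℝ × R3 → ℂ}
    (hP : PolyBounded (fun a : (H × R3) × ℝ => 2 + 2 * ‖a.1.1‖)
      (fun a (x : H × ℝ × R3) => P (idx a) a.2 x.2)) :
    PolyBounded (fun a : (H × R3) × ℝ => 2 + 2 * ‖a.1.1‖)
      (fun a => divisionKernel φ G e P (idx a) a) := by
  have hN := one_le_weight (H := H)
  unfold divisionKernel
  refine .mul hN (.mul hN (.mul hN (.mul hN ?_ ?_) (.mul hN ?_ ?_)) (.mul hN ?_ ?_)) hP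
  · refine .comp hN (g := fun _ (t : ℝ) => Complex.exp (t * Complex.I))
      (h := fun a (x : H × ℝ × R3) => 2 * π * inner ℝ a.1.1 x.1)
      (fun _ => (contDiff_ofReal.mul contDiff_const).cexp)
      (fun k => ?_) ?_
    · obtain ⟨C, hC⟩ := exists_bound_iteratedFDeriv_exp_mul_I k
      exact ⟨C, fun _ => hC⟩
    · refine .clm (L := fun a : (H × R3) × ℝ => (2 * π) • (innerSL ℝ a.1.1).comp
        (ContinuousLinearMap.fst ℝ H (ℝ × R3))) (2 * π) 1 fun a => ?_
      rw [norm_smul, Real.norm_of_nonneg (by positivity)]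
      refine mul_le_mul_of_nonneg_left ?_ (by positivity)
      refine (ContinuousLinearMap.opNorm_comp_le _ _).trans ?_
      rw [innerSL_apply_norm]
      have := ContinuousLinearMap.norm_fst_le ℝ H (ℝ × R3)
      nlinarith [norm_nonneg a.1.1]
  · refine .const (rexp (12 * π) * 7) 1 fun a => ?_
    have h1 := one_le_contourScale (idx a)
    have h2 := (hidx a).scale_le_weight he
    have h3 := (hidx a).radius_le'
    have h4 := (hidx a).norm_exp_le a.2
    have h5 := contourScale_le_radius (idx a)
    rw [norm_div, norm_mul, norm_mul, norm_circleMap_zero, Complex.norm_I, mul_one,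
      abs_of_nonneg (by linarith)]
    have h6 : (1 : ℝ) ≤ ‖(2 * π * Complex.I : ℂ)‖ := by
      simp [abs_of_pos Real.pi_pos]
      linarith [Real.pi_gt_three]
    refine (div_le_self (mul_nonneg (norm_nonneg _) (by linarith)) h6).trans ?_
    refine (mul_le_mul h4 (h3.trans (mul_le_mul_of_nonneg_left h2 (by norm_num)))
      (by linarith) (by positivity)).trans (le_of_eq (by ring))
  · convert! ((polyBounded_scale_pow he hidx 97200 7).mul hN
      (polyBounded_scale_pow he hidx 97200 7)).mul hN
      (polyBounded_scale_pow he hidx 97200 7) using 3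
    ring
  · have h := PolyBounded.comp (N := fun a : (H × R3) × ℝ => 2 + 2 * ‖a.1.1‖) hN
      (g := fun a (y : R3) => φ (y - (97200 * contourScale (idx a) ^ 7) • a.1.2))
      (h := fun a (x : H × ℝ × R3) => (97200 * contourScale (idx a) ^ 7) • x.2.2)
      (fun a => hφ.comp (by fun_prop)) (fun k => ?_) ?_
    · simpa only [smul_sub] using h
    · obtain ⟨C, hC⟩ := hφb k
      exact ⟨C, fun a y => by rw [iteratedFDeriv_comp_sub]; exact hC _⟩
    · refine .clm (L := fun a : (H × R3) × ℝ => (97200 * contourScale (idx a) ^ 7) •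
        (ContinuousLinearMap.snd ℝ ℝ R3).comp
        (ContinuousLinearMap.snd ℝ H (ℝ × R3))) 97200 7 fun a => ?_
      have h1 := one_le_contourScale (idx a)
      have h2 := (hidx a).scale_le_weight he
      rw [norm_smul, Real.norm_of_nonneg (by positivity)]
      have := ContinuousLinearMap.norm_snd_le ℝ H (ℝ × R3)
      have := ContinuousLinearMap.norm_snd_le ℝ ℝ R3
      have h3 : ‖(ContinuousLinearMap.snd ℝ ℝ R3).comp
        (ContinuousLinearMap.snd ℝ H (ℝ × R3))‖ ≤ 1 := by
        refine (ContinuousLinearMap.opNorm_comp_le _ _).trans ?_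
        nlinarith [norm_nonneg (ContinuousLinearMap.snd ℝ ℝ R3),
          norm_nonneg (ContinuousLinearMap.snd ℝ H (ℝ × R3))]
      refine (mul_le_of_le_one_right (by positivity) h3).trans ?_
      gcongr
  · exact polyBounded_scale_pow he hidx 486 5
  · exact .comp hN (g := fun _ => G) (fun _ => hG)
      (fun k => (hGb k).imp fun C hC _ => hC)
      (.mul hN (polyBounded_scale_pow he hidx 486 5) (polyBounded_quintic he hidx))

end DivisionKernel

section DivisionTheorem

variable {H : Type} [NormedAddCommGroup H] [InnerProductSpace ℝ H] [FiniteDimensional ℝ H]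
  [MeasurableSpace H] [BorelSpace H] {e : H} {A : ℝ × R3 → Bool × ℕ × ℕ}

/-- The measure against which the division kernels are integrated. -/
def divisionMeasure (H : Type) [NormedAddCommGroup H] [InnerProductSpace ℝ H]
    [FiniteDimensional ℝ H] [MeasurableSpace H] [BorelSpace H] : Measure ((H × R3) × ℝ) :=
  ((volume : Measure H).prod (volume.restrict (Metric.closedBall (0 : R3) 2))).prod
    (volume.restrict (Set.Ioc 0 (2 * π)))

theorem integrable_weight_divisionMeasure (W : 𝓢(H, ℂ)) (M : ℕ) :
    Integrable (fun a => ‖W a.1.1‖ * (2 + 2 * ‖a.1.1‖) ^ M) (divisionMeasure H) := by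
  have h1 : Integrable (fun η => ‖W η‖ * (2 + 2 * ‖η‖) ^ M) := by
    simp only [add_pow, Finset.mul_sum]
    refine integrable_finsetSum _ fun k _ => ?_
    refine ((W.integrable_pow_mul volume (M - k)).const_mul
      (2 ^ k * 2 ^ (M - k) * (M.choose k))).congr (Eventually.of_forall fun η => ?_)
    simp only [mul_pow]
    ring
  have hb : IsFiniteMeasure (volume.restrict (Metric.closedBall (0 : R3) 2)) :=
    ⟨by simpa using (isCompact_closedBall (0 : R3) 2).measure_lt_top⟩
  have h2 := (h1.mul_prod (integrable_const (1 : ℝ)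
    (μ := volume.restrict (Metric.closedBall (0 : R3) 2)))).mul_prod
    (integrable_const (1 : ℝ) (μ := volume.restrict (Set.Ioc 0 (2 * π))))
  simpa [divisionMeasure] using h2

theorem contDiff_integral_divisionKernel (hA : Measurable A)
    (hA' : ∀ q, AdaptedContour (A q) q.1 q.2) (he : ‖e‖ ≤ 1) (W : 𝓢(H, ℂ)) {φ : R3 → ℂ}
    {G : ℂ → ℂ} (hφ : ContDiff ℝ ∞ φ)
    (hφb : ∀ k, ∃ C, ∀ y, ‖iteratedFDeriv ℝ k φ y‖ ≤ C) (hG : ContDiff ℝ ∞ G)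
    (hGb : ∀ k, ∃ C, ∀ y, ‖iteratedFDeriv ℝ k G y‖ ≤ C)
    {P : Bool × ℕ × ℕ → ℝ → ℝ × R3 → ℂ}
    (hP : ∀ i, ContDiff ℝ ∞ fun q : ℝ × (ℝ × R3) => P i q.1 q.2)
    (hPb : PolyBounded (fun a : (H × R3) × ℝ => 2 + 2 * ‖a.1.1‖)
      (fun a (x : H × ℝ × R3) => P (A (inner ℝ a.1.1 e, a.1.2)) a.2 x.2)) :
    ContDiff ℝ ∞ (fun x => ∫ a, W a.1.1 *
      divisionKernel φ G e P (A (inner ℝ a.1.1 e, a.1.2)) a x ∂(divisionMeasure H)) ∧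
    ∀ x, Integrable (fun a => W a.1.1 *
      divisionKernel φ G e P (A (inner ℝ a.1.1 e, a.1.2)) a x) (divisionMeasure H) := by
  refine contDiff_integral_of_polyBounded (idx := fun a => A (inner ℝ a.1.1 e, a.1.2))
    (N := fun a : (H × R3) × ℝ => 2 + 2 * ‖a.1.1‖)
    (w := fun a => W a.1.1) (fun i => ?_) (contDiff_divisionKernel hφ hG e hP)
    (W.continuous.comp (by fun_prop))
    (polyBounded_divisionKernel hφ hφb hG hGb he (fun a => hA' _) hPb)
    (integrable_weight_divisionMeasure W)
  refine measurableSet_preimage (hA.comp ?_) (measurableSet_singleton i)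
  fun_prop

theorem integral_contour_eq (i : Bool × ℕ × ℕ) (τ : ℝ) {T : ℝ} (hT : |T| ≤ 1) :
    ∫ θ in Set.Ioc 0 (2 * π), Complex.exp (2 * π * τ * contour i θ * Complex.I) *
      (circleMap 0 (contourRadius (contourScale i) i.2.2) θ * Complex.I) /
        (2 * π * Complex.I) * (contour i θ - T)⁻¹ =
      Complex.exp (2 * π * τ * T * Complex.I) := by
  have hd : DifferentiableOn ℂ (fun z : ℂ => Complex.exp (2 * π * τ * z * Complex.I))
      (Metric.closedBall (contourCenter i) (contourRadius (contourScale i) i.2.2)) := by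
    fun_prop
  have hT' : (T : ℂ) ∈ Metric.ball (contourCenter i) (contourRadius (contourScale i) i.2.2) := by
    have h1 := norm_ofReal_sub_contourCenter_le i hT
    have h2 := one_le_contourScale i
    have : 0 < (2 * contourScale i)⁻¹ := by positivity
    rw [Metric.mem_ball, dist_eq_norm]
    linarith
  have h := hd.circleIntegral_sub_inv_smul hT'
  rw [circleIntegral, intervalIntegral.integral_of_le (by positivity)] at h
  have h0 : (2 * π * Complex.I : ℂ) ≠ 0 := by simp [Real.pi_ne_zero]
  rw [← mul_right_inj' h0, ← smul_eq_mul _ (Complex.exp _), ← h, ← integral_const_mul]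
  refine integral_congr_ae (Eventually.of_forall fun θ => ?_)
  simp only [smul_eq_mul, deriv_circleMap, contour]
  field_simp

end DivisionTheorem

section DivisionTheorem

/-- The factor of the division kernel producing the quotient. -/
def quotientFactor (G : ℂ → ℂ) (i : Bool × ℕ × ℕ) (θ : ℝ) (y : ℝ × R3) : ℂ :=
  ((2 * contourScale i : ℝ) : ℂ) * G (((2 * contourScale i : ℝ) : ℂ) * (contour i θ - y.1))

/-- The factors of the division kernel producing the coefficients of the remainder. -/
def remainderFactor (j : Fin 5) (i : Bool × ℕ × ℕ) (θ : ℝ) (y : ℝ × R3) : ℂ :=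
  ![contour i θ ^ 4 + y.2.1 * contour i θ ^ 1 + y.2.2.1, contour i θ ^ 3 + y.2.1,
    contour i θ ^ 2, contour i θ ^ 1, 1] j

theorem contDiff_quotientFactor {G : ℂ → ℂ} (hG : ContDiff ℝ ∞ G) (i : Bool × ℕ × ℕ) :
    ContDiff ℝ ∞ fun q : ℝ × (ℝ × R3) => quotientFactor G i q.1 q.2 := by
  have h1 : ContDiff ℝ ∞ fun q : ℝ × (ℝ × R3) => (q.2.1 : ℂ) := contDiff_ofReal.comp (by fun_prop)
  have h2 : ContDiff ℝ ∞ fun q : ℝ × (ℝ × R3) => contour i q.1 :=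
    (contDiff_contour i).comp contDiff_fst
  have hc : ContDiff ℝ ∞ fun _ : ℝ × (ℝ × R3) => ((2 * contourScale i : ℝ) : ℂ) := contDiff_const
  have h3 := hG.comp (hc.mul (h2.sub h1))
  exact hc.mul h3

theorem contDiff_remainderFactor (j : Fin 5) (i : Bool × ℕ × ℕ) :
    ContDiff ℝ ∞ fun q : ℝ × (ℝ × R3) => remainderFactor j i q.1 q.2 := by
  have h1 : ContDiff ℝ ∞ fun q : ℝ × (ℝ × R3) => (q.2.2.1 : ℂ) :=
    contDiff_ofReal.comp (by fun_prop)
  have h1' : ContDiff ℝ ∞ fun q : ℝ × (ℝ × R3) => (q.2.2.2.1 : ℂ) :=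
    contDiff_ofReal.comp (by fun_prop)
  have h2 : ContDiff ℝ ∞ fun q : ℝ × (ℝ × R3) => contour i q.1 :=
    (contDiff_contour i).comp contDiff_fst
  fin_cases j
  · exact ((h2.pow 4).add (h1.mul (h2.pow 1))).add h1'
  · exact (h2.pow 3).add h1
  · exact h2.pow 2
  · exact h2.pow 1
  · exact contDiff_const

variable {H : Type} [NormedAddCommGroup H] [InnerProductSpace ℝ H]
  {e : H} {idx : (H × R3) × ℝ → Bool × ℕ × ℕ}

theorem polyBounded_quotientFactor [FiniteDimensional ℝ H] {G : ℂ → ℂ} (hG : ContDiff ℝ ∞ G)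
    (hGb : ∀ k, ∃ C, ∀ y, ‖iteratedFDeriv ℝ k G y‖ ≤ C) (he : ‖e‖ ≤ 1)
    (hidx : ∀ a, AdaptedContour (idx a) (inner ℝ a.1.1 e) a.1.2) :
    PolyBounded (fun a : (H × R3) × ℝ => 2 + 2 * ‖a.1.1‖)
      (fun a (x : H × ℝ × R3) => quotientFactor G (idx a) a.2 x.2) := by
  have hN := one_le_weight (H := H)
  have h1 := polyBounded_scale_pow he hidx 2 1
  simp only [pow_one] at h1
  have h2 := polyBounded_contour_pow he hidx 1
  simp only [pow_one] at h2
  have h3 : ContDiff ℝ ∞ fun x : H × ℝ × R3 => -(x.2.1 : ℂ) :=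
    (contDiff_ofReal.comp (by fun_prop)).neg
  have h4 := h1.mul hN (h2.add hN (.of_contDiff h3))
  have h5 := h1.mul hN (PolyBounded.comp hN (g := fun _ => G) (fun _ => hG)
    (fun k => (hGb k).imp fun C hC _ => hC) h4)
  simpa only [quotientFactor, sub_eq_add_neg] using h5

theorem polyBounded_remainderFactor [FiniteDimensional ℝ H] (he : ‖e‖ ≤ 1)
    (hidx : ∀ a, AdaptedContour (idx a) (inner ℝ a.1.1 e) a.1.2) (j : Fin 5) :
    PolyBounded (fun a : (H × R3) × ℝ => 2 + 2 * ‖a.1.1‖)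
      (fun a (x : H × ℝ × R3) => remainderFactor j (idx a) a.2 x.2) := by
  have hN := one_le_weight (H := H)
  have h1 : PolyBounded (fun a : (H × R3) × ℝ => 2 + 2 * ‖a.1.1‖)
      (fun _ (x : H × ℝ × R3) => (x.2.2.1 : ℂ)) :=
    .of_contDiff (contDiff_ofReal.comp (by fun_prop))
  have h1' : PolyBounded (fun a : (H × R3) × ℝ => 2 + 2 * ‖a.1.1‖)
      (fun _ (x : H × ℝ × R3) => (x.2.2.2.1 : ℂ)) :=
    .of_contDiff (contDiff_ofReal.comp (by fun_prop))
  have h2 := polyBounded_contour_pow he hidx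
  fin_cases j
  · exact ((h2 4).add hN (h1.mul hN (h2 1))).add hN h1'
  · exact (h2 3).add hN h1
  · exact h2 2
  · exact h2 1
  · exact .of_contDiff contDiff_const

theorem divisionKernel_mul_add_sum {φ : R3 → ℂ} {G : ℂ → ℂ} (hφ : ∀ y, φ y ≠ 0 → ‖y‖ ≤ 1)
    (hG : ∀ z, 1 ≤ ‖z‖ → G z = z⁻¹) {i : Bool × ℕ × ℕ} {a : (H × R3) × ℝ}
    (hi : AdaptedContour i (inner ℝ a.1.1 e) a.1.2) (x : H) {T : ℝ} (hT : |T| ≤ 1) (ξ : R3) :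
    divisionKernel φ G e (quotientFactor G) i a (x, T, ξ) * quintic ξ T +
      ∑ j, divisionKernel φ G e (remainderFactor j) i a (x, T, ξ) * (T : ℂ) ^ (j : ℕ) =
    Complex.exp ((2 * π * inner ℝ a.1.1 x : ℝ) * Complex.I) *
      (((97200 * contourScale i ^ 7 : ℝ) : ℂ) ^ 3 *
        φ ((97200 * contourScale i ^ 7) • (ξ - a.1.2))) *
      (Complex.exp (2 * π * (inner ℝ a.1.1 e : ℝ) * contour i a.2 * Complex.I) *
        (circleMap 0 (contourRadius (contourScale i) i.2.2) a.2 * Complex.I) /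
          (2 * π * Complex.I) * (contour i a.2 - T)⁻¹) := by
  have hn := one_le_contourScale i
  simp only [divisionKernel]
  by_cases h0 : φ ((97200 * contourScale i ^ 7) • (ξ - a.1.2)) = 0
  · simp [h0]
  have h1 := hφ _ h0
  rw [norm_smul, Real.norm_of_nonneg (by positivity)] at h1
  have h2 : ‖ξ - a.1.2‖ ≤ (97200 * contourScale i ^ 7)⁻¹ := by
    rw [inv_eq_one_div, le_div_iff₀ (by positivity)]
    linarith
  have h3 := hi.le_quintic_of_norm_sub_le h2 a.2
  have h4 := le_norm_contour_sub i hT a.2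
  rw [hG _ (by
    rw [norm_mul, Complex.norm_real, Real.norm_of_nonneg (by positivity)]
    exact (inv_le_iff_one_le_mul₀' (by positivity)).1 h3)]
  rw [quotientFactor, hG _ (by
    rw [norm_mul, Complex.norm_real, Real.norm_of_nonneg (by positivity)]
    exact (inv_le_iff_one_le_mul₀' (by positivity)).1 h4)]
  have h5 : quintic ξ (contour i a.2) ≠ 0 := norm_pos_iff.1 (lt_of_lt_of_le (by positivity) h3)
  have h6 : contour i a.2 - T ≠ 0 := norm_pos_iff.1 (lt_of_lt_of_le (by positivity) h4)
  have h7 : ((486 * contourScale i ^ 5 : ℝ) : ℂ) ≠ 0 := by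
    exact_mod_cast (by positivity : 486 * contourScale i ^ 5 ≠ 0)
  have h8 : ((2 * contourScale i : ℝ) : ℂ) ≠ 0 := by
    exact_mod_cast (by positivity : 2 * contourScale i ≠ 0)
  have h9 : quintic ξ (contour i a.2) = quintic ξ T + (contour i a.2 - T) *
      ∑ j, remainderFactor j i a.2 (T, ξ) * (T : ℂ) ^ (j : ℕ) := by
    simp [quintic, remainderFactor, Fin.sum_univ_five]
    ring
  generalize Complex.exp ((2 * π * inner ℝ a.1.1 x : ℝ) * Complex.I) = X
  generalize Complex.exp (2 * π * (inner ℝ a.1.1 e : ℝ) * contour i a.2 * Complex.I) *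
    (circleMap 0 (contourRadius (contourScale i) i.2.2) a.2 * Complex.I) /
      (2 * π * Complex.I) = Y
  generalize ((97200 * contourScale i ^ 7 : ℝ) : ℂ) ^ 3 *
    φ ((97200 * contourScale i ^ 7) • (ξ - a.1.2)) = Z
  simp only [mul_assoc, ← Finset.mul_sum, mul_inv, mul_inv_cancel_left₀ h7,
    mul_inv_cancel_left₀ h8]
  calc X * (Y * (Z * ((quintic ξ (contour i a.2))⁻¹ * ((contour i a.2 - T)⁻¹ * quintic ξ T)))) +
        X * (Y * (Z * ((quintic ξ (contour i a.2))⁻¹ *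
          ∑ j, remainderFactor j i a.2 (T, ξ) * (T : ℂ) ^ (j : ℕ)))) =
      X * Y * Z * ((quintic ξ (contour i a.2))⁻¹ * ((contour i a.2 - T)⁻¹ * (quintic ξ T +
        (contour i a.2 - T) * ∑ j, remainderFactor j i a.2 (T, ξ) * (T : ℂ) ^ (j : ℕ)))) := by
        rw [mul_add (contour i a.2 - (T : ℂ))⁻¹, inv_mul_cancel_left₀ h6]
        ring
    _ = X * (Z * (Y * (contour i a.2 - T)⁻¹)) := by
        rw [← h9]
        field_simp

end DivisionTheorem

section DivisionTheorem

variable {H : Type} [NormedAddCommGroup H] [InnerProductSpace ℝ H] [FiniteDimensional ℝ H]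
  [MeasurableSpace H] [BorelSpace H] {e : H}

theorem integral_divisionMeasure_eq {A : ℝ × R3 → Bool × ℕ × ℕ}
    (hA' : ∀ q, AdaptedContour (A q) q.1 q.2) (K : 𝓢(H, ℂ)) {φ : R3 → ℂ}
    (hφ : ∀ y, φ y ≠ 0 → ‖y‖ ≤ 1) (hφ1 : ∫ y, φ y = 1) (x : H) {T : ℝ} (hT : |T| ≤ 1) {ξ : R3}
    (hξ : ‖ξ‖ ≤ 1) {F : (H × R3) × ℝ → ℂ}
    (hF : ∀ a, F a = (𝓕 K : 𝓢(H, ℂ)) a.1.1 *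
      (Complex.exp ((2 * π * inner ℝ a.1.1 x : ℝ) * Complex.I) *
        (((97200 * contourScale (A (inner ℝ a.1.1 e, a.1.2)) ^ 7 : ℝ) : ℂ) ^ 3 *
          φ ((97200 * contourScale (A (inner ℝ a.1.1 e, a.1.2)) ^ 7) • (ξ - a.1.2))) *
        (Complex.exp (2 * π * (inner ℝ a.1.1 e : ℝ) *
            contour (A (inner ℝ a.1.1 e, a.1.2)) a.2 * Complex.I) *
          (circleMap 0 (contourRadius (contourScale (A (inner ℝ a.1.1 e, a.1.2)))
            (A (inner ℝ a.1.1 e, a.1.2)).2.2) a.2 * Complex.I) /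
            (2 * π * Complex.I) * (contour (A (inner ℝ a.1.1 e, a.1.2)) a.2 - T)⁻¹)))
    (hFi : Integrable F (divisionMeasure H)) :
    ∫ a, F a ∂(divisionMeasure H) = K (x + T • e) := by
  have h1 : ∀ b : H × R3, ∫ θ in Set.Ioc 0 (2 * π), F (b, θ) = (𝓕 K : 𝓢(H, ℂ)) b.1 *
      (Complex.exp ((2 * π * inner ℝ b.1 x : ℝ) * Complex.I) *
        (((97200 * (⌈|inner ℝ b.1 e|⌉₊ + 1) ^ 7 : ℝ) : ℂ) ^ 3 *
          φ ((97200 * ((⌈|inner ℝ b.1 e|⌉₊ : ℝ) + 1) ^ 7) • (ξ - b.2)))) *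
      Complex.exp (2 * π * (inner ℝ b.1 e : ℝ) * T * Complex.I) := by
    intro b
    rw [← integral_contour_eq (A (inner ℝ b.1 e, b.2)) (inner ℝ b.1 e) hT, ← integral_const_mul]
    refine integral_congr_ae (Eventually.of_forall fun θ => ?_)
    simp only [hF]
    have h2 : contourScale (A (inner ℝ b.1 e, b.2)) = ⌈|inner ℝ b.1 e|⌉₊ + 1 := by
      rw [contourScale, (hA' (inner ℝ b.1 e, b.2)).scale]
    rw [← h2]
    ring
  have h2 := hFi.integral_prod_left
  rw [divisionMeasure, integral_prod _ hFi, integral_prod _ h2]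
  have h3 : ∀ η : H, ∫ μ in Metric.closedBall (0 : R3) 2, ∫ θ in Set.Ioc 0 (2 * π),
      F ((η, μ), θ) = Complex.exp ((2 * π * inner ℝ η (x + T • e) : ℝ) * Complex.I) •
        (𝓕 K : 𝓢(H, ℂ)) η := by
    intro η
    simp only [h1]
    rw [integral_mul_const, integral_const_mul, integral_const_mul, integral_dilate_mollifier hφ hφ1 _ hξ]
    · rw [mul_one, mul_assoc, ← Complex.exp_add, smul_eq_mul, mul_comm]
      congr 2
      rw [inner_add_right, inner_smul_right]
      push_cast
      ring
    · have : (1 : ℝ) ≤ ((⌈|inner ℝ η e|⌉₊ : ℝ) + 1) ^ 7 := one_le_pow₀ (by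
        have : (0 : ℝ) ≤ (⌈|inner ℝ η e|⌉₊ : ℝ) := by positivity
        linarith)
      linarith
  simp only [h3]
  have h4 : 𝓕⁻ (𝓕 K : 𝓢(H, ℂ)) = K := FourierTransform.fourierInv_fourier_eq K
  rw [← Real.fourierInv_eq', ← SchwartzMap.fourierInv_coe, h4]

theorem exists_eq_mul_quintic_add_of_schwartz (he : ‖e‖ ≤ 1) (K : 𝓢(H, ℂ)) :
    ∃ (Q : H × ℝ × R3 → ℂ) (R : Fin 5 → H × R3 → ℂ), ContDiff ℝ ∞ Q ∧
      (∀ j, ContDiff ℝ ∞ (R j)) ∧ ∀ (x : H) (T : ℝ) (ξ : R3), |T| ≤ 1 → ‖ξ‖ ≤ 1 →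
        K (x + T • e) = Q (x, T, ξ) * quintic ξ T + ∑ j, R j (x, ξ) * (T : ℂ) ^ (j : ℕ) := by
  obtain ⟨A, hA, hA'⟩ := exists_measurable_adaptedContour
  obtain ⟨φ, hφ, hφs, hφb, hφ1⟩ := exists_contDiff_mollifier
  obtain ⟨G, hG, hGi, hGb⟩ := exists_contDiff_eq_inv
  have hq := contDiff_integral_divisionKernel hA hA' he (𝓕 K : 𝓢(H, ℂ)) hφ hφb hG hGb
    (fun i => contDiff_quotientFactor hG i)
    (polyBounded_quotientFactor hG hGb he fun a => hA' (inner ℝ a.1.1 e, a.1.2))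
  have hr := fun j => contDiff_integral_divisionKernel hA hA' he (𝓕 K : 𝓢(H, ℂ)) hφ hφb hG hGb
    (fun i => contDiff_remainderFactor j i)
    (polyBounded_remainderFactor he (fun a => hA' (inner ℝ a.1.1 e, a.1.2)) j)
  refine ⟨_, fun j y => ∫ a, (𝓕 K : 𝓢(H, ℂ)) a.1.1 * divisionKernel φ G e (remainderFactor j)
    (A (inner ℝ a.1.1 e, a.1.2)) a (y.1, 0, y.2) ∂(divisionMeasure H), hq.1, fun j => ?_, ?_⟩
  · have h1 : ContDiff ℝ ∞ fun y : H × R3 => (y.1, (0 : ℝ), y.2) := by fun_prop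
    have h2 := (hr j).1.comp h1
    exact h2
  · intro x T ξ hT hξ
    have h0 : ∀ j a, divisionKernel φ G e (remainderFactor j)
        (A (inner ℝ a.1.1 e, a.1.2)) a (x, 0, ξ) = divisionKernel φ G e (remainderFactor j)
        (A (inner ℝ a.1.1 e, a.1.2)) a (x, T, ξ) := fun j a => rfl
    simp only [h0]
    have hi := ((hq.2 (x, T, ξ)).mul_const (quintic ξ T)).add
      (integrable_finsetSum Finset.univ fun j _ =>
        ((hr j).2 (x, T, ξ)).mul_const ((T : ℂ) ^ (j : ℕ)))
    simp only [← integral_mul_const]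
    rw [← integral_finsetSum _ fun j _ => ((hr j).2 (x, T, ξ)).mul_const _,
      ← integral_add ((hq.2 (x, T, ξ)).mul_const _) (integrable_finsetSum Finset.univ fun j _ =>
        ((hr j).2 (x, T, ξ)).mul_const ((T : ℂ) ^ (j : ℕ)))]
    refine (integral_divisionMeasure_eq hA' K hφs hφ1 x hT hξ (fun a => ?_) hi).symm
    rw [← divisionKernel_mul_add_sum hφs hGi (hA' (inner ℝ a.1.1 e, a.1.2)) x hT ξ, mul_add,
      Finset.mul_sum]
    simp only [Pi.add_apply, mul_assoc]

/-- The real quintic `T⁵ + xT² + yT + z` unfolding `T⁵`. -/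
def realQuintic (ξ : R3) (T : ℝ) : ℝ := T ^ 5 + ξ.1 * T ^ 2 + ξ.2.1 * T + ξ.2.2

/-- Division of a smooth function by the polynomial `T⁵ + xT² + yT + z`. -/
theorem exists_eq_mul_realQuintic_add (he : ‖e‖ ≤ 1) {K : H → ℝ} (hK : ContDiff ℝ ∞ K)
    (hKc : HasCompactSupport K) :
    ∃ (Q : H × ℝ × R3 → ℝ) (R : Fin 5 → H × R3 → ℝ), ContDiff ℝ ∞ Q ∧
      (∀ j, ContDiff ℝ ∞ (R j)) ∧ ∀ (x : H) (T : ℝ) (ξ : R3), |T| ≤ 1 → ‖ξ‖ ≤ 1 →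
        K (x + T • e) = Q (x, T, ξ) * realQuintic ξ T + ∑ j, R j (x, ξ) * T ^ (j : ℕ) := by
  have h1 : ContDiff ℝ ∞ fun x => (K x : ℂ) := Complex.ofRealCLM.contDiff.comp hK
  have h2 : HasCompactSupport fun x => (K x : ℂ) := hKc.comp_left Complex.ofReal_zero
  obtain ⟨Q, R, hQ, hR, h⟩ := exists_eq_mul_quintic_add_of_schwartz he (h2.toSchwartzMap h1)
  refine ⟨fun y => (Q y).re, fun j y => (R j y).re, Complex.reCLM.contDiff.comp hQ,
    fun j => Complex.reCLM.contDiff.comp (hR j), fun x T ξ hT hξ => ?_⟩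
  have h3 := congrArg Complex.re (h x T ξ hT hξ)
  have h4 : quintic ξ T = ((realQuintic ξ T : ℝ) : ℂ) := by
    simp [quintic, realQuintic]
  have h5 : ∀ j : Fin 5, R j (x, ξ) * (T : ℂ) ^ (j : ℕ) =
      R j (x, ξ) * ((T ^ (j : ℕ) : ℝ) : ℂ) := by simp
  rw [h4] at h3
  simp only [h5, Complex.add_re, Complex.re_sum, Complex.re_mul_ofReal] at h3
  simpa using h3

end DivisionTheorem

section LocalDiffeomorphism

variable {E F : Type*} [NormedAddCommGroup E] [NormedSpace ℝ E] [FiniteDimensional ℝ E]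
  [NormedAddCommGroup F] [NormedSpace ℝ F]

theorem ContDiffOn.exists_hasCompactSupport_eventuallyEq {f : E → F} {U : Set E} (hU : IsOpen U)
    (hf : ContDiffOn ℝ ∞ f U) {x : E} (hx : x ∈ U) :
    ∃ g : E → F, ContDiff ℝ ∞ g ∧ HasCompactSupport g ∧ g =ᶠ[𝓝 x] f := by
  obtain ⟨r, hr, hrU⟩ := Metric.nhds_basis_closedBall.mem_iff.1 (hU.mem_nhds hx)
  let b : ContDiffBump x := ⟨r / 2, r, by positivity, by linarith⟩
  have hs : tsupport (fun y => b y • f y) ⊆ Metric.closedBall x r :=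
    (tsupport_smul_subset_left (fun y => b y) f).trans_eq b.tsupport_eq
  refine ⟨fun y => b y • f y, contDiff_iff_contDiffAt.2 fun y => ?_, b.hasCompactSupport.smul_right,
    ?_⟩
  · by_cases hy : y ∈ tsupport fun y => b y • f y
    · exact b.contDiff.contDiffAt.smul (hf.contDiffAt (hU.mem_nhds (hrU (hs hy))))
    · exact contDiffAt_const.congr_of_eventuallyEq (notMem_tsupport_iff_eventuallyEq.1 hy)
  · filter_upwards [b.eventuallyEq_one] with y hy
    simp only [hy, Pi.one_apply, one_smul]

theorem isLocalDiffeoAt_of_injective_fderiv {Φ : E → E} (hΦ : ContDiff ℝ ∞ Φ) {p : E}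
    (h : Function.Injective (fderiv ℝ Φ p)) : IsLocalDiffeoAt Φ p := by
  have : CompleteSpace E := FiniteDimensional.complete ℝ E
  let L : E ≃L[ℝ] E := (LinearEquiv.ofInjectiveEndo (fderiv ℝ Φ p).toLinearMap h).toContinuousLinearEquiv
  have hL : (L : E →L[ℝ] E) = fderiv ℝ Φ p := by
    ext x
    rfl
  have hd : HasFDerivAt Φ (L : E →L[ℝ] E) p := by
    rw [hL]
    exact (hΦ.differentiable (by simp)).differentiableAt.hasFDerivAt
  let e := hΦ.contDiffAt.toOpenPartialHomeomorph Φ hd (by simp)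
  let O : Set E := {x | fderiv ℝ Φ x ∈ Set.range ((↑) : (E ≃L[ℝ] E) → E →L[ℝ] E)}
  have hO : IsOpen O := (ContinuousLinearEquiv.isOpen (𝕜 := ℝ) (E := E) (F := E)).preimage
    (hΦ.continuous_fderiv (by simp))
  let e' := e.restrOpen O hO
  have he' : ∀ x, e' x = Φ x := fun x => rfl
  have hs : ∀ x ∈ e'.source, x ∈ O := fun x hx => by
    rw [OpenPartialHomeomorph.restrOpen_source] at hx
    exact hx.2
  have hp : p ∈ e'.source := by
    rw [OpenPartialHomeomorph.restrOpen_source]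
    exact ⟨hΦ.contDiffAt.mem_toOpenPartialHomeomorph_source hd (by simp), L, hL⟩
  refine ⟨e'.source, e'.target, e'.symm, e'.open_source, hp, e'.open_target, e'.map_source hp,
    hΦ.contDiffOn, fun y hy => ?_, fun x hx => e'.map_source hx, fun y hy => e'.map_target hy,
    fun x hx => e'.left_inv hx, fun y hy => e'.right_inv hy⟩
  obtain ⟨M, hM⟩ := hs _ (e'.map_target hy)
  refine (e'.contDiffAt_symm hy (f₀' := M) ?_ hΦ.contDiffAt).contDiffWithinAt
  rw [hM]
  exact (hΦ.differentiable (by simp)).differentiableAt.hasFDerivAt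

theorem exists_eventually_inverse {Φ : E → E} (hΦ : ContDiff ℝ ∞ Φ) {p : E}
    (h : Function.Injective (fderiv ℝ Φ p)) :
    ∃ η : E → E, ContDiff ℝ ∞ η ∧ (∀ᶠ x in 𝓝 p, η (Φ x) = x) ∧ ∀ᶠ y in 𝓝 (Φ p), Φ (η y) = y := by
  obtain ⟨U, V, η, hU, hpU, hV, hpV, -, hη, -, hηm, hl, hr⟩ :=
    isLocalDiffeoAt_of_injective_fderiv hΦ h
  obtain ⟨g, hg, -, hgη⟩ := hη.exists_hasCompactSupport_eventuallyEq hV hpV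
  refine ⟨g, hg, ?_, ?_⟩
  · filter_upwards [hΦ.continuous.continuousAt.eventually hgη, hU.mem_nhds hpU] with x hx hxU
    rw [hx, hl x hxU]
  · filter_upwards [hgη, hV.mem_nhds hpV] with y hy hyV
    rw [hy, hr y hyV]

theorem exists_implicit_function {G : Type*} [NormedAddCommGroup G] [NormedSpace ℝ G]
    [FiniteDimensional ℝ G] {F : E × G → G} (hF : ContDiff ℝ ∞ F) {x₀ : E} {y₀ : G}
    (h0 : F (x₀, y₀) = 0) (h : ∀ b, fderiv ℝ F (x₀, y₀) (0, b) = 0 → b = 0) :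
    ∃ φ : E → G, ContDiff ℝ ∞ φ ∧ φ x₀ = y₀ ∧ (∀ᶠ x in 𝓝 x₀, F (x, φ x) = 0) ∧
      ∀ᶠ q in 𝓝 (x₀, y₀), F q = 0 → q.2 = φ q.1 := by
  have hΦ : ContDiff ℝ ∞ fun q : E × G => (q.1, F q) := contDiff_fst.prodMk hF
  have hd : HasFDerivAt (fun q : E × G => (q.1, F q))
      ((ContinuousLinearMap.fst ℝ E G).prod (fderiv ℝ F (x₀, y₀))) (x₀, y₀) :=
    hasFDerivAt_fst.prodMk (hF.differentiable (by simp)).differentiableAt.hasFDerivAt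
  obtain ⟨η, hη, hl, hr⟩ := exists_eventually_inverse hΦ (p := (x₀, y₀)) (by
    rw [hd.fderiv, injective_iff_map_eq_zero]
    rintro ⟨a, b⟩ hab
    simp only [ContinuousLinearMap.prod_apply, Prod.mk_eq_zero,
      ContinuousLinearMap.coe_fst'] at hab
    obtain ⟨rfl, hb⟩ := hab
    rw [h b hb]
    rfl)
  have h1 : ContDiff ℝ ∞ fun x : E => (x, (0 : G)) := contDiff_id.prodMk contDiff_const
  have h2 : ContDiff ℝ ∞ fun x : E => (η (x, 0)).2 := by
    have h3 := contDiff_snd.comp (hη.comp h1)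
    exact h3
  refine ⟨_, h2, ?_, ?_, ?_⟩
  · have := hl.self_of_nhds
    rw [h0] at this
    simp only [this]
  · rw [h0] at hr
    have h3 : Tendsto (fun x : E => (x, (0 : G))) (𝓝 x₀) (𝓝 (x₀, 0)) :=
      h1.continuous.tendsto x₀
    filter_upwards [h3.eventually hr] with x hx
    rw [Prod.ext_iff] at hx
    have h4 : (x, (η (x, 0)).2) = η (x, 0) := Prod.ext hx.1.symm rfl
    rw [h4]
    exact hx.2
  · filter_upwards [hl] with q hq hFq
    rw [hFq] at hq
    simp only [hq]

end LocalDiffeomorphism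

section NormalForm

theorem eq_zero_of_sum_eq_pow_mul {n : ℕ} {r : ℕ → ℝ} {g : ℝ → ℝ} (hg : ContinuousAt g 0)
    (h : ∀ᶠ T in 𝓝 (0 : ℝ), ∑ i ∈ Finset.range n, r i * T ^ i = T ^ n * g T) :
    ∀ i < n, r i = 0 := by
  induction n generalizing r with
  | zero => simp
  | succ n ih =>
    have h0 : r 0 = 0 := by
      have := h.self_of_nhds
      rw [Finset.sum_range_succ'] at this
      simpa using this
    have h1 : ∀ᶠ T in 𝓝[≠] (0 : ℝ), ∑ i ∈ Finset.range n, r (i + 1) * T ^ i = T ^ n * g T := by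
      filter_upwards [h.filter_mono nhdsWithin_le_nhds, self_mem_nhdsWithin] with T hT hT0
      rw [Finset.sum_range_succ', h0] at hT
      have h2 : T * ∑ i ∈ Finset.range n, r (i + 1) * T ^ i = T * (T ^ n * g T) := by
        rw [Finset.mul_sum, ← mul_assoc, ← pow_succ', ← hT]
        simp only [zero_mul, add_zero]
        exact Finset.sum_congr rfl fun i _ => by ring
      exact mul_left_cancel₀ hT0 h2
    have h2 : (fun T : ℝ => ∑ i ∈ Finset.range n, r (i + 1) * T ^ i) =ᶠ[𝓝 0]
        fun T => T ^ n * g T :=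
      (ContinuousAt.eventuallyEq_nhds_iff_eventuallyEq_nhdsNE (by fun_prop)
        (by fun_prop)).1 h1
    intro i hi
    cases i with
    | zero => exact h0
    | succ i => exact ih (r := fun i => r (i + 1)) h2 i (by omega)

theorem exists_eventually_eq_mul_realQuintic_add {E : Type} [NormedAddCommGroup E]
    [NormedSpace ℝ E] [FiniteDimensional ℝ E] {K : ℝ × E → ℝ} (hK : ContDiff ℝ ∞ K) (a₀ : E) :
    ∃ (Q : ℝ × E × R3 → ℝ) (R : ℕ → E × R3 → ℝ), ContDiff ℝ ∞ Q ∧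
      (∀ j, ContDiff ℝ ∞ (R j)) ∧ ∀ᶠ q : ℝ × E × R3 in 𝓝 (0, a₀, 0),
        K (q.1, q.2.1) = Q q * realQuintic q.2.2 q.1 +
          ∑ j ∈ Finset.range 5, R j q.2 * q.1 ^ j := by
  let H := WithLp 2 (ℝ × EuclideanSpace ℝ (Fin (Module.finrank ℝ E)))
  let ι : E →L[ℝ] H := (WithLp.prodContinuousLinearEquiv 2 ℝ ℝ _).symm.toContinuousLinearMap.comp
    ((ContinuousLinearMap.inr ℝ ℝ _).comp toEuclidean.toContinuousLinearMap)
  let e : H := WithLp.toLp 2 (1, 0)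
  let pr1 : H →L[ℝ] ℝ := (ContinuousLinearMap.fst ℝ ℝ _).comp
    (WithLp.prodContinuousLinearEquiv 2 ℝ ℝ _).toContinuousLinearMap
  let pr2 : H →L[ℝ] E := toEuclidean.symm.toContinuousLinearMap.comp
    ((ContinuousLinearMap.snd ℝ ℝ _).comp
    (WithLp.prodContinuousLinearEquiv 2 ℝ ℝ _).toContinuousLinearMap)
  have h1 : ∀ a T, pr1 (ι a + T • e) = T := fun a T => by
    change (0 : ℝ) + T * 1 = T
    ring
  have h2 : ∀ (a : E) (T : ℝ), pr2 (ι a + T • e) = a := fun a T => by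
    change toEuclidean.symm (toEuclidean a + T • 0) = a
    simp
  have he : ‖e‖ ≤ 1 := by
    rw [WithLp.prod_norm_eq_of_L2]
    simp [e]
  have hK' : ContDiff ℝ ∞ fun h : H => K (pr1 h, pr2 h) := by
    have h3 := hK.comp (pr1.contDiff.prodMk pr2.contDiff)
    exact h3
  obtain ⟨k, hk, hkc, hke⟩ :=
    hK'.contDiffOn.exists_hasCompactSupport_eventuallyEq isOpen_univ (Set.mem_univ (ι a₀))
  borelize H
  obtain ⟨Q, R, hQ, hR, h⟩ := exists_eq_mul_realQuintic_add he hk hkc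
  have hR' : ∀ j, ContDiff ℝ ∞ fun y : E × R3 => R j (ι y.1, y.2) := fun j => by
    have h3 : ContDiff ℝ ∞ fun y : E × R3 => (ι y.1, y.2) := by fun_prop
    have h4 := (hR j).comp h3
    exact h4
  refine ⟨fun q => Q (ι q.2.1, q.1, q.2.2), fun j => if hj : j < 5 then
    fun y => R ⟨j, hj⟩ (ι y.1, y.2) else 0, ?_, fun j => ?_, ?_⟩
  · have h3 : ContDiff ℝ ∞ fun q : ℝ × E × R3 => (ι q.2.1, q.1, q.2.2) := by fun_prop
    have h4 := hQ.comp h3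
    exact h4
  · by_cases hj : j < 5
    · simp only [hj, dif_pos]
      exact hR' _
    · simp only [hj, dif_neg, not_false_eq_true]
      exact contDiff_const
  · have h3 : Tendsto (fun q : ℝ × E × R3 => ι q.2.1 + q.1 • e) (𝓝 (0, a₀, 0)) (𝓝 (ι a₀)) := by
      have : Continuous fun q : ℝ × E × R3 => ι q.2.1 + q.1 • e := by fun_prop
      simpa using this.tendsto (0, a₀, 0)
    have h4 : ∀ᶠ q : ℝ × E × R3 in 𝓝 (0, a₀, 0), |q.1| < 1 :=
      ContinuousAt.eventually_lt (by fun_prop) continuousAt_const (by simp)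
    have h5 : ∀ᶠ q : ℝ × E × R3 in 𝓝 (0, a₀, 0), ‖q.2.2‖ < 1 :=
      ContinuousAt.eventually_lt (by fun_prop) continuousAt_const (by simp)
    filter_upwards [h3.eventually hke, h4, h5] with q hq hT hξ
    rw [h1, h2] at hq
    rw [← hq, h _ _ _ hT.le hξ.le, Finset.sum_range]
    simp

end NormalForm

section NormalForm

/-- The quartic substitution `a₂ + T + bT² + cT³ + dT⁴` with parameters `a = (a₁, a₂, b, c, d)`. -/
def quarticShift (T : ℝ) (a : ℝ × ℝ × R3) : ℝ :=
  a.2.1 + T + a.2.2.1 * T ^ 2 + a.2.2.2.1 * T ^ 3 + a.2.2.2.2 * T ^ 4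

theorem contDiff_quarticShift :
    ContDiff ℝ ∞ fun q : ℝ × (ℝ × ℝ × R3) => quarticShift q.1 q.2 := by
  unfold quarticShift
  fun_prop

/-- The function `k` generates, as an envelope, a front with a cuspidal butterfly at the origin. -/
structure ButterflyJet (k : R2 → ℝ) (c : ℕ → ℝ) (e : ℝ) (g ε : ℝ → ℝ) : Prop where
  smooth : ContDiff ℝ ∞ k
  smooth_g : ContDiff ℝ ∞ g
  continuous_ε : Continuous ε
  eq : ∀ᶠ t in 𝓝 (0 : ℝ),
    k (0, t) = t ^ 5 * (c 0 + c 1 * t + c 2 * t ^ 2 + c 3 * t ^ 3 + t ^ 4 * g t)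
  fderiv_eq : ∀ᶠ t in 𝓝 (0 : ℝ), fderiv ℝ k (0, t) (1, 0) = t ^ 2 * (e + t ^ 2 * ε t)
  c_ne : c 0 ≠ 0
  e_ne : e ≠ 0

/-- `Q` and the `R j` are quotient and remainder of the division of `k` by the unfolded quintic,
near the parameter `a`. -/
structure QuinticDivision (k : R2 → ℝ) (Q : ℝ × (ℝ × ℝ × R3) × R3 → ℝ)
    (R : ℕ → (ℝ × ℝ × R3) × R3 → ℝ) (a : ℝ × ℝ × R3) : Prop where
  smooth_Q : ContDiff ℝ ∞ Q
  smooth_R : ∀ j, ContDiff ℝ ∞ (R j)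
  eq : ∀ᶠ q : ℝ × (ℝ × ℝ × R3) × R3 in 𝓝 (0, a, 0),
    k (q.2.1.1, quarticShift q.1 q.2.1) = Q q * realQuintic q.2.2 q.1 +
      ∑ j ∈ Finset.range 5, R j q.2 * q.1 ^ j

/-- Taylor coefficients of the quotient at parameters `(0, 0, β)`. -/
def quotientJet (c : ℕ → ℝ) (β : R3) : ℕ → ℝ
  | 0 => c 0
  | 1 => 5 * β.1 * c 0 + c 1
  | 2 => c 0 * (5 * β.2.1 + 10 * β.1 ^ 2) + 6 * β.1 * c 1 + c 2
  | 3 => c 0 * (5 * β.2.2 + 20 * β.1 * β.2.1 + 10 * β.1 ^ 3) +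
    c 1 * (6 * β.2.1 + 15 * β.1 ^ 2) + 7 * β.1 * c 2 + c 3
  | _ => 0

theorem exists_jet_substitution (c : ℕ → ℝ) (β : R3) {g : ℝ → ℝ} (hg : Continuous g) :
    ∃ h : ℝ → ℝ, Continuous h ∧ ∀ T s : ℝ, s = 1 + β.1 * T + β.2.1 * T ^ 2 + β.2.2 * T ^ 3 →
      s ^ 5 * (c 0 + c 1 * (T * s) + c 2 * (T * s) ^ 2 + c 3 * (T * s) ^ 3 +
        (T * s) ^ 4 * g (T * s)) = quotientJet c β 0 + quotientJet c β 1 * T +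
          quotientJet c β 2 * T ^ 2 + quotientJet c β 3 * T ^ 3 + T ^ 4 * h T := by
  obtain ⟨b, c', d⟩ := β
  obtain ⟨y, hy, hyd⟩ : ∃ y : ℝ → ℝ, Continuous y ∧ ∀ T, y T = c' + T * d :=
    ⟨_, by fun_prop, fun _ => rfl⟩
  obtain ⟨z, hz, hzd⟩ : ∃ z : ℝ → ℝ, Continuous z ∧ ∀ T, z T = b + T * y T :=
    ⟨_, by fun_prop, fun _ => rfl⟩
  refine ⟨fun T =>
    c 0 * (10 * (2 * b * d + y T ^ 2) +
      10 * (3 * b ^ 2 * y T + 3 * b * T * y T ^ 2 + T ^ 2 * y T ^ 3) + 5 * z T ^ 4 + T * z T ^ 5) +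
    c 1 * (6 * d + 15 * (2 * b * y T + T * y T ^ 2) + 20 * z T ^ 3 + 15 * T * z T ^ 4 +
      6 * T ^ 2 * z T ^ 5 + T ^ 3 * z T ^ 6) +
    c 2 * (7 * y T + 21 * z T ^ 2 + 35 * T * z T ^ 3 + 35 * T ^ 2 * z T ^ 4 +
      21 * T ^ 3 * z T ^ 5 + 7 * T ^ 4 * z T ^ 6 + T ^ 5 * z T ^ 7) +
    c 3 * (8 * z T + 28 * T * z T ^ 2 + 56 * T ^ 2 * z T ^ 3 + 70 * T ^ 3 * z T ^ 4 +
      56 * T ^ 4 * z T ^ 5 + 28 * T ^ 5 * z T ^ 6 + 8 * T ^ 6 * z T ^ 7 + T ^ 7 * z T ^ 8) +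
    (1 + T * z T) ^ 9 * g (T * (1 + T * z T)), by fun_prop, ?_⟩
  rintro T s hs
  have hs' : s = 1 + T * z T := by
    rw [hs]
    simp only [hzd, hyd]
    ring
  have h1 : T * z T = T * b + T ^ 2 * c' + T ^ 3 * d := by simp only [hzd, hyd]; ring
  have h2 : T ^ 2 * z T ^ 2 = T ^ 2 * b ^ 2 + 2 * b * c' * T ^ 3 +
      T ^ 4 * (2 * b * d + y T ^ 2) := by simp only [hzd, hyd]; ring
  have h3 : T ^ 3 * z T ^ 3 = T ^ 3 * b ^ 3 +
      T ^ 4 * (3 * b ^ 2 * y T + 3 * b * T * y T ^ 2 + T ^ 2 * y T ^ 3) := by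
    simp only [hzd]; ring
  have h4 : T ^ 3 * z T ^ 2 = T ^ 3 * b ^ 2 + T ^ 4 * (2 * b * y T + T * y T ^ 2) := by
    simp only [hzd]; ring
  have h5 : T ^ 3 * z T = T ^ 3 * b + T ^ 4 * y T := by simp only [hzd]; ring
  rw [hs']
  simp only [quotientJet]
  linear_combination c 0 * (5 * h1 + 10 * h2 + 10 * h3) + c 1 * (6 * T * h1 + 15 * h4) +
    c 2 * 7 * h5

variable {k : R2 → ℝ} {c : ℕ → ℝ} {e : ℝ} {g ε : ℝ → ℝ} {Q : ℝ × (ℝ × ℝ × R3) × R3 → ℝ}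
  {R : ℕ → (ℝ × ℝ × R3) × R3 → ℝ} {β : R3}

theorem tendsto_quarticShift (β : R3) :
    Tendsto (fun T => quarticShift T (0, 0, β)) (𝓝 0) (𝓝 0) := by
  have h : Continuous fun T => quarticShift T (0, 0, β) := by
    unfold quarticShift
    fun_prop
  simpa [quarticShift] using h.tendsto 0

theorem ButterflyJet.quotient_jet (hk : ButterflyJet k c e g ε)
    (hd : QuinticDivision k Q R (0, 0, β)) :
    (∀ j < 5, R j ((0, 0, β), 0) = 0) ∧ ∃ h : ℝ → ℝ, Continuous h ∧
      ∀ᶠ T in 𝓝 (0 : ℝ), Q (T, (0, 0, β), 0) = quotientJet c β 0 + quotientJet c β 1 * T +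
          quotientJet c β 2 * T ^ 2 + quotientJet c β 3 * T ^ 3 + T ^ 4 * h T := by
  obtain ⟨h, hh, hj⟩ := exists_jet_substitution c β hk.smooth_g.continuous
  have h0 : ∀ T, quarticShift T (0, 0, β) =
      T * (1 + β.1 * T + β.2.1 * T ^ 2 + β.2.2 * T ^ 3) := fun T => by
    simp only [quarticShift]
    ring
  have h1 : Tendsto (fun T : ℝ => (T, ((0 : ℝ), (0 : ℝ), β), (0 : R3))) (𝓝 0)
      (𝓝 (0, (0, 0, β), 0)) := by
    have : Continuous fun T : ℝ => (T, ((0 : ℝ), (0 : ℝ), β), (0 : R3)) := by fun_prop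
    exact this.tendsto 0
  have h2 : ∀ᶠ T in 𝓝 (0 : ℝ), ∑ j ∈ Finset.range 5, R j ((0, 0, β), 0) * T ^ j = T ^ 5 *
      (quotientJet c β 0 + quotientJet c β 1 * T + quotientJet c β 2 * T ^ 2 +
        quotientJet c β 3 * T ^ 3 + T ^ 4 * h T - Q (T, (0, 0, β), 0)) := by
    filter_upwards [h1.eventually hd.eq, (tendsto_quarticShift β).eventually hk.eq] with T hT hT'
    rw [hT', h0, mul_pow, mul_assoc, hj T _ rfl] at hT
    simp only [realQuintic, Prod.fst_zero, Prod.snd_zero] at hT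
    linear_combination -hT
  have hQc : Continuous fun T : ℝ => Q (T, ((0 : ℝ), (0 : ℝ), β), (0 : R3)) :=
    hd.smooth_Q.continuous.comp (by fun_prop)
  have h3 := eq_zero_of_sum_eq_pow_mul
    (Continuous.sub (by fun_prop) hQc).continuousAt h2
  refine ⟨h3, h, hh, ?_⟩
  refine (ContinuousAt.eventuallyEq_nhds_iff_eventuallyEq_nhdsNE hQc.continuousAt (by fun_prop)).1 ?_
  filter_upwards [h2.filter_mono nhdsWithin_le_nhds, self_mem_nhdsWithin] with T hT hT0
  have h4 : ∑ j ∈ Finset.range 5, R j ((0, 0, β), 0) * T ^ j = 0 :=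
    Finset.sum_eq_zero fun j hj => by rw [h3 j (Finset.mem_range.1 hj), zero_mul]
  rw [h4, eq_comm, mul_eq_zero, sub_eq_zero] at hT
  exact (hT.resolve_left (pow_ne_zero 5 hT0)).symm

theorem ButterflyJet.exists_fderiv_eq (hk : ButterflyJet k c e g ε) :
    ∃ h : ℝ → ℝ, Continuous h ∧
      ∀ᶠ t in 𝓝 (0 : ℝ), fderiv ℝ k (0, t) (0, 1) = t ^ 4 * (5 * c 0 + t * h t) := by
  have hg' : Continuous (deriv g) := hk.smooth_g.continuous_deriv (by simp)
  have hg := hk.smooth_g.continuous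
  refine ⟨fun t => 5 * (c 1 + c 2 * t + c 3 * t ^ 2 + t ^ 3 * g t) + (c 1 + 2 * c 2 * t +
    3 * c 3 * t ^ 2 + 4 * t ^ 3 * g t + t ^ 4 * deriv g t), by fun_prop, ?_⟩
  filter_upwards [hk.eq.eventually_nhds] with t ht
  have h1 : HasDerivAt (fun t => k (0, t)) (fderiv ℝ k (0, t) (0, 1)) t :=
    (hk.smooth.differentiable (by simp)).differentiableAt.hasFDerivAt.comp_hasDerivAt t
      ((hasDerivAt_const t (0 : ℝ)).prodMk (hasDerivAt_id t))
  have hgt : HasDerivAt g (deriv g t) t :=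
    (hk.smooth_g.differentiable (by simp)).differentiableAt.hasDerivAt
  have hid := hasDerivAt_id t
  have h2 := (hid.pow 5).mul (((((hasDerivAt_const t (c 0)).add (hid.const_mul (c 1))).add
    ((hid.pow 2).const_mul (c 2))).add ((hid.pow 3).const_mul (c 3))).add ((hid.pow 4).mul hgt))
  rw [(h1.congr_of_eventuallyEq (EventuallyEq.symm ht)).unique h2]
  simp
  ring

end NormalForm

section NormalForm

variable {k : R2 → ℝ} {c : ℕ → ℝ} {e : ℝ} {g ε : ℝ → ℝ} {Q : ℝ × (ℝ × ℝ × R3) × R3 → ℝ}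
  {R : ℕ → (ℝ × ℝ × R3) × R3 → ℝ} {β : R3}

theorem hasDerivAt_comp_line {E F : Type*} [NormedAddCommGroup E] [NormedSpace ℝ E]
    [NormedAddCommGroup F] [NormedSpace ℝ F] {f : E → F} (hf : ContDiff ℝ ∞ f) (x v : E) :
    HasDerivAt (fun s : ℝ => f (x + s • v)) (fderiv ℝ f x v) 0 := by
  have h1 : HasDerivAt (fun s : ℝ => x + s • v) v 0 := by
    simpa using ((hasDerivAt_id (0 : ℝ)).smul_const v).const_add x
  have h2 : HasFDerivAt f (fderiv ℝ f x) (x + (0 : ℝ) • v) := by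
    rw [zero_smul, add_zero]
    exact (hf.differentiable (by simp)).differentiableAt.hasFDerivAt
  exact h2.comp_hasDerivAt (0 : ℝ) h1

theorem QuinticDivision.fderiv_eq (hk : ContDiff ℝ ∞ k) (hd : QuinticDivision k Q R (0, 0, β))
    (α : ℝ × ℝ × R3) (v : R3) :
    ∀ᶠ T in 𝓝 (0 : ℝ),
      α.1 * fderiv ℝ k (0, quarticShift T (0, 0, β)) (1, 0) +
        (α.2.1 + α.2.2.1 * T ^ 2 + α.2.2.2.1 * T ^ 3 + α.2.2.2.2 * T ^ 4) *
          fderiv ℝ k (0, quarticShift T (0, 0, β)) (0, 1) =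
      fderiv ℝ Q (T, (0, 0, β), 0) (0, α, v) * T ^ 5 +
        Q (T, (0, 0, β), 0) * (v.1 * T ^ 2 + v.2.1 * T + v.2.2) +
        ∑ j ∈ Finset.range 5, fderiv ℝ (R j) ((0, 0, β), 0) (α, v) * T ^ j := by
  have h1 : Tendsto (fun T : ℝ => (T, ((0 : ℝ), (0 : ℝ), β), (0 : R3))) (𝓝 0)
      (𝓝 (0, (0, 0, β), 0)) := by
    have : Continuous fun T : ℝ => (T, ((0 : ℝ), (0 : ℝ), β), (0 : R3)) := by fun_prop
    exact this.tendsto 0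
  filter_upwards [h1.eventually hd.eq.eventually_nhds] with T hT
  have h2 : Tendsto (fun s : ℝ => (T, ((0 : ℝ), (0 : ℝ), β), (0 : R3)) + s • ((0 : ℝ), α, v)) (𝓝 0)
      (𝓝 (T, (0, 0, β), 0)) := by
    have : Continuous fun s : ℝ => (T, ((0 : ℝ), (0 : ℝ), β), (0 : R3)) + s • ((0 : ℝ), α, v) := by
      fun_prop
    simpa using this.tendsto 0
  have h3 := h2.eventually hT
  have h4 : HasDerivAt (fun s : ℝ => realQuintic (s • v) T) (v.1 * T ^ 2 + v.2.1 * T + v.2.2) 0 := by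
    have : ∀ s : ℝ, realQuintic (s • v) T = T ^ 5 + s * (v.1 * T ^ 2 + v.2.1 * T + v.2.2) := by
      intro s
      simp only [realQuintic, Prod.smul_fst, Prod.smul_snd, smul_eq_mul]
      ring
    simp only [this]
    simpa using ((hasDerivAt_id (0 : ℝ)).mul_const (v.1 * T ^ 2 + v.2.1 * T + v.2.2)).const_add
      (T ^ 5)
  have h5 := (hasDerivAt_comp_line hd.smooth_Q (T, ((0 : ℝ), (0 : ℝ), β), (0 : R3)) (0, α, v)).mul h4
  have h6 := HasDerivAt.fun_sum fun j (_ : j ∈ Finset.range 5) =>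
    (hasDerivAt_comp_line (hd.smooth_R j) (((0 : ℝ), (0 : ℝ), β), (0 : R3)) (α, v)).mul_const (T ^ j)
  have h7 := hasDerivAt_comp_line hk (0, quarticShift T (0, 0, β))
    (α.1, α.2.1 + α.2.2.1 * T ^ 2 + α.2.2.2.1 * T ^ 3 + α.2.2.2.2 * T ^ 4)
  have h8 := h7.unique ((h5.add h6).congr_of_eventuallyEq ?_)
  · have h9 : (α.1, α.2.1 + α.2.2.1 * T ^ 2 + α.2.2.2.1 * T ^ 3 + α.2.2.2.2 * T ^ 4) =
        α.1 • ((1 : ℝ), (0 : ℝ)) +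
          (α.2.1 + α.2.2.1 * T ^ 2 + α.2.2.2.1 * T ^ 3 + α.2.2.2.2 * T ^ 4) • ((0 : ℝ), (1 : ℝ)) := by
      simp
    rw [h9, map_add, map_smul, map_smul, smul_eq_mul, smul_eq_mul] at h8
    rw [h8]
    simp only [zero_smul, add_zero, realQuintic, Prod.fst_zero, Prod.snd_zero]
    ring
  · filter_upwards [h3] with s hs
    simp only [Prod.smul_mk, Prod.mk_add_mk, zero_add, add_zero, smul_eq_mul,
      mul_zero, Pi.add_apply, Pi.mul_apply] at hs ⊢
    rw [← hs]
    congr 1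
    simp only [quarticShift, Prod.fst_add, Prod.snd_add, Prod.smul_fst, Prod.smul_snd, smul_eq_mul,
      Prod.mk.injEq]
    constructor <;> ring

theorem ButterflyJet.fderiv_remainder (hk : ButterflyJet k c e g ε)
    (hd : QuinticDivision k Q R (0, 0, β)) (α : ℝ × ℝ × R3) (v : R3) :
    fderiv ℝ (R 0) ((0, 0, β), 0) (α, v) = -(quotientJet c β 0 * v.2.2) ∧
    fderiv ℝ (R 1) ((0, 0, β), 0) (α, v) =
      -(quotientJet c β 0 * v.2.1 + quotientJet c β 1 * v.2.2) ∧
    fderiv ℝ (R 2) ((0, 0, β), 0) (α, v) = e * α.1 -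
      (quotientJet c β 0 * v.1 + quotientJet c β 1 * v.2.1 + quotientJet c β 2 * v.2.2) ∧
    fderiv ℝ (R 3) ((0, 0, β), 0) (α, v) = 2 * β.1 * e * α.1 -
      (quotientJet c β 1 * v.1 + quotientJet c β 2 * v.2.1 + quotientJet c β 3 * v.2.2) ∧
    (α.1 = 0 → v = 0 → fderiv ℝ (R 4) ((0, 0, β), 0) (α, v) = 5 * c 0 * α.2.1) := by
  obtain ⟨-, h, hh, hQ⟩ := hk.quotient_jet hd
  obtain ⟨h', hh', hkm⟩ := hk.exists_fderiv_eq
  have hε := hk.continuous_ε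
  have hS : ∀ T, quarticShift T (0, 0, β) =
      T * (1 + β.1 * T + β.2.1 * T ^ 2 + β.2.2 * T ^ 3) := fun T => by
    simp only [quarticShift]
    ring
  have hdQ : Continuous fun T : ℝ => fderiv ℝ Q (T, ((0 : ℝ), (0 : ℝ), β), (0 : R3)) (0, α, v) := by
    have h1 : Continuous fun T : ℝ => fderiv ℝ Q (T, ((0 : ℝ), (0 : ℝ), β), (0 : R3)) :=
      (hd.smooth_Q.continuous_fderiv (by simp)).comp (by fun_prop)
    exact h1.clm_apply continuous_const
  generalize hr : (fun j => fderiv ℝ (R j) ((0, 0, β), 0) (α, v)) = r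
  have hr' : ∀ j, fderiv ℝ (R j) ((0, 0, β), 0) (α, v) = r j := fun j => congrFun hr j
  have h0 := hd.fderiv_eq hk.smooth α v
  simp only [hr'] at h0 ⊢
  generalize quotientJet c β 0 = q0 at hQ ⊢
  generalize quotientJet c β 1 = q1 at hQ ⊢
  generalize quotientJet c β 2 = q2 at hQ ⊢
  generalize quotientJet c β 3 = q3 at hQ ⊢
  obtain ⟨y, hy, hyd⟩ : ∃ y : ℝ → ℝ, Continuous y ∧ ∀ T, y T = β.2.1 + T * β.2.2 :=
    ⟨_, by fun_prop, fun _ => rfl⟩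
  obtain ⟨z, hz, hzd⟩ : ∃ z : ℝ → ℝ, Continuous z ∧ ∀ T, z T = β.1 + T * y T :=
    ⟨_, by fun_prop, fun _ => rfl⟩
  obtain ⟨S, hSc, hSd⟩ : ∃ S : ℝ → ℝ, Continuous S ∧ ∀ T, S T = 1 + T * z T :=
    ⟨_, by fun_prop, fun _ => rfl⟩
  obtain ⟨N, hN, hNd⟩ : ∃ N : ℝ → ℝ, Continuous N ∧
      ∀ T, N T = α.2.2.1 * T + α.2.2.2.1 * T ^ 2 + α.2.2.2.2 * T ^ 3 :=
    ⟨_, by fun_prop, fun _ => rfl⟩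
  have hS' : ∀ T, quarticShift T (0, 0, β) = T * S T := fun T => by
    rw [hS]
    simp only [hSd, hzd, hyd]
    ring
  obtain ⟨D, hD, hDd⟩ : ∃ D : ℝ → ℝ, Continuous D ∧
      ∀ T, fderiv ℝ Q (T, (0, 0, β), 0) (0, α, v) = D T := ⟨_, hdQ, fun _ => rfl⟩
  simp only [hDd] at h0
  have h1 : ∀ᶠ T in 𝓝 (0 : ℝ), α.1 * ((T * S T) ^ 2 * (e + (T * S T) ^ 2 * ε (T * S T))) +
      (α.2.1 + T * N T) * ((T * S T) ^ 4 * (5 * c 0 + (T * S T) * h' (T * S T))) =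
      D T * T ^ 5 +
        (q0 + q1 * T + q2 * T ^ 2 + q3 * T ^ 3 + T ^ 4 * h T) *
          (v.1 * T ^ 2 + v.2.1 * T + v.2.2) +
        (r 0 + r 1 * T + r 2 * T ^ 2 + r 3 * T ^ 3 + r 4 * T ^ 4) := by
    filter_upwards [h0, hQ, (tendsto_quarticShift β).eventually hkm,
      (tendsto_quarticShift β).eventually hk.fderiv_eq] with T h0 h2 h3 h4
    rw [h2, h3, h4, hS'] at h0
    simp only [Finset.sum_range_succ, Finset.sum_range_zero] at h0
    simp only [hNd]
    linear_combination h0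
  have h2 := eq_zero_of_sum_eq_pow_mul (n := 4) (r := fun j => if j = 0 then r 0 + q0 * v.2.2 else
      if j = 1 then r 1 + (q0 * v.2.1 + q1 * v.2.2) else
      if j = 2 then r 2 + (q0 * v.1 + q1 * v.2.1 + q2 * v.2.2) - e * α.1 else
      r 3 + (q1 * v.1 + q2 * v.2.1 + q3 * v.2.2) - 2 * β.1 * e * α.1)
    (g := fun T => α.1 * (e * (z T ^ 2 + 2 * y T) + S T ^ 4 * ε (T * S T)) +
      (α.2.1 + T * N T) * (S T ^ 4 * (5 * c 0 + (T * S T) * h' (T * S T))) -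
      D T * T - r 4 -
      h T * (v.1 * T ^ 2 + v.2.1 * T + v.2.2) - (q2 * v.1 + q3 * v.2.1) - T * q3 * v.1)
    (Continuous.continuousAt (by fun_prop)) (by
      filter_upwards [h1] with T hT
      have h3 : T ^ 2 * S T ^ 2 = T ^ 2 + 2 * β.1 * T ^ 3 + T ^ 4 * (z T ^ 2 + 2 * y T) := by
        simp only [hSd, hzd]
        ring
      simp only [Finset.sum_range_succ, Finset.sum_range_zero]
      norm_num
      linear_combination -hT + α.1 * e * h3)
  refine ⟨?_, ?_, ?_, ?_, ?_⟩
  · simpa [add_eq_zero_iff_eq_neg] using h2 0 (by norm_num)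
  · simpa [add_eq_zero_iff_eq_neg] using h2 1 (by norm_num)
  · have := h2 2 (by norm_num)
    norm_num at this
    linarith
  · have := h2 3 (by norm_num)
    norm_num at this
    linarith
  · intro hα hv
    have h3 := eq_zero_of_sum_eq_pow_mul (n := 5)
      (r := fun j => if j = 4 then r 4 - 5 * c 0 * α.2.1 else r j)
      (g := fun T => N T * (S T ^ 4 * (5 * c 0 + (T * S T) * h' (T * S T))) + α.2.1 *
        (z T * (4 + 6 * (T * z T) + 4 * (T * z T) ^ 2 + (T * z T) ^ 3) * (5 * c 0) +
          S T ^ 5 * h' (T * S T)) - D T)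
      (Continuous.continuousAt (by fun_prop)) (by
        filter_upwards [h1] with T hT
        have h4 : S T ^ 4 = 1 + T * (z T * (4 + 6 * (T * z T) + 4 * (T * z T) ^ 2 +
            (T * z T) ^ 3)) := by
          simp only [hSd]
          ring
        rw [hα] at hT
        simp only [hv, Prod.fst_zero, Prod.snd_zero] at hT ⊢
        simp only [Finset.sum_range_succ, Finset.sum_range_zero]
        norm_num
        linear_combination -hT + 5 * c 0 * α.2.1 * T ^ 4 * h4) 4 (by norm_num)
    norm_num at h3
    linarith

end NormalForm

section NormalForm

theorem exists_eq_add_apply_of_contDiff {E G : Type} [NormedAddCommGroup E] [NormedSpace ℝ E]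
    [FiniteDimensional ℝ E] [NormedAddCommGroup G] [NormedSpace ℝ G] [FiniteDimensional ℝ G]
    {f : E × G → ℝ} (hf : ContDiff ℝ ∞ f) :
    ∃ L : E × G → (E →L[ℝ] ℝ), ContDiff ℝ ∞ L ∧ (∀ x y, f (x, y) = f (0, y) + L (x, y) x) ∧
      ∀ y v, L (0, y) v = fderiv ℝ f (0, y) (v, 0) := by
  have hd : ContDiff ℝ ∞ (fderiv ℝ f) := hf.fderiv_right (by simp)
  have hs : ContDiff ℝ ∞ fun q : ℝ × (E × G) =>
      (fderiv ℝ f (q.1 • q.2.1, q.2.2)).comp (ContinuousLinearMap.inl ℝ E G) := by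
    have h1 : ContDiff ℝ ∞ fun q : ℝ × (E × G) => (q.1 • q.2.1, q.2.2) := by fun_prop
    exact (hd.comp h1).clm_comp contDiff_const
  have hL := contDiff_intervalIntegral (E := E × G) (F := E →L[ℝ] ℝ) (h := fun r q =>
      (fderiv ℝ f (r • q.1, q.2)).comp (ContinuousLinearMap.inl ℝ E G)) hs
  have hi : ∀ x y, IntervalIntegrable (fun r : ℝ =>
      (fderiv ℝ f (r • x, y)).comp (ContinuousLinearMap.inl ℝ E G)) volume 0 1 := by
    intro x y
    have h1 : Continuous fun r : ℝ => (r, (x, y)) := by fun_prop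
    have h2 := hs.continuous.comp h1
    exact Continuous.intervalIntegrable h2 _ _
  refine ⟨_, hL, fun x y => ?_, fun y v => ?_⟩
  · rw [ContinuousLinearMap.intervalIntegral_apply (hi x y)]
    have h1 : ∀ r : ℝ, HasDerivAt (fun r : ℝ => f (r • x, y))
        ((fderiv ℝ f (r • x, y)).comp (ContinuousLinearMap.inl ℝ E G) x) r := by
      intro r
      have h2 : HasDerivAt (fun r : ℝ => (r • x, y)) (x, 0) r := by
        have := ((hasDerivAt_id r).smul_const x).prodMk (hasDerivAt_const r y)
        simpa using this
      exact (hf.differentiable (by simp)).differentiableAt.hasFDerivAt.comp_hasDerivAt r h2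
    have h3 := intervalIntegral.integral_eq_sub_of_hasDerivAt (a := 0) (b := 1)
      (fun r _ => h1 r) (by
        have := (hi x y)
        refine Continuous.intervalIntegrable ?_ _ _
        have h1 : Continuous fun r : ℝ => (r, (x, y)) := by fun_prop
        exact (hs.continuous.comp h1).clm_apply continuous_const)
    rw [h3]
    simp
  · rw [ContinuousLinearMap.intervalIntegral_apply (hi 0 y)]
    simp

/-- The obstruction to unfolding with quartic coefficients `β`. -/
def unfoldingObstruction (c : ℕ → ℝ) (β : R3) : R3 :=
  (2 * β.1 * quotientJet c β 0 - quotientJet c β 1,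
    2 * β.1 * (quotientJet c β 1 - β.1 * quotientJet c β 0) - quotientJet c β 2 +
      β.2.1 * quotientJet c β 0,
    2 * β.1 * (quotientJet c β 2 - β.1 * quotientJet c β 1) - quotientJet c β 3 +
      β.2.1 * quotientJet c β 1)

theorem contDiff_unfoldingObstruction (c : ℕ → ℝ) : ContDiff ℝ ∞ (unfoldingObstruction c) := by
  unfold unfoldingObstruction quotientJet
  fun_prop

theorem exists_unfoldingObstruction_eq_zero {c : ℕ → ℝ} (hc : c 0 ≠ 0) :
    ∃ β, unfoldingObstruction c β = 0 := by
  obtain ⟨b, hb⟩ : ∃ b, b = -c 1 / (3 * c 0) := ⟨_, rfl⟩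
  obtain ⟨c', hc'⟩ : ∃ c', c' = (-2 * b ^ 2 * c 0 - 4 * b * c 1 - c 2) / (4 * c 0) := ⟨_, rfl⟩
  have hb' : 3 * c 0 * b = -c 1 := by rw [hb]; field_simp
  have hcc : 4 * c 0 * c' = -2 * b ^ 2 * c 0 - 4 * b * c 1 - c 2 := by rw [hc']; field_simp
  obtain ⟨d, hd⟩ : ∃ d, d = (2 * b * (quotientJet c (b, c', 0) 2 - b * quotientJet c (b, c', 0) 1) -
    quotientJet c (b, c', 0) 3 + c' * quotientJet c (b, c', 0) 1) / (5 * c 0) := ⟨_, rfl⟩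
  rw [eq_div_iff (by simpa using hc)] at hd
  refine ⟨(b, c', d), ?_⟩
  simp only [unfoldingObstruction, quotientJet, Prod.mk_eq_zero] at hd ⊢
  refine ⟨?_, ?_, ?_⟩
  · linear_combination -hb'
  · linear_combination -hcc
  · linear_combination -hd

theorem fderiv_unfoldingObstruction_eq_zero {c : ℕ → ℝ} (hc : c 0 ≠ 0) {β b : R3}
    (h : fderiv ℝ (unfoldingObstruction c) β b = 0) : b = 0 := by
  have h0 := hasDerivAt_comp_line (contDiff_unfoldingObstruction c) β b
  rw [h] at h0
  have aff : ∀ (f : ℝ → ℝ) (m n : ℝ), HasDerivAt f 0 0 → (∀ s, f s = m + s * (n * c 0)) →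
      n = 0 ∨ c 0 = 0 := by
    intro f m n hf hfm
    have h1 : HasDerivAt (fun s : ℝ => m + s * (n * c 0)) (n * c 0) 0 := by
      simpa using ((hasDerivAt_id (0 : ℝ)).mul_const (n * c 0)).const_add m
    rw [funext hfm] at hf
    exact mul_eq_zero.1 (h1.unique hf)
  obtain ⟨b1, b2, b3⟩ := b
  have e1 : b1 = 0 := by
    have := aff _ (-3 * c 0 * β.1 - c 1) (-3 * b1) h0.fst (fun s => by
      simp [unfoldingObstruction, quotientJet]; ring)
    simpa [hc] using this
  subst e1
  have e2 : b2 = 0 := by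
    have := aff _ (unfoldingObstruction c β).2.1 (-4 * b2) h0.snd.fst (fun s => by
      simp [unfoldingObstruction, quotientJet]; ring)
    simpa [hc] using this
  subst e2
  have e3 : b3 = 0 := by
    have := aff _ (unfoldingObstruction c β).2.2 (-5 * b3) h0.snd.snd (fun s => by
      simp [unfoldingObstruction, quotientJet]; ring)
    simpa [hc] using this
  subst e3
  rfl

end NormalForm

section NormalForm

variable {k : R2 → ℝ} {c : ℕ → ℝ} {e : ℝ} {g ε : ℝ → ℝ} {Q : ℝ × (ℝ × ℝ × R3) × R3 → ℝ}
  {R : ℕ → (ℝ × ℝ × R3) × R3 → ℝ} {β : R3}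

theorem hasDerivAt_fst_comp {E F : Type*} [NormedAddCommGroup E] [NormedSpace ℝ E]
    [NormedAddCommGroup F] [NormedSpace ℝ F] {f : ℝ → E × F} {f' : E × F} {t : ℝ}
    (h : HasDerivAt f f' t) : HasDerivAt (fun s => (f s).1) f'.1 t :=
  (hasFDerivAt_fst (𝕜 := ℝ) (p := f t)).comp_hasDerivAt t h

theorem hasDerivAt_snd_comp {E F : Type*} [NormedAddCommGroup E] [NormedSpace ℝ E]
    [NormedAddCommGroup F] [NormedSpace ℝ F] {f : ℝ → E × F} {f' : E × F} {t : ℝ}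
    (h : HasDerivAt f f' t) : HasDerivAt (fun s => (f s).2) f'.2 t :=
  (hasFDerivAt_snd (𝕜 := ℝ) (p := f t)).comp_hasDerivAt t h

theorem QuinticDivision.eventually {β₀ : R3} (hd : QuinticDivision k Q R (0, 0, β₀)) :
    ∀ᶠ β in 𝓝 β₀, QuinticDivision k Q R (0, 0, β) := by
  have h1 : Tendsto (fun β : R3 => ((0 : ℝ), ((0 : ℝ), (0 : ℝ), β), (0 : R3))) (𝓝 β₀)
      (𝓝 (0, (0, 0, β₀), 0)) := by
    have : Continuous fun β : R3 => ((0 : ℝ), ((0 : ℝ), (0 : ℝ), β), (0 : R3)) := by fun_prop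
    exact this.tendsto β₀
  filter_upwards [h1.eventually hd.eq.eventually_nhds] with β hβ
  exact ⟨hd.smooth_Q, hd.smooth_R, hβ⟩

/-- The first two unfolding parameters, solving two of the remainder equations. -/
theorem ButterflyJet.exists_solve_even (hk : ButterflyJet k c e g ε) {β₀ : R3}
    (hd : QuinticDivision k Q R (0, 0, β₀)) :
    ∃ φ : R3 × R3 → ℝ × ℝ, ContDiff ℝ ∞ φ ∧ (∀ᶠ β in 𝓝 β₀, φ (0, β) = 0) ∧
      ∀ᶠ q in 𝓝 ((0 : R3), β₀),
        R 2 (((φ q).1, (φ q).2, q.2), q.1) = q.2.1 * R 1 (((φ q).1, (φ q).2, q.2), q.1) ∧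
        R 4 (((φ q).1, (φ q).2, q.2), q.1) = q.2.2.2 * R 1 (((φ q).1, (φ q).2, q.2), q.1) := by
  have hR : ∀ j, ContDiff ℝ ∞ fun q : (R3 × R3) × (ℝ × ℝ) =>
      R j ((q.2.1, q.2.2, q.1.2), q.1.1) := fun j => by
    have h1 : ContDiff ℝ ∞ fun q : (R3 × R3) × (ℝ × ℝ) =>
      (((q.2.1, q.2.2, q.1.2), q.1.1) : (ℝ × ℝ × R3) × R3) := by fun_prop
    have h2 := (hd.smooth_R j).comp h1
    exact h2
  obtain ⟨F, hF, hFd⟩ : ∃ F : (R3 × R3) × (ℝ × ℝ) → ℝ × ℝ, ContDiff ℝ ∞ F ∧ ∀ q, F q =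
      (R 2 ((q.2.1, q.2.2, q.1.2), q.1.1) - q.1.2.1 * R 1 ((q.2.1, q.2.2, q.1.2), q.1.1),
        R 4 ((q.2.1, q.2.2, q.1.2), q.1.1) - q.1.2.2.2 * R 1 ((q.2.1, q.2.2, q.1.2), q.1.1)) := by
    refine ⟨_, ?_, fun _ => rfl⟩
    exact ((hR 2).sub ((by fun_prop : ContDiff ℝ ∞ fun q : (R3 × R3) × (ℝ × ℝ) => q.1.2.1).mul
      (hR 1))).prodMk ((hR 4).sub
        ((by fun_prop : ContDiff ℝ ∞ fun q : (R3 × R3) × (ℝ × ℝ) => q.1.2.2.2).mul (hR 1)))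
  have hF0 : ∀ᶠ β in 𝓝 β₀, F ((0, β), (0, 0)) = 0 := by
    filter_upwards [hd.eventually] with β hβ
    have h1 := (hk.quotient_jet hβ).1
    rw [hFd]
    simp [h1]
  obtain ⟨φ, hφ, hφ0, hφF, hφu⟩ := exists_implicit_function (x₀ := ((0 : R3), β₀))
    (y₀ := ((0 : ℝ), (0 : ℝ))) hF hF0.self_of_nhds (by
      rintro ⟨x, s⟩ h
      have h1 := hasDerivAt_comp_line hF (((0 : R3), β₀), ((0 : ℝ), (0 : ℝ))) (0, (x, s))
      rw [h] at h1
      have h2 : ∀ j, HasDerivAt (fun t : ℝ => R j ((t * x, t * s, β₀), 0))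
          (fderiv ℝ (R j) ((0, 0, β₀), 0) ((x, s, 0), 0)) 0 := fun j => by
        simpa using hasDerivAt_comp_line (hd.smooth_R j) (((0 : ℝ), (0 : ℝ), β₀), (0 : R3))
          ((x, s, 0), 0)
      simp only [hFd] at h1
      have h3 := hasDerivAt_fst_comp h1
      have h4 := hasDerivAt_snd_comp h1
      simp only [Prod.smul_mk, Prod.mk_add_mk, zero_add, add_zero, smul_eq_mul, smul_zero,
        Prod.fst_zero, Prod.snd_zero] at h3 h4
      have h5 := h3.unique ((h2 2).sub ((h2 1).const_mul _))
      have h6 := h4.unique ((h2 4).sub ((h2 1).const_mul _))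
      obtain ⟨-, g1, g2, -, g4⟩ := hk.fderiv_remainder hd (x, s, 0) 0
      rw [g1, g2] at h5
      have hx : x = 0 := by
        have h7 : e * x = 0 := by simpa [eq_comm] using h5
        exact (mul_eq_zero.1 h7).resolve_left hk.e_ne
      rw [g1, g4 hx rfl] at h6
      have hs : s = 0 := by simpa [hk.c_ne, eq_comm] using h6
      rw [hx, hs]
      rfl)
  refine ⟨φ, hφ, ?_, ?_⟩
  · have h1 : Tendsto (fun β : R3 => (((0 : R3), β), ((0 : ℝ), (0 : ℝ)))) (𝓝 β₀)
        (𝓝 ((0, β₀), (0, 0))) := by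
      have : Continuous fun β : R3 => (((0 : R3), β), ((0 : ℝ), (0 : ℝ))) := by fun_prop
      exact this.tendsto β₀
    filter_upwards [h1.eventually hφu, hF0] with β h2 h3
    exact (h2 h3).symm
  · filter_upwards [hφF] with q hq
    rw [hFd, Prod.mk_eq_zero, sub_eq_zero, sub_eq_zero] at hq
    exact hq

/-- The unfolding parameters as functions of the coefficients of the quintic. -/
theorem ButterflyJet.exists_unfolding (hk : ButterflyJet k c e g ε) {β₀ : R3}
    (hβ₀ : unfoldingObstruction c β₀ = 0) (hd : QuinticDivision k Q R (0, 0, β₀)) :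
    ∃ a : R3 → ℝ × ℝ × R3, ContDiff ℝ ∞ a ∧ a 0 = (0, 0, β₀) ∧ ∀ᶠ ξ in 𝓝 (0 : R3),
      R 2 (a ξ, ξ) = (a ξ).2.2.1 * R 1 (a ξ, ξ) ∧ R 3 (a ξ, ξ) = (a ξ).2.2.2.1 * R 1 (a ξ, ξ) ∧
      R 4 (a ξ, ξ) = (a ξ).2.2.2.2 * R 1 (a ξ, ξ) := by
  obtain ⟨φ, hφ, hφ0, hφR⟩ := hk.exists_solve_even hd
  have hA : ContDiff ℝ ∞ fun q : R3 × R3 =>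
      ((((φ q).1, (φ q).2, q.2), q.1) : (ℝ × ℝ × R3) × R3) := by fun_prop
  have hR : ∀ j, ContDiff ℝ ∞ fun q : R3 × R3 => R j (((φ q).1, (φ q).2, q.2), q.1) := fun j =>
    have h2 := (hd.smooth_R j).comp hA
    h2
  obtain ⟨E, hE, hEd⟩ : ∃ E : R3 × R3 → ℝ, ContDiff ℝ ∞ E ∧ ∀ q, E q =
      R 3 (((φ q).1, (φ q).2, q.2), q.1) - q.2.2.1 * R 1 (((φ q).1, (φ q).2, q.2), q.1) := by
    refine ⟨_, ?_, fun _ => rfl⟩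
    exact (hR 3).sub ((by fun_prop : ContDiff ℝ ∞ fun q : R3 × R3 => q.2.2.1).mul (hR 1))
  obtain ⟨L, hL, hLE, hLd⟩ := exists_eq_add_apply_of_contDiff hE
  obtain ⟨F, hF, hFd⟩ : ∃ F : R3 × R3 → R3, ContDiff ℝ ∞ F ∧ ∀ q, F q =
      (e : ℝ) • (L q (1, 0, 0), L q (0, 1, 0), L q (0, 0, 1)) :=
    ⟨_, by fun_prop, fun _ => rfl⟩
  have hE0 : ∀ᶠ β in 𝓝 β₀, E (0, β) = 0 := by
    filter_upwards [hd.eventually, hφ0] with β hβ h0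
    have h1 := (hk.quotient_jet hβ).1
    rw [hEd]
    simp [h1, h0]
  have hF0 : ∀ᶠ β in 𝓝 β₀, F (0, β) = e • unfoldingObstruction c β := by
    have h1 : Tendsto (fun β : R3 => ((0 : R3), β)) (𝓝 β₀) (𝓝 (0, β₀)) := by
      have : Continuous fun β : R3 => ((0 : R3), β) := by fun_prop
      exact this.tendsto β₀
    filter_upwards [hd.eventually, hφ0, h1.eventually hφR.eventually_nhds] with β hβ h0 h2
    have h3 : ∀ v : R3, L (0, β) v = (2 * β.1 * (quotientJet c β 0 * v.1 + quotientJet c β 1 * v.2.1 + quotientJet c β 2 * v.2.2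
        - β.1 * (quotientJet c β 0 * v.2.1 + quotientJet c β 1 * v.2.2)) -
        (quotientJet c β 1 * v.1 + quotientJet c β 2 * v.2.1 + quotientJet c β 3 * v.2.2) +
        β.2.1 * (quotientJet c β 0 * v.2.1 + quotientJet c β 1 * v.2.2)) := by
      intro v
      rw [hLd]
      have h4 := hasDerivAt_comp_line hE (0, β) (v, 0)
      have h5 := hasDerivAt_comp_line hφ (0, β) (v, 0)
      simp only [Prod.smul_mk, Prod.mk_add_mk, zero_add, add_zero, smul_zero] at h4 h5
      generalize fderiv ℝ φ (0, β) (v, 0) = φ' at h5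
      have h6 : HasDerivAt (fun s : ℝ => ((((φ (s • v, β)).1, (φ (s • v, β)).2, β), s • v) :
          (ℝ × ℝ × R3) × R3)) ((φ'.1, φ'.2, 0), v) 0 :=
        HasDerivAt.prodMk (HasDerivAt.prodMk (hasDerivAt_fst_comp h5)
          (HasDerivAt.prodMk (hasDerivAt_snd_comp h5) (hasDerivAt_const _ _)))
          (by simpa using (hasDerivAt_id (0 : ℝ)).smul_const v)
      have h7 : ∀ j, HasDerivAt (fun s : ℝ => R j (((φ (s • v, β)).1, (φ (s • v, β)).2, β), s • v))
          (fderiv ℝ (R j) ((0, 0, β), 0) ((φ'.1, φ'.2, 0), v)) 0 := by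
        intro j
        have h8 : HasFDerivAt (R j) (fderiv ℝ (R j) ((0, 0, β), 0))
            (((φ ((0 : ℝ) • v, β)).1, (φ ((0 : ℝ) • v, β)).2, β), (0 : ℝ) • v) := by
          rw [zero_smul, h0]
          exact ((hd.smooth_R j).differentiable (by simp)).differentiableAt.hasFDerivAt
        exact h8.comp_hasDerivAt (0 : ℝ) h6
      have h9 : Tendsto (fun s : ℝ => (s • v, β)) (𝓝 0) (𝓝 (0, β)) := by
        have : Continuous fun s : ℝ => (s • v, β) := by fun_prop
        simpa using this.tendsto 0
      have h10 : HasDerivAt (fun s : ℝ => R 2 (((φ (s • v, β)).1, (φ (s • v, β)).2, β), s • v))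
          (β.1 * fderiv ℝ (R 1) ((0, 0, β), 0) ((φ'.1, φ'.2, 0), v)) 0 := by
        refine ((h7 1).const_mul β.1).congr_of_eventuallyEq ?_
        filter_upwards [h9.eventually h2] with s hs
        exact hs.1
      have h11 := (h7 2).unique h10
      simp only [hEd] at h4
      have h12 := h4.unique ((h7 3).sub ((h7 1).const_mul β.2.1))
      obtain ⟨-, g1, g2, g3, -⟩ := hk.fderiv_remainder hβ (φ'.1, φ'.2, 0) v
      rw [g1, g2] at h11
      rw [g1, g3] at h12
      simp only at h11 h12
      rw [h12]
      linear_combination 2 * β.1 * h11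
    rw [hFd]
    simp only [h3, unfoldingObstruction]
    congr 1
    ext <;> simp
  obtain ⟨b, hb, hb0, hbF, -⟩ := exists_implicit_function (x₀ := (0 : R3)) (y₀ := β₀) hF
    (by rw [hF0.self_of_nhds, hβ₀, smul_zero]) (by
      intro v hv
      refine fderiv_unfoldingObstruction_eq_zero hk.c_ne (β := β₀) ?_
      have h1 := hasDerivAt_comp_line hF (0, β₀) (0, v)
      have h2 := (hasDerivAt_comp_line (contDiff_unfoldingObstruction c) β₀ v).const_smul e
      rw [hv] at h1
      have h3 : Tendsto (fun s : ℝ => β₀ + s • v) (𝓝 0) (𝓝 β₀) := by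
        have : Continuous fun s : ℝ => β₀ + s • v := by fun_prop
        simpa using this.tendsto 0
      have h4 := h1.unique (h2.congr_of_eventuallyEq (by
        filter_upwards [h3.eventually hF0] with s hs
        simpa using hs))
      exact (smul_eq_zero.1 h4.symm).resolve_left hk.e_ne)
  refine ⟨fun ξ => ((φ (ξ, b ξ)).1, (φ (ξ, b ξ)).2, b ξ), by fun_prop, ?_, ?_⟩
  · simp [hb0, hφ0.self_of_nhds]
  · have h1 : Tendsto (fun ξ : R3 => (ξ, b ξ)) (𝓝 0) (𝓝 (0, β₀)) := by
      have : Continuous fun ξ : R3 => (ξ, b ξ) := by fun_prop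
      simpa [hb0] using this.tendsto 0
    have h2 : Tendsto b (𝓝 0) (𝓝 β₀) := by
      simpa [hb0] using hb.continuous.tendsto 0
    filter_upwards [h1.eventually hφR, h2.eventually hE0, hbF] with ξ h3 h4 h5
    refine ⟨h3.1, ?_, h3.2⟩
    rw [hFd, smul_eq_zero, or_iff_right hk.e_ne, Prod.mk_eq_zero, Prod.mk_eq_zero] at h5
    have h6 := hLE ξ (b ξ)
    have h7 : ξ = ξ.1 • ((1 : ℝ), (0 : ℝ), (0 : ℝ)) + ξ.2.1 • ((0 : ℝ), (1 : ℝ), (0 : ℝ)) +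
        ξ.2.2 • ((0 : ℝ), (0 : ℝ), (1 : ℝ)) := by
      ext <;> simp
    have h8 : L (ξ, b ξ) ξ = 0 := by
      generalize L (ξ, b ξ) = ℓ at h5
      rw [h7, map_add, map_add, map_smul, map_smul, map_smul, h5.1, h5.2.1, h5.2.2]
      simp
    rw [h4, h8, hEd] at h6
    simp only at h6
    linarith

end NormalForm

section NormalForm

variable {k : R2 → ℝ} {c : ℕ → ℝ} {e : ℝ} {g ε : ℝ → ℝ}

/-- The coordinate change `ψ` and the substitution `S` turn the family `Z - Y * m - k (X, m)` into
a multiple of the unfolded quintic. -/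
structure QuinticNormalForm (k : R2 → ℝ) (ψ : R3 → R3) (S Q : ℝ × R3 → ℝ) (κ : ℝ) : Prop where
  smooth_ψ : ContDiff ℝ ∞ ψ
  smooth_S : ContDiff ℝ ∞ S
  smooth_Q : ContDiff ℝ ∞ Q
  ψ_zero : ψ 0 = 0
  injective : Function.Injective (fderiv ℝ ψ 0)
  fderiv_ψ : fderiv ℝ ψ 0 (1, 0, 0) = (κ, 0, 0)
  κ_ne : κ ≠ 0
  S_zero : S 0 = 0
  fderiv_S : fderiv ℝ S 0 (1, 0) = 1
  Q_ne : Q 0 ≠ 0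
  eq : ∀ᶠ q in 𝓝 (0 : ℝ × R3),
    (ψ q.2).2.2 - (ψ q.2).2.1 * S q - k ((ψ q.2).1, S q) = -(Q q * realQuintic q.2 q.1)

theorem ButterflyJet.exists_normalForm (hk : ButterflyJet k c e g ε) :
    ∃ ψ S Q κ, QuinticNormalForm k ψ S Q κ := by
  obtain ⟨β, hβ⟩ := exists_unfoldingObstruction_eq_zero hk.c_ne
  obtain ⟨Q, R, hQ, hR, hQR⟩ := exists_eventually_eq_mul_realQuintic_add
    (K := fun q : ℝ × (ℝ × ℝ × R3) => k (q.2.1, quarticShift q.1 q.2)) (by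
      have h1 : ContDiff ℝ ∞ fun q : ℝ × (ℝ × ℝ × R3) => (q.2.1, quarticShift q.1 q.2) :=
        (by fun_prop : ContDiff ℝ ∞ fun q : ℝ × (ℝ × ℝ × R3) => q.2.1).prodMk contDiff_quarticShift
      have h2 := hk.smooth.comp h1
      exact h2) ((0 : ℝ), (0 : ℝ), β)
  have hd : QuinticDivision k Q R (0, 0, β) := ⟨hQ, hR, hQR⟩
  obtain ⟨a, ha, ha0, haR⟩ := hk.exists_unfolding hβ hd
  obtain ⟨hR0, h, -, hQ0⟩ := hk.quotient_jet hd
  have hA : ContDiff ℝ ∞ fun ξ : R3 => ((a ξ, ξ) : (ℝ × ℝ × R3) × R3) := by fun_prop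
  have hRa : ∀ j, ContDiff ℝ ∞ fun ξ => R j (a ξ, ξ) := fun j => by
    have h2 := (hR j).comp hA
    exact h2
  obtain ⟨ψ, hψ, hψd⟩ : ∃ ψ : R3 → R3, ContDiff ℝ ∞ ψ ∧ ∀ ξ, ψ ξ =
      ((a ξ).1, -R 1 (a ξ, ξ), R 0 (a ξ, ξ) - R 1 (a ξ, ξ) * (a ξ).2.1) := by
    refine ⟨_, ?_, fun _ => rfl⟩
    exact ha.fst.prodMk ((hRa 1).neg.prodMk ((hRa 0).sub ((hRa 1).mul ha.snd.fst)))
  obtain ⟨S, hS, hSd⟩ : ∃ S : ℝ × R3 → ℝ, ContDiff ℝ ∞ S ∧ ∀ q, S q = quarticShift q.1 (a q.2) := by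
    refine ⟨_, ?_, fun _ => rfl⟩
    have h1 : ContDiff ℝ ∞ fun q : ℝ × R3 => (q.1, a q.2) := by fun_prop
    have h2 := contDiff_quarticShift.comp h1
    exact h2
  have hB : ContDiff ℝ ∞ fun q : ℝ × R3 => (q.1, a q.2, q.2) := by fun_prop
  have hQa : ContDiff ℝ ∞ fun q : ℝ × R3 => Q (q.1, a q.2, q.2) := by
    have h1 := hQ.comp hB
    exact h1
  have hψ' : ∀ v : R3, ∃ x : ℝ, e * x = quotientJet c β 0 * v.1 + (quotientJet c β 1 * v.2.1 +
      quotientJet c β 2 * v.2.2) - β.1 * (quotientJet c β 0 * v.2.1 + quotientJet c β 1 * v.2.2) ∧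
      fderiv ℝ ψ 0 v = (x, quotientJet c β 0 * v.2.1 + quotientJet c β 1 * v.2.2,
        -(quotientJet c β 0 * v.2.2)) := by
    intro v
    have h1 := hasDerivAt_comp_line ha 0 v
    have h4 := hasDerivAt_comp_line hψ 0 v
    simp only [zero_add] at h1 h4
    generalize fderiv ℝ a 0 v = α at h1
    have h2 : HasDerivAt (fun s : ℝ => ((a (s • v), s • v) : (ℝ × ℝ × R3) × R3)) (α, v) 0 :=
      HasDerivAt.prodMk h1 (by simpa using (hasDerivAt_id (0 : ℝ)).smul_const v)
    have h3 : ∀ j, HasDerivAt (fun s : ℝ => R j (a (s • v), s • v))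
        (fderiv ℝ (R j) ((0, 0, β), 0) (α, v)) 0 := by
      intro j
      have h8 : HasFDerivAt (R j) (fderiv ℝ (R j) ((0, 0, β), 0))
          (a ((0 : ℝ) • v), (0 : ℝ) • v) := by
        rw [zero_smul, ha0]
        exact ((hR j).differentiable (by simp)).differentiableAt.hasFDerivAt
      exact h8.comp_hasDerivAt (0 : ℝ) h2
    obtain ⟨g0, g1, g2, -, -⟩ := hk.fderiv_remainder hd α v
    have h5 : Tendsto (fun s : ℝ => s • v) (𝓝 0) (𝓝 0) := by
      have : Continuous fun s : ℝ => s • v := by fun_prop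
      simpa using this.tendsto 0
    have h6 := (h3 2).unique (((hasDerivAt_fst_comp (hasDerivAt_snd_comp
      (hasDerivAt_snd_comp h1))).mul (h3 1)).congr_of_eventuallyEq (by
        filter_upwards [h5.eventually haR] with s hs
        exact hs.1))
    simp only [hψd] at h4
    have h7 := h4.unique (HasDerivAt.prodMk (hasDerivAt_fst_comp h1) (HasDerivAt.prodMk (h3 1).neg
      ((h3 0).sub ((h3 1).mul (hasDerivAt_fst_comp (hasDerivAt_snd_comp h1))))))
    refine ⟨α.1, ?_, ?_⟩
    · rw [zero_smul, ha0, hR0 1 (by norm_num), g1, g2] at h6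
      linear_combination h6
    · rw [h7, zero_smul, ha0, hR0 1 (by norm_num), g1, g0]
      ext <;> simp
  have hq0 : quotientJet c β 0 ≠ 0 := hk.c_ne
  refine ⟨ψ, S, fun q => Q (q.1, a q.2, q.2), quotientJet c β 0 / e,
    hψ, hS, hQa, ?_, ?_, ?_, div_ne_zero hq0 hk.e_ne, ?_, ?_, ?_, ?_⟩
  · rw [hψd, ha0]
    simp [hR0]
  · refine (injective_iff_map_eq_zero _).2 ?_
    rintro ⟨v1, v2, v3⟩ hv
    obtain ⟨x, hx, hxv⟩ := hψ' (v1, v2, v3)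
    rw [hv, eq_comm, Prod.mk_eq_zero, Prod.mk_eq_zero] at hxv
    obtain ⟨rfl, h2, h3⟩ := hxv
    have e3 : v3 = 0 := by simpa [hq0] using h3
    subst e3
    have e2 : v2 = 0 := by simpa [hq0] using h2
    subst e2
    have e1 : v1 = 0 := by simpa [hq0] using hx
    subst e1
    rfl
  · obtain ⟨x, hx, hxv⟩ := hψ' (1, 0, 0)
    have h1 : x = quotientJet c β 0 / e := by
      rw [eq_div_iff hk.e_ne, mul_comm]
      simpa using hx
    rw [hxv, h1]
    simp
  · rw [hSd]
    simp [ha0, quarticShift]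
  · have h1 := hasDerivAt_comp_line hS 0 (1, 0)
    have h2 : ∀ s : ℝ, S (0 + s • ((1 : ℝ), (0 : R3))) =
        s + β.1 * s ^ 2 + β.2.1 * s ^ 3 + β.2.2 * s ^ 4 := by
      intro s
      rw [hSd]
      simp [ha0, quarticShift]
    simp only [h2] at h1
    have h3 := hasDerivAt_id (0 : ℝ)
    refine h1.unique (HasDerivAt.congr_deriv (((h3.add ((h3.pow 2).const_mul β.1)).add
      ((h3.pow 3).const_mul β.2.1)).add ((h3.pow 4).const_mul β.2.2)) (by simp))
  · have h1 := hQ0.self_of_nhds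
    simp only [Prod.fst_zero, Prod.snd_zero, ha0]
    rw [h1]
    simpa using hq0
  · have h1 : Tendsto (fun q : ℝ × R3 => (q.1, a q.2, q.2)) (𝓝 0) (𝓝 (0, (0, 0, β), 0)) := by
      simpa [ha0] using hB.continuous.tendsto 0
    have h2 : Tendsto (fun q : ℝ × R3 => q.2) (𝓝 0) (𝓝 0) := continuous_snd.tendsto 0
    filter_upwards [h1.eventually hQR, h2.eventually haR] with q h3 h4
    simp only [Finset.sum_range_succ, Finset.sum_range_zero, h4.1, h4.2.1, h4.2.2] at h3
    rw [hψd, hSd, h3]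
    simp only [quarticShift]
    ring

end NormalForm

section NormalForm

variable {k : R2 → ℝ} {ψ : R3 → R3} {S Q : ℝ × R3 → ℝ} {κ : ℝ}

/-- The swallowtail-type surface of quintics with a double root is a cuspidal butterfly. -/
theorem fCBF_eq_of_double_root {ξ : R3} {T : ℝ} (h0 : realQuintic ξ T = 0)
    (h1 : 5 * T ^ 4 + 2 * ξ.1 * T + ξ.2.1 = 0) :
    fCBF (ξ.1, T) = (ξ.1, -ξ.2.1, ξ.2.2 - ξ.1 ^ 2) := by
  simp only [fCBF, realQuintic, Prod.mk.injEq, true_and] at h0 ⊢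
  constructor
  · linear_combination h1
  · linear_combination h0 * (-1) + T * h1

theorem QuinticNormalForm.double_root (hn : QuinticNormalForm k ψ S Q κ) (hk : ContDiff ℝ ∞ k) :
    ∀ᶠ q in 𝓝 (0 : ℝ × R3), (ψ q.2).2.1 = -fderiv ℝ k ((ψ q.2).1, S q) (0, 1) →
      (ψ q.2).2.2 = k ((ψ q.2).1, S q) + S q * (ψ q.2).2.1 →
      realQuintic q.2 q.1 = 0 ∧ 5 * q.1 ^ 4 + 2 * q.2.1 * q.1 + q.2.2.1 = 0 := by
  filter_upwards [hn.eq.eventually_nhds,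
    hn.smooth_Q.continuous.continuousAt.eventually_ne hn.Q_ne] with q hq hQ hY hZ
  have h0 : realQuintic q.2 q.1 = 0 := by
    have h1 := hq.self_of_nhds
    have h2 : Q q * realQuintic q.2 q.1 = 0 := by linear_combination h1 - hZ
    exact (mul_eq_zero.1 h2).resolve_left hQ
  refine ⟨h0, ?_⟩
  have h1 : HasDerivAt (fun t : ℝ => realQuintic q.2 t)
      (5 * q.1 ^ 4 + 2 * q.2.1 * q.1 + q.2.2.1) q.1 := by
    have h2 := hasDerivAt_id q.1
    refine HasDerivAt.congr_deriv ((((h2.pow 5).add ((h2.pow 2).const_mul q.2.1)).add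
      (h2.const_mul q.2.2.1)).add_const q.2.2.2) (by simp; ring)
  have hl : HasDerivAt (fun t : ℝ => (t, q.2)) (1, 0) q.1 :=
    (hasDerivAt_id q.1).prodMk (hasDerivAt_const _ _)
  have hS : HasDerivAt (fun t : ℝ => S (t, q.2)) (fderiv ℝ S q (1, 0)) q.1 :=
    (hn.smooth_S.differentiable (by simp)).differentiableAt.hasFDerivAt.comp_hasDerivAt q.1 hl
  have hQd : HasDerivAt (fun t : ℝ => Q (t, q.2)) (fderiv ℝ Q q (1, 0)) q.1 :=
    (hn.smooth_Q.differentiable (by simp)).differentiableAt.hasFDerivAt.comp_hasDerivAt q.1 hl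
  have hkd : HasDerivAt (fun t : ℝ => k ((ψ q.2).1, S (t, q.2)))
      (fderiv ℝ k ((ψ q.2).1, S q) (0, fderiv ℝ S q (1, 0))) q.1 :=
    (hk.differentiable (by simp)).differentiableAt.hasFDerivAt.comp_hasDerivAt q.1
      ((hasDerivAt_const _ _).prodMk hS)
  have h3 := ((hS.const_mul (ψ q.2).2.1).const_sub (ψ q.2).2.2).sub hkd
  have h4 : Tendsto (fun t : ℝ => (t, q.2)) (𝓝 q.1) (𝓝 q) :=
    hl.continuousAt
  have h5 := h3.unique (((hQd.mul h1).neg).congr_of_eventuallyEq (by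
    filter_upwards [h4.eventually hq] with t ht
    exact ht))
  have h6 : fderiv ℝ k ((ψ q.2).1, S q) (0, fderiv ℝ S q (1, 0)) =
      fderiv ℝ S q (1, 0) * fderiv ℝ k ((ψ q.2).1, S q) (0, 1) := by
    rw [← smul_eq_mul, ← map_smul]
    simp
  rw [h0, h6, hY] at h5
  have h7 : Q q * (5 * q.1 ^ 4 + 2 * q.2.1 * q.1 + q.2.2.1) = 0 := by
    linear_combination h5
  exact (mul_eq_zero.1 h7).resolve_left hQ

theorem QuinticNormalForm.aequiv_fCBF (hn : QuinticNormalForm k ψ S Q κ) (hk : ContDiff ℝ ∞ k)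
    {f : R2 → R3} (hf : ContDiff ℝ ∞ f) {p : R2} {X : R3 → R3} (hX : ContDiff ℝ ∞ X)
    (hXi : Function.Injective (fderiv ℝ X (f p))) {M : R2 → ℝ} (hM : ContDiff ℝ ∞ M)
    (hM0 : M p = 0) (hXp : X (f p) = 0) (hd : ∀ v, (fderiv ℝ (fun q => X (f q)) p v).2 = 0)
    (hi : ∀ v, fderiv ℝ (fun q => X (f q)) p v = 0 → fderiv ℝ M p v = 0 → v = 0)
    (heq : ∀ᶠ q in 𝓝 p, (X (f q)).2.1 = -fderiv ℝ k ((X (f q)).1, M q) (0, 1) ∧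
      (X (f q)).2.2 = k ((X (f q)).1, M q) + M q * (X (f q)).2.1) :
    AEquiv f p fCBF (0, 0) := by
  obtain ⟨η, hη, hηψ, hψη⟩ := exists_eventually_inverse hn.smooth_ψ hn.injective
  rw [hn.ψ_zero] at hψη
  have hη0 : η 0 = 0 := by
    have := hηψ.self_of_nhds
    rwa [hn.ψ_zero] at this
  have hη1 : ∀ v, fderiv ℝ η 0 (fderiv ℝ ψ 0 v) = v := by
    intro v
    have h1 := hasDerivAt_comp_line hn.smooth_ψ 0 v
    have h2 : HasFDerivAt η (fderiv ℝ η 0) (ψ (0 + (0 : ℝ) • v)) := by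
      rw [zero_smul, add_zero, hn.ψ_zero]
      exact (hη.differentiable (by simp)).differentiableAt.hasFDerivAt
    have h5 : Tendsto (fun s : ℝ => 0 + s • v) (𝓝 0) (𝓝 0) := by
      have : Continuous fun s : ℝ => 0 + s • v := by fun_prop
      simpa using this.tendsto 0
    have h6 : HasDerivAt (fun s : ℝ => 0 + s • v) v 0 := by
      simpa using (hasDerivAt_id (0 : ℝ)).smul_const v
    refine (h2.comp_hasDerivAt (0 : ℝ) h1).unique (h6.congr_of_eventuallyEq ?_)
    filter_upwards [h5.eventually hηψ] with s hs
    exact hs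
  have hη2 : ∀ v, fderiv ℝ η 0 v = 0 → v = 0 := by
    intro v hv
    have hs : Function.Surjective (fderiv ℝ ψ 0) :=
      LinearMap.surjective_of_injective (f := (fderiv ℝ ψ 0).toLinearMap) hn.injective
    obtain ⟨w, rfl⟩ := hs v
    rw [hη1] at hv
    rw [hv, map_zero]
  have hη3 : ∀ x : ℝ, fderiv ℝ η 0 (x, 0, 0) = (x / κ, 0, 0) := by
    intro x
    have h1 := hη1 ((x / κ) • (1, 0, 0))
    rw [map_smul, hn.fderiv_ψ] at h1
    simpa [hn.κ_ne] using h1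
  obtain ⟨τ, hτ, hτ0, hτS, -⟩ := exists_implicit_function (E := R3 × ℝ) (G := ℝ)
    (F := fun q => S (q.2, q.1.1) - q.1.2) (x₀ := (0, 0)) (y₀ := 0)
    (by
      have h1 : ContDiff ℝ ∞ fun q : (R3 × ℝ) × ℝ => (q.2, q.1.1) := by fun_prop
      exact (hn.smooth_S.comp h1).sub (by fun_prop))
    (sub_eq_zero.2 hn.S_zero)
    (by
      intro b hb
      have h1 : ContDiff ℝ ∞ fun q : (R3 × ℝ) × ℝ => (q.2, q.1.1) := by fun_prop
      have h2 := hasDerivAt_comp_line (f := fun q : (R3 × ℝ) × ℝ => S (q.2, q.1.1) - q.1.2)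
        ((hn.smooth_S.comp h1).sub (by fun_prop)) ((0, 0), 0) (0, b)
      rw [hb] at h2
      have h3 := hasDerivAt_comp_line hn.smooth_S 0 (b, 0)
      have h4 : ((b, 0) : ℝ × R3) = b • (1, 0) := by simp
      have h5 := h2.unique (h3.congr_of_eventuallyEq (Eventually.of_forall fun s => by simp))
      rw [h4, map_smul, hn.fderiv_S] at h5
      simpa [eq_comm] using h5)
  have hXf : ContDiff ℝ ∞ fun q => X (f q) := hX.comp hf
  obtain ⟨ξ, hξ, hξd⟩ : ∃ ξ : R2 → R3, ContDiff ℝ ∞ ξ ∧ ∀ q, ξ q = η (X (f q)) :=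
    ⟨_, hη.comp hXf, fun _ => rfl⟩
  have hξp : ξ p = 0 := by rw [hξd, hXp, hη0]
  obtain ⟨T, hT, hTd⟩ : ∃ T : R2 → ℝ, ContDiff ℝ ∞ T ∧ ∀ q, T q = τ (ξ q, M q) :=
    ⟨_, hτ.comp (hξ.prodMk hM), fun _ => rfl⟩
  have hTp : T p = 0 := by rw [hTd, hξp, hM0]; exact hτ0
  have hTS : ∀ᶠ q in 𝓝 p, S (T q, ξ q) = M q := by
    have h1 : Tendsto (fun q => (ξ q, M q)) (𝓝 p) (𝓝 (0, 0)) := by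
      simpa [hξp, hM0] using (hξ.prodMk hM).continuous.tendsto p
    filter_upwards [h1.eventually hτS] with q hq
    rw [hTd]
    exact sub_eq_zero.1 hq
  have hξ' : ∀ v, fderiv ℝ ξ p v = ((fderiv ℝ (fun q => X (f q)) p v).1 / κ, 0, 0) := by
    intro v
    have h1 := hasDerivAt_comp_line hXf p v
    have h2 : HasFDerivAt η (fderiv ℝ η 0) (X (f (p + (0 : ℝ) • v))) := by
      rw [zero_smul, add_zero, hXp]
      exact (hη.differentiable (by simp)).differentiableAt.hasFDerivAt
    have h3 := hasDerivAt_comp_line hξ p v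
    simp only [hξd] at h3
    rw [h3.unique (h2.comp_hasDerivAt (0 : ℝ) h1), ← hη3]
    congr 1
    exact Prod.ext rfl (hd v)
  refine ⟨fun q => ((ξ q).1, T q), fun x => ((η (X x)).1, -(η (X x)).2.1,
    (η (X x)).2.2 - (η (X x)).1 ^ 2), ?_, ?_, ?_, ?_, ?_⟩
  · refine isLocalDiffeoAt_of_injective_fderiv (hξ.fst.prodMk hT) ?_
    refine (injective_iff_map_eq_zero _).2 fun v hv => ?_
    have h1 := hasDerivAt_comp_line (hξ.fst.prodMk hT) p v
    rw [hv] at h1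
    have h2 := hasDerivAt_comp_line hξ p v
    have g1 := hasDerivAt_fst_comp h2
    have h3 := (hasDerivAt_fst_comp h1).unique g1
    rw [hξ'] at h3 h2
    have h4 : (fderiv ℝ (fun q => X (f q)) p v).1 = 0 := by
      simpa [hn.κ_ne] using h3.symm
    rw [h4, zero_div] at h2
    have h5 := hasDerivAt_snd_comp h1
    have h6 : HasFDerivAt S (fderiv ℝ S 0) (T (p + (0 : ℝ) • v), ξ (p + (0 : ℝ) • v)) := by
      rw [zero_smul, add_zero, hξp, hTp]
      exact (hn.smooth_S.differentiable (by simp)).differentiableAt.hasFDerivAt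
    have h7 : Tendsto (fun s : ℝ => p + s • v) (𝓝 0) (𝓝 p) := by
      have : Continuous fun s : ℝ => p + s • v := by fun_prop
      simpa using this.tendsto 0
    have h8 := (hasDerivAt_comp_line hM p v).unique
      ((h6.comp_hasDerivAt (0 : ℝ) (h5.prodMk h2)).congr_of_eventuallyEq (by
        filter_upwards [h7.eventually hTS] with s hs
        exact hs.symm))
    refine hi v (Prod.ext h4 (hd v)) ?_
    rw [h8]
    exact map_zero _
  · simp [hξp, hTp]
  · have h1 : ContDiff ℝ ∞ fun x => η (X x) := hη.comp hX
    refine isLocalDiffeoAt_of_injective_fderiv (by fun_prop) ?_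
    refine (injective_iff_map_eq_zero _).2 fun v hv => ?_
    have h2 := hasDerivAt_comp_line (f := fun x => ((η (X x)).1, -(η (X x)).2.1,
      (η (X x)).2.2 - (η (X x)).1 ^ 2)) (by fun_prop) (f p) v
    rw [hv] at h2
    have h3 := hasDerivAt_comp_line hX (f p) v
    have h4 : HasFDerivAt η (fderiv ℝ η 0) (X (f p + (0 : ℝ) • v)) := by
      rw [zero_smul, add_zero, hXp]
      exact (hη.differentiable (by simp)).differentiableAt.hasFDerivAt
    have h5 : HasDerivAt (fun s : ℝ => η (X (f p + s • v))) _ 0 := h4.comp_hasDerivAt (0 : ℝ) h3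
    have e1 := hasDerivAt_fst_comp h5
    have e2 := hasDerivAt_fst_comp (hasDerivAt_snd_comp h5)
    have e3 := hasDerivAt_snd_comp (hasDerivAt_snd_comp h5)
    have g1 := (hasDerivAt_fst_comp h2).unique e1
    have g2 := (hasDerivAt_fst_comp (hasDerivAt_snd_comp h2)).unique e2.neg
    have g3 := (hasDerivAt_snd_comp (hasDerivAt_snd_comp h2)).unique (e3.sub (e1.pow 2))
    simp only [Prod.fst_zero, Prod.snd_zero] at g1 g2 g3
    rw [← g1] at g3
    have h6 : fderiv ℝ η 0 (fderiv ℝ X (f p) v) = 0 := by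
      refine Prod.ext g1.symm (Prod.ext ?_ ?_)
      · simpa [eq_comm] using g2
      · simpa [eq_comm] using g3
    exact (injective_iff_map_eq_zero _).1 hXi v (hη2 _ h6)
  · simp [hXp, hη0, fCBF]
  · have h1 : Tendsto (fun q => (T q, ξ q)) (𝓝 p) (𝓝 0) := by
      have := (hT.prodMk hξ).continuous.tendsto p
      rwa [hTp, hξp] at this
    have h2 : Tendsto (fun q => X (f q)) (𝓝 p) (𝓝 0) := by
      simpa [hXp] using hXf.continuous.tendsto p
    filter_upwards [h1.eventually (hn.double_root hk), h2.eventually hψη, hTS, heq]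
      with q g1 g2 g3 g4
    rw [← hξd] at g2 ⊢
    simp only [g2, g3] at g1
    obtain ⟨e1, e2⟩ := g1 g4.1 g4.2
    exact (fCBF_eq_of_double_root e1 e2).symm

end NormalForm

section NullSurface

/-- Near `p`, the surface `F` is the sum of two curves with null tangents
`a (1, S, S²)` and `b (1, T, T²)`. -/
structure IsNullSurface (F : R2 → R3) (a b S T : ℝ → ℝ) (p : R2) : Prop where
  smooth_F : ContDiff ℝ ∞ F
  smooth_a : ContDiff ℝ ∞ a
  smooth_b : ContDiff ℝ ∞ b
  smooth_S : ContDiff ℝ ∞ S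
  smooth_T : ContDiff ℝ ∞ T
  F_zero : F p = 0
  S_zero : S p.1 = 0
  T_zero : T p.2 = 0
  fderiv_F : ∀ᶠ q in 𝓝 p, ∀ v, fderiv ℝ F q v = (v.1 * a q.1 + v.2 * b q.2,
    v.1 * a q.1 * S q.1 + v.2 * b q.2 * T q.2, v.1 * a q.1 * S q.1 ^ 2 + v.2 * b q.2 * T q.2 ^ 2)
  a_ne : a p.1 ≠ 0
  b_ne : b p.2 ≠ 0
  deriv_S_ne : deriv S p.1 ≠ 0
  deriv_T_ne : deriv T p.2 ≠ 0

variable {F : R2 → R3} {a b S T : ℝ → ℝ} {p : R2}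

theorem exists_eq_add_mul_of_contDiff_real {f : ℝ → ℝ} (hf : ContDiff ℝ ∞ f) :
    ∃ g : ℝ → ℝ, ContDiff ℝ ∞ g ∧ ∀ t, f t = f 0 + t * g t := by
  obtain ⟨g, hg, h⟩ := exists_eq_add_mul_of_contDiff (E := ℝ) (f := fun t _ => f t)
    (hf.comp contDiff_fst)
  refine ⟨fun t => g t 0, ?_, fun t => h t 0⟩
  have h1 : ContDiff ℝ ∞ fun t : ℝ => (t, (0 : ℝ)) := by fun_prop
  have h2 := hg.comp h1
  exact h2

theorem exists_jet_of_contDiff {f : ℝ → ℝ} (hf : ContDiff ℝ ∞ f) :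
    ∃ (c : ℕ → ℝ) (g : ℝ → ℝ), ContDiff ℝ ∞ g ∧ c 0 = f 0 ∧
      ∀ t, f t = c 0 + c 1 * t + c 2 * t ^ 2 + c 3 * t ^ 3 + t ^ 4 * g t := by
  obtain ⟨g1, hg1, h1⟩ := exists_eq_add_mul_of_contDiff_real hf
  obtain ⟨g2, hg2, h2⟩ := exists_eq_add_mul_of_contDiff_real hg1
  obtain ⟨g3, hg3, h3⟩ := exists_eq_add_mul_of_contDiff_real hg2
  obtain ⟨g4, hg4, h4⟩ := exists_eq_add_mul_of_contDiff_real hg3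
  refine ⟨fun j => if j = 0 then f 0 else if j = 1 then g1 0 else if j = 2 then g2 0 else g3 0,
    g4, hg4, rfl, fun t => ?_⟩
  norm_num
  linear_combination h1 t + t * h2 t + t ^ 2 * h3 t + t ^ 3 * h4 t

theorem IsNullSurface.det_ne (h : IsNullSurface F a b S T p)
    (hab : a p.1 / deriv S p.1 + b p.2 / deriv T p.2 = 0) {x y : ℝ}
    (h1 : x * a p.1 + y * b p.2 = 0) (h2 : x * deriv S p.1 + y * deriv T p.2 = 0) :
    x = 0 ∧ y = 0 := by
  have hS := h.deriv_S_ne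
  have hT := h.deriv_T_ne
  have ha := h.a_ne
  field_simp at hab
  have h3 : x = 0 := by
    have : 2 * (deriv T p.2 * a p.1) * x = 0 := by
      linear_combination deriv T p.2 * h1 - b p.2 * h2 + x * hab
    simpa [ha, hT] using this
  subst h3
  refine ⟨rfl, ?_⟩
  simpa [hT] using h2

/-- `η` is the inverse of the chart formed by the first coordinate and the sum of the slopes. -/
structure IsSlopeChart (F : R2 → R3) (a b S T : ℝ → ℝ) (p : R2) (η : R2 → R2) : Prop where
  smooth : ContDiff ℝ ∞ η
  map_zero : η 0 = p
  left_inv : ∀ᶠ q in 𝓝 p, η ((F q).1, S q.1 + T q.2) = q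
  spec : ∀ᶠ z in 𝓝 (0 : R2), (F (η z)).1 = z.1 ∧ S (η z).1 + T (η z).2 = z.2 ∧
    ∀ v, (fderiv ℝ η z v).1 * a (η z).1 + (fderiv ℝ η z v).2 * b (η z).2 = v.1 ∧
      (fderiv ℝ η z v).1 * deriv S (η z).1 + (fderiv ℝ η z v).2 * deriv T (η z).2 = v.2

theorem IsNullSurface.exists_chart (h : IsNullSurface F a b S T p)
    (hab : a p.1 / deriv S p.1 + b p.2 / deriv T p.2 = 0) :
    ∃ η : R2 → R2, IsSlopeChart F a b S T p η := by
  obtain ⟨Φ, hΦ, hΦd⟩ : ∃ Φ : R2 → R2, ContDiff ℝ ∞ Φ ∧ ∀ q, Φ q = ((F q).1, S q.1 + T q.2) :=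
    ⟨_, h.smooth_F.fst.prodMk ((h.smooth_S.comp contDiff_fst).add
      (h.smooth_T.comp contDiff_snd)), fun _ => rfl⟩
  have hdΦ : ∀ᶠ q in 𝓝 p, ∀ v, fderiv ℝ Φ q v = (v.1 * a q.1 + v.2 * b q.2,
        v.1 * deriv S q.1 + v.2 * deriv T q.2) := by
    filter_upwards [h.fderiv_F] with q hq v
    have h1 := hasDerivAt_fst_comp (hasDerivAt_comp_line h.smooth_F q v)
    rw [hq] at h1
    have h2 := hasDerivAt_comp_line h.smooth_S q.1 v.1
    have h3 := hasDerivAt_comp_line h.smooth_T q.2 v.2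
    have h4 := hasDerivAt_comp_line hΦ q v
    simp only [hΦd] at h4
    rw [h4.unique (h1.prodMk (h2.add h3)), fderiv_eq_smul_deriv, fderiv_eq_smul_deriv, smul_eq_mul,
      smul_eq_mul]
  have hΦp : Φ p = 0 := by
    rw [hΦd, h.F_zero, h.S_zero, h.T_zero]
    simp
  obtain ⟨η, hη, hηΦ, hΦη⟩ := exists_eventually_inverse hΦ (p := p) (by
    refine (injective_iff_map_eq_zero _).2 fun v hv => ?_
    rw [hdΦ.self_of_nhds, Prod.mk_eq_zero] at hv
    obtain ⟨h1, h2⟩ := h.det_ne hab hv.1 hv.2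
    exact Prod.ext h1 h2)
  rw [hΦp] at hΦη
  have hηp : η 0 = p := by
    have := hηΦ.self_of_nhds
    rwa [hΦp] at this
  have hη1 : Tendsto η (𝓝 0) (𝓝 p) := by
    simpa [hηp] using hη.continuous.tendsto 0
  refine ⟨η, hη, hηp, ?_, ?_⟩
  · filter_upwards [hηΦ] with q hq
    rwa [← hΦd]
  · filter_upwards [hΦη.eventually_nhds, hη1.eventually hdΦ] with z h1 h2
    have h3 := h1.self_of_nhds
    rw [hΦd] at h3
    refine ⟨congrArg Prod.fst h3, congrArg Prod.snd h3, fun v => ?_⟩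
    have h4 := hasDerivAt_comp_line hη z v
    have h5 : HasFDerivAt Φ (fderiv ℝ Φ (η z)) (η (z + (0 : ℝ) • v)) := by
      rw [zero_smul, add_zero]
      exact (hΦ.differentiable (by simp)).differentiableAt.hasFDerivAt
    have h6 : HasDerivAt (fun s : ℝ => z + s • v) v 0 := by
      simpa using ((hasDerivAt_id (0 : ℝ)).smul_const v).const_add z
    have h7 : Tendsto (fun s : ℝ => z + s • v) (𝓝 0) (𝓝 z) := by
      simpa using h6.continuousAt.tendsto
    have h8 := (h5.comp_hasDerivAt (0 : ℝ) h4).unique (h6.congr_of_eventuallyEq (by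
      filter_upwards [h7.eventually h1] with s hs
      exact hs))
    rw [h2] at h8
    exact ⟨congrArg Prod.fst h8, congrArg Prod.snd h8⟩

end NullSurface

section SlopeGap

variable {F : R2 → R3} {a b S T : ℝ → ℝ} {p : R2} {η : R2 → R2}

/-- Difference of the slopes of the two null curves, in the slope chart. -/
def slopeGap (S T : ℝ → ℝ) (η : R2 → R2) (z : R2) : ℝ := S (η z).1 - T (η z).2

/-- Potential of the null surface, in the slope chart. -/
def nullPotential (F : R2 → R3) (η : R2 → R2) (z : R2) : ℝ :=
  (F (η z)).2.2 - z.2 * (F (η z)).2.1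

theorem IsSlopeChart.contDiff_slopeGap (hη : IsSlopeChart F a b S T p η)
    (h : IsNullSurface F a b S T p) : ContDiff ℝ ∞ (slopeGap S T η) :=
  (h.smooth_S.comp hη.smooth.fst).sub (h.smooth_T.comp hη.smooth.snd)

theorem IsSlopeChart.contDiff_nullPotential (hη : IsSlopeChart F a b S T p η)
    (h : IsNullSurface F a b S T p) : ContDiff ℝ ∞ (nullPotential F η) := by
  have h1 := h.smooth_F.comp hη.smooth
  exact h1.snd.snd.sub (contDiff_snd.mul h1.snd.fst)

theorem IsSlopeChart.tendsto (hη : IsSlopeChart F a b S T p η) : Tendsto η (𝓝 0) (𝓝 p) := by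
  simpa [hη.map_zero] using hη.smooth.continuous.tendsto 0

theorem IsSlopeChart.hasDerivAt_slopeGap (hη : IsSlopeChart F a b S T p η)
    (h : IsNullSurface F a b S T p) (z ζ : R2) :
    HasDerivAt (fun s : ℝ => slopeGap S T η (z + s • ζ))
      (deriv S (η z).1 * (fderiv ℝ η z ζ).1 - deriv T (η z).2 * (fderiv ℝ η z ζ).2) 0 := by
  have h1 := hasDerivAt_comp_line hη.smooth z ζ
  have hS : HasDerivAt S (deriv S (η z).1) (η (z + (0 : ℝ) • ζ)).1 := by
    rw [zero_smul, add_zero]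
    exact (h.smooth_S.differentiable (by simp)).differentiableAt.hasDerivAt
  have hT : HasDerivAt T (deriv T (η z).2) (η (z + (0 : ℝ) • ζ)).2 := by
    rw [zero_smul, add_zero]
    exact (h.smooth_T.differentiable (by simp)).differentiableAt.hasDerivAt
  exact (hS.comp 0 (hasDerivAt_fst_comp h1)).sub (hT.comp 0 (hasDerivAt_snd_comp h1))

theorem IsSlopeChart.hasDerivAt_surface (hη : IsSlopeChart F a b S T p η)
    (h : IsNullSurface F a b S T p) (z ζ : R2) :
    HasDerivAt (fun s : ℝ => F (η (z + s • ζ))) (fderiv ℝ F (η z) (fderiv ℝ η z ζ)) 0 := by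
  have h1 := hasDerivAt_comp_line hη.smooth z ζ
  have hF : HasFDerivAt F (fderiv ℝ F (η z)) (η (z + (0 : ℝ) • ζ)) := by
    rw [zero_smul, add_zero]
    exact (h.smooth_F.differentiable (by simp)).differentiableAt.hasFDerivAt
  exact hF.comp_hasDerivAt (0 : ℝ) h1

theorem IsSlopeChart.fderiv_snd_coord (hη : IsSlopeChart F a b S T p η)
    (h : IsNullSurface F a b S T p) : ∀ᶠ z in 𝓝 (0 : R2),
    fderiv ℝ (fun z => (F (η z)).2.1) z (0, 1) =
      (fderiv ℝ η z (0, 1)).1 * a (η z).1 * slopeGap S T η z := by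
  filter_upwards [hη.tendsto.eventually h.fderiv_F, hη.spec] with z hF hz
  have h1 := hη.hasDerivAt_surface h z (0, 1)
  have h2 := hasDerivAt_fst_comp (hasDerivAt_snd_comp h1)
  have h3 : ContDiff ℝ ∞ fun z => (F (η z)).2.1 := (h.smooth_F.comp hη.smooth).snd.fst
  rw [(hasDerivAt_comp_line h3 z (0, 1)).unique h2, hF]
  simp only [slopeGap]
  linear_combination T (η z).2 * (hz.2.2 (0, 1)).1

theorem IsSlopeChart.fderiv_nullPotential (hη : IsSlopeChart F a b S T p η)
    (h : IsNullSurface F a b S T p) : ∀ᶠ z in 𝓝 (0 : R2), ∀ ζ : R2,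
    fderiv ℝ (nullPotential F η) z ζ =
      -(S (η z).1 * T (η z).2 * ζ.1) - (F (η z)).2.1 * ζ.2 := by
  filter_upwards [hη.tendsto.eventually h.fderiv_F, hη.spec] with z hF hz ζ
  have h1 := hη.hasDerivAt_surface h z ζ
  rw [hF] at h1
  have h2 := hasDerivAt_fst_comp (hasDerivAt_snd_comp h1)
  have h3 := hasDerivAt_snd_comp (hasDerivAt_snd_comp h1)
  have h4 : HasDerivAt (fun s : ℝ => z.2 + s * ζ.2) ζ.2 0 := by
    simpa using ((hasDerivAt_id (0 : ℝ)).mul_const ζ.2).const_add z.2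
  have h5 := h3.sub (h4.mul h2)
  have h6 := hasDerivAt_comp_line (hη.contDiff_nullPotential h) z ζ
  have h7 := h6.unique h5
  rw [h7]
  simp only [zero_smul, add_zero, zero_mul]
  rw [← hz.2.1]
  linear_combination -(S (η z).1 * T (η z).2) * (hz.2.2 ζ).1

/-- The null curves of a null surface have parametrizations `u`, `v` by their slopes, along which
the first coordinate has a degenerate critical point of order three. -/
structure IsButterflySlope (a b S T : ℝ → ℝ) (p : R2) (u v l : ℝ → ℝ) : Prop where
  smooth_u : ContDiff ℝ ∞ u
  smooth_v : ContDiff ℝ ∞ v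
  smooth_l : ContDiff ℝ ∞ l
  u_zero : u 0 = p.1
  v_zero : v 0 = p.2
  S_u : ∀ᶠ y in 𝓝 0, S (u y) = y
  T_v : ∀ᶠ y in 𝓝 0, T (v y) = y
  add_eq : ∀ᶠ y in 𝓝 0, a (u y) / deriv S (u y) + b (v y) / deriv T (v y) = y ^ 2 * l y
  l_ne : l 0 ≠ 0

variable {u v l : ℝ → ℝ}

theorem IsButterflySlope.add_eq_zero (hs : IsButterflySlope a b S T p u v l) :
    a p.1 / deriv S p.1 + b p.2 / deriv T p.2 = 0 := by
  have := hs.add_eq.self_of_nhds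
  simpa [hs.u_zero, hs.v_zero] using this

theorem deriv_inv_of_eventually {S u : ℝ → ℝ} (hS : ContDiff ℝ ∞ S) (hu : ContDiff ℝ ∞ u)
    (h : ∀ᶠ y in 𝓝 0, S (u y) = y) : ∀ᶠ y in 𝓝 0, deriv u y = 1 / deriv S (u y) := by
  filter_upwards [h.eventually_nhds] with y hy
  have h1 : HasDerivAt S (deriv S (u y)) (u y) :=
    (hS.differentiable (by simp)).differentiableAt.hasDerivAt
  have h2 : HasDerivAt u (deriv u y) y :=
    (hu.differentiable (by simp)).differentiableAt.hasDerivAt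
  have h3 := (h1.comp y h2).unique ((hasDerivAt_id y).congr_of_eventuallyEq hy)
  exact eq_one_div_of_mul_eq_one_right h3

theorem IsButterflySlope.exists_fst_eq (hs : IsButterflySlope a b S T p u v l)
    (h : IsNullSurface F a b S T p) : ∃ κ : ℝ → ℝ, ContDiff ℝ ∞ κ ∧ κ 0 ≠ 0 ∧
      ∀ᶠ y in 𝓝 0, (F (u y, v y)).1 = y ^ 3 * κ y := by
  have hγ : ContDiff ℝ ∞ fun y => (u y, v y) := hs.smooth_u.prodMk hs.smooth_v
  have hγ0 : Tendsto (fun y => (u y, v y)) (𝓝 0) (𝓝 p) := by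
    simpa [hs.u_zero, hs.v_zero] using hγ.continuous.tendsto 0
  have hθ : ContDiff ℝ ∞ fun y => (F (u y, v y)).1 := (h.smooth_F.comp hγ).fst
  obtain ⟨κ, hκ, hκ0, he⟩ := exists_eq_pow_mul_of_deriv_eq (j := 2) hθ hs.smooth_l
    (by simp [hs.u_zero, hs.v_zero, h.F_zero]) (by
      filter_upwards [deriv_inv_of_eventually h.smooth_S hs.smooth_u hs.S_u,
        deriv_inv_of_eventually h.smooth_T hs.smooth_v hs.T_v, hs.add_eq,
        hγ0.eventually h.fderiv_F] with y h1 h2 h3 h4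
      have h5 : HasFDerivAt F (fderiv ℝ F (u y, v y)) (u y, v y) :=
        (h.smooth_F.differentiable (by simp)).differentiableAt.hasFDerivAt
      have h6 : HasDerivAt (fun y => (u y, v y)) (deriv u y, deriv v y) y :=
        (hs.smooth_u.differentiable (by simp)).differentiableAt.hasDerivAt.prodMk
          (hs.smooth_v.differentiable (by simp)).differentiableAt.hasDerivAt
      have h7 := hasDerivAt_fst_comp (h5.comp_hasDerivAt y h6)
      rw [h4] at h7
      rw [← h3]
      refine h7.deriv.trans ?_
      simp only
      rw [h1, h2]
      ring)
  refine ⟨κ, hκ, ?_, he⟩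
  rw [hκ0]
  exact div_ne_zero hs.l_ne (by norm_num)

theorem IsButterflySlope.exists_slopeGap_eq (hs : IsButterflySlope a b S T p u v l)
    (h : IsNullSurface F a b S T p) (hη : IsSlopeChart F a b S T p η) :
    ∃ ρ : ℝ → ℝ, ContDiff ℝ ∞ ρ ∧ ρ 0 ≠ 0 ∧
      ∀ᶠ m in 𝓝 0, slopeGap S T η (0, m) = m ^ 3 * ρ m := by
  obtain ⟨κ, hκ, hκ0, he⟩ := hs.exists_fst_eq h
  have hγ : ContDiff ℝ ∞ fun y => (u y, v y) := hs.smooth_u.prodMk hs.smooth_v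
  have hγ0 : Tendsto (fun y => (u y, v y)) (𝓝 0) (𝓝 p) := by
    simpa [hs.u_zero, hs.v_zero] using hγ.continuous.tendsto 0
  have hθ0 : ContDiff ℝ ∞ fun m : ℝ => (F (u (m / 2), v (m / 2))).1 :=
    ((h.smooth_F.comp hγ).comp (by fun_prop : ContDiff ℝ ∞ fun m : ℝ => m / 2)).fst
  obtain ⟨θ, hθ, hθd⟩ : ∃ θ : ℝ → ℝ, ContDiff ℝ ∞ θ ∧ ∀ m, θ m = (F (u (m / 2), v (m / 2))).1 :=
    ⟨_, hθ0, fun _ => rfl⟩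
  have hD := hη.contDiff_slopeGap h
  have hG : ContDiff ℝ ∞ fun q : ℝ × ℝ => (θ q.2 + q.1, q.2) :=
    ((hθ.comp contDiff_snd).add contDiff_fst).prodMk contDiff_snd
  obtain ⟨g, hg, hgD⟩ := exists_eq_add_mul_of_contDiff (E := ℝ)
    (f := fun t m => slopeGap S T η (θ m + t, m)) (by
      have := hD.comp hG
      exact this)
  have hθz : θ 0 = 0 := by
    rw [hθd]
    simp [hs.u_zero, hs.v_zero, h.F_zero]
  have hhalf : Tendsto (fun m : ℝ => m / 2) (𝓝 0) (𝓝 0) := by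
    have : Continuous fun m : ℝ => m / 2 := by fun_prop
    simpa using this.tendsto 0
  have hD0 : ∀ᶠ m in 𝓝 (0 : ℝ), slopeGap S T η (θ m, m) = 0 := by
    filter_upwards [hhalf.eventually (hγ0.eventually hη.left_inv), hhalf.eventually hs.S_u,
      hhalf.eventually hs.T_v] with m h1 h2 h3
    rw [← hθd, h2, h3, add_halves] at h1
    rw [slopeGap, h1, h2, h3, sub_self]
  refine ⟨fun m => -(κ (m / 2) / 8) * g (-θ m) m, ?_, ?_, ?_⟩
  · have h1 : ContDiff ℝ ∞ fun m => (-θ m, m) := hθ.neg.prodMk contDiff_id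
    have h2 := hg.comp h1
    have h3 : ContDiff ℝ ∞ fun m : ℝ => κ (m / 2) := hκ.comp (by fun_prop)
    exact (h3.div_const 8).neg.mul h2
  · have h1 := hη.hasDerivAt_slopeGap h 0 (1, 0)
    have h2 : HasDerivAt (fun t : ℝ => t * g t 0) (g 0 0) 0 := by
      have h3 : ContDiff ℝ ∞ fun t : ℝ => (t, (0 : ℝ)) := by fun_prop
      have h4 := (hg.comp h3).differentiable (by simp)
      have h5 := (hasDerivAt_id (0 : ℝ)).mul (h4 0).hasDerivAt
      exact h5.congr_deriv (by simp)
    have h6 := h1.unique (h2.congr_of_eventuallyEq (Eventually.of_forall fun t => by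
      have h7 := hgD t 0
      have h8 : slopeGap S T η (0, 0) = 0 := by simpa [hθz] using hD0.self_of_nhds
      simp only [hθz, zero_add, h8] at h7
      simpa using h7))
    obtain ⟨-, -, h7⟩ := hη.spec.self_of_nhds
    obtain ⟨h8, h9⟩ := h7 (1, 0)
    simp only [hη.map_zero] at h6 h8 h9
    have h10 : (fderiv ℝ η 0 (1, 0)).1 ≠ 0 := by
      intro h11
      rw [h11] at h8 h9
      have h12 : (fderiv ℝ η 0 (1, 0)).2 = 0 := by simpa [h.deriv_T_ne] using h9
      rw [h12] at h8
      simp at h8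
    have h13 : g 0 0 = 2 * ((fderiv ℝ η 0 (1, 0)).1 * deriv S p.1) := by
      linear_combination -h6 - h9
    simp only [zero_div, hθz, neg_zero, h13]
    exact mul_ne_zero (neg_ne_zero.2 (div_ne_zero hκ0 (by norm_num)))
      (mul_ne_zero two_ne_zero (mul_ne_zero h10 h.deriv_S_ne))
  · filter_upwards [hD0, hhalf.eventually he] with m h1 h2
    have h3 := hgD (-θ m) m
    simp only [add_neg_cancel, add_zero, h1, zero_add] at h3
    rw [← hθd] at h2
    rw [h3]
    nth_rewrite 1 [h2]
    ring

end SlopeGap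

section NullSurfaceButterfly

variable {F : R2 → R3} {a b S T : ℝ → ℝ} {p : R2} {η : R2 → R2} {u v l : ℝ → ℝ}

theorem IsButterflySlope.exists_nullPotential_eq (hs : IsButterflySlope a b S T p u v l)
    (h : IsNullSurface F a b S T p) (hη : IsSlopeChart F a b S T p η) :
    ∃ κ : ℝ → ℝ, ContDiff ℝ ∞ κ ∧ κ 0 ≠ 0 ∧
      ∀ᶠ m in 𝓝 0, nullPotential F η (0, m) = m ^ 5 * κ m := by
  obtain ⟨ρ, hρ, hρ0, hD⟩ := hs.exists_slopeGap_eq h hη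
  have hl : ContDiff ℝ ∞ fun m : ℝ => ((0 : ℝ), m) := by fun_prop
  have hl0 : Tendsto (fun m : ℝ => ((0 : ℝ), m)) (𝓝 0) (𝓝 0) := by
    exact hl.continuous.tendsto 0
  have hX : ContDiff ℝ ∞ fun z => (F (η z)).2.1 := (h.smooth_F.comp hη.smooth).snd.fst
  have hk := hη.contDiff_nullPotential h
  have hμ : ContDiff ℝ ∞ fun m : ℝ => (fderiv ℝ η (0, m) (0, 1)).1 := by
    have h1 : ContDiff ℝ ∞ (fderiv ℝ η) := hη.smooth.fderiv_right (by simp)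
    have h2 := h1.comp hl
    exact (h2.clm_apply contDiff_const).fst
  have haη : ContDiff ℝ ∞ fun m : ℝ => a (η (0, m)).1 :=
    h.smooth_a.comp (hη.smooth.comp hl).fst
  have hderiv : ∀ {G : R2 → ℝ}, ContDiff ℝ ∞ G → ∀ m : ℝ,
      deriv (fun m => G (0, m)) m = fderiv ℝ G (0, m) (0, 1) := fun {G} hG m => by
    have h1 : HasFDerivAt G (fderiv ℝ G (0, m)) (0, m) :=
      (hG.differentiable (by simp)).differentiableAt.hasFDerivAt
    have h2 : HasDerivAt (fun m : ℝ => ((0 : ℝ), m)) (0, 1) m :=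
      (hasDerivAt_const m (0 : ℝ)).prodMk (hasDerivAt_id m)
    exact (h1.comp_hasDerivAt m h2).deriv
  obtain ⟨κ, hκ, hκ0, he⟩ := exists_eq_pow_mul_of_deriv_eq (j := 3) (hX.comp hl)
    (ρ := fun m => (fderiv ℝ η (0, m) (0, 1)).1 * a (η (0, m)).1 * ρ m) ((hμ.mul haη).mul hρ)
    (by
      have h1 : η (0, 0) = p := hη.map_zero
      simp [h1, h.F_zero]) (by
      filter_upwards [hD, hl0.eventually (hη.fderiv_snd_coord h)] with m h1 h2
      refine (hderiv hX m).trans ?_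
      rw [h2, h1]
      ring)
  obtain ⟨κ', hκ', hκ0', he'⟩ := exists_eq_pow_mul_of_deriv_eq (j := 4) (hk.comp hl)
    hκ.neg (by
      have h1 : η (0, 0) = p := hη.map_zero
      simp [nullPotential, h1, h.F_zero]) (by
      filter_upwards [he, hl0.eventually (hη.fderiv_nullPotential h)] with m h1 h2
      refine (hderiv hk m).trans ?_
      simp only [Function.comp_apply] at h1
      rw [h2, h1]
      ring)
  refine ⟨κ', hκ', ?_, he'⟩
  obtain ⟨-, -, h7⟩ := hη.spec.self_of_nhds
  obtain ⟨h8, h9⟩ := h7 (0, 1)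
  have h10 : η (0, 0) = p := hη.map_zero
  simp only [hη.map_zero] at h8 h9
  have h11 : (fderiv ℝ η 0 (0, 1)).1 ≠ 0 := by
    intro h11
    rw [h11] at h8 h9
    have h12 : (fderiv ℝ η 0 (0, 1)).2 = 0 := by simpa [h.b_ne] using h8
    rw [h12] at h9
    simp at h9
  rw [hκ0', hκ0, h10]
  exact div_ne_zero (neg_ne_zero.2 (div_ne_zero (mul_ne_zero (mul_ne_zero h11 h.a_ne) hρ0)
    (by norm_num))) (by norm_num)

theorem IsButterflySlope.exists_butterflyJet (hs : IsButterflySlope a b S T p u v l)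
    (h : IsNullSurface F a b S T p) (hη : IsSlopeChart F a b S T p η) :
    ∃ c e g ε, ButterflyJet (nullPotential F η) c e g ε := by
  obtain ⟨ρ, hρ, -, hD⟩ := hs.exists_slopeGap_eq h hη
  obtain ⟨κ, hκ, hκ0, he⟩ := hs.exists_nullPotential_eq h hη
  obtain ⟨c, g, hg, hc, hκg⟩ := exists_jet_of_contDiff hκ
  have hl0 : Tendsto (fun m : ℝ => ((0 : ℝ), m)) (𝓝 0) (𝓝 0) := by
    have : Continuous fun m : ℝ => ((0 : ℝ), m) := by fun_prop
    exact this.tendsto 0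
  refine ⟨c, -1 / 4, g, fun m => m ^ 2 * ρ m ^ 2 / 4, hη.contDiff_nullPotential h, hg,
    by fun_prop, ?_, ?_, hc ▸ hκ0, by norm_num⟩
  · filter_upwards [he] with m hm
    rw [hm, hκg]
  · filter_upwards [hD, hl0.eventually (hη.fderiv_nullPotential h), hl0.eventually hη.spec]
      with m h1 h2 h3
    rw [h2]
    simp only [slopeGap] at h1
    have h4 := h3.2.1
    linear_combination (-1 / 4) * (S (η (0, m)).1 + T (η (0, m)).2 + m) * h4 +
      (1 / 4) * (S (η (0, m)).1 - T (η (0, m)).2 + m ^ 3 * ρ m) * h1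

theorem IsButterflySlope.aequiv_fCBF {f : R2 → R3} {X : R3 → R3}
    (hs : IsButterflySlope a b S T p u v l)
    (h : IsNullSurface (fun q => X (f q)) a b S T p) (hf : ContDiff ℝ ∞ f) (hX : ContDiff ℝ ∞ X)
    (hXi : Function.Injective (fderiv ℝ X (f p))) : AEquiv f p fCBF (0, 0) := by
  have hab := hs.add_eq_zero
  obtain ⟨η, hη⟩ := h.exists_chart hab
  obtain ⟨c, e, g, ε, hk⟩ := hs.exists_butterflyJet h hη
  obtain ⟨ψ, σ, Q, κ, hn⟩ := hk.exists_normalForm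
  have hM : ContDiff ℝ ∞ fun q : R2 => S q.1 + T q.2 :=
    (h.smooth_S.comp contDiff_fst).add (h.smooth_T.comp contDiff_snd)
  have hF := h.fderiv_F.self_of_nhds
  refine hn.aequiv_fCBF (hη.contDiff_nullPotential h) hf hX hXi hM
    (by simp [h.S_zero, h.T_zero]) h.F_zero (fun v => ?_) (fun v h1 h2 => ?_) ?_
  · rw [hF, h.S_zero, h.T_zero]
    simp
  · rw [hF, Prod.mk_eq_zero] at h1
    have h3 := hasDerivAt_comp_line hM p v
    have h4 := hasDerivAt_comp_line h.smooth_S p.1 v.1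
    have h5 := hasDerivAt_comp_line h.smooth_T p.2 v.2
    have h6 := h3.unique (h4.add h5)
    rw [h2, fderiv_eq_smul_deriv, fderiv_eq_smul_deriv] at h6
    obtain ⟨h7, h8⟩ := h.det_ne hab h1.1 h6.symm
    exact Prod.ext h7 h8
  · have hz : Tendsto (fun q : R2 => ((X (f q)).1, S q.1 + T q.2)) (𝓝 p) (𝓝 0) := by
      have h1 : Continuous fun q : R2 => ((X (f q)).1, S q.1 + T q.2) :=
        (h.smooth_F.continuous.fst).prodMk hM.continuous
      have h2 : X (f p) = 0 := h.F_zero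
      have h3 := h1.tendsto p
      rw [h2, h.S_zero, h.T_zero, add_zero] at h3
      exact h3
    filter_upwards [hη.left_inv, hz.eventually (hη.fderiv_nullPotential h)] with q h1 h2
    rw [h2, nullPotential, h1]
    constructor
    · simp
    · ring

end NullSurfaceButterfly

section SingularCurve

theorem exists_contDiff_eventuallyEq_inv {f : ℝ → ℝ} (hf : ContDiff ℝ ∞ f) {x : ℝ}
    (hx : f x ≠ 0) : ∃ g : ℝ → ℝ, ContDiff ℝ ∞ g ∧ ∀ᶠ y in 𝓝 x, g y = (f y)⁻¹ := by
  obtain ⟨g, hg, -, h⟩ := ContDiffOn.exists_hasCompactSupport_eventuallyEq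
    (isOpen_compl_singleton.preimage hf.continuous) (f := fun y => (f y)⁻¹)
    (hf.contDiffOn.inv fun y hy => hy) (x := x) hx
  exact ⟨g, hg, h⟩

theorem exists_contDiff_eventuallyEq_phiW {g w : ℝ → ℝ} (hg : ContDiff ℝ ∞ g)
    (hw : ContDiff ℝ ∞ w) {x : ℝ} (hgx : g x ≠ 0) (hwx : w x ≠ 0) :
    ∃ φ : ℝ → ℝ, ContDiff ℝ ∞ φ ∧ φ =ᶠ[𝓝 x] phiW g w := by
  obtain ⟨m, hm, h⟩ := exists_contDiff_eventuallyEq_inv ((hg.pow 2).mul hw) (x := x)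
    (mul_ne_zero (pow_ne_zero 2 hgx) hwx)
  refine ⟨fun y => deriv g y * m y, (contDiff_infty_iff_deriv.1 hg).2.mul hm, ?_⟩
  filter_upwards [h] with y hy
  rw [hy, phiW, div_eq_mul_inv]

theorem exists_eq_sq_mul_iff {f : ℝ → ℝ} (hf : ContDiff ℝ ∞ f) :
    (∃ l : ℝ → ℝ, ContDiff ℝ ∞ l ∧ l 0 ≠ 0 ∧ ∀ᶠ y in 𝓝 0, f y = y ^ 2 * l y) ↔
      f 0 = 0 ∧ deriv f 0 = 0 ∧ deriv (deriv f) 0 ≠ 0 := by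
  have key : ∀ l : ℝ → ℝ, ContDiff ℝ ∞ l → ∀ c d : ℝ,
      (∀ᶠ y in 𝓝 0, f y = c + d * y + y ^ 2 * l y) →
      f 0 = c ∧ deriv f 0 = d ∧ deriv (deriv f) 0 = 2 * l 0 := by
    intro l hl c d h
    have h1 : ∀ y, HasDerivAt (fun y => c + d * y + y ^ 2 * l y)
        (d + y * (2 * l y + y * deriv l y)) y := fun y => by
      have h2 := (hl.differentiable (by simp) y).hasDerivAt
      refine ((((hasDerivAt_id y).const_mul d).const_add c).add
        (((hasDerivAt_id y).pow 2).mul h2)).congr_deriv ?_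
      simp
      ring
    have h3 : deriv f =ᶠ[𝓝 0] fun y => d + y * (2 * l y + y * deriv l y) := by
      filter_upwards [h.eventually_nhds] with y hy
      exact ((h1 y).congr_of_eventuallyEq hy).deriv
    have h4 : HasDerivAt (fun y => d + y * (2 * l y + y * deriv l y)) (2 * l 0) 0 := by
      have h5 : ContDiff ℝ ∞ fun y => 2 * l y + y * deriv l y :=
        (contDiff_const.mul hl).add (contDiff_id.mul (contDiff_infty_iff_deriv.1 hl).2)
      have h6 := ((hasDerivAt_id (0 : ℝ)).mul
        (h5.differentiable (by simp) 0).hasDerivAt).const_add d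
      exact h6.congr_deriv (by simp)
    exact ⟨by simpa using h.self_of_nhds, by simpa using h3.self_of_nhds,
      (h4.congr_of_eventuallyEq h3).deriv⟩
  constructor
  · rintro ⟨l, hl, hl0, h⟩
    obtain ⟨h1, h2, h3⟩ := key l hl 0 0 (by simpa using h)
    exact ⟨h1, h2, by simpa [h3] using hl0⟩
  · rintro ⟨h1, h2, h3⟩
    obtain ⟨g, hg, hfg⟩ := exists_eq_add_mul_of_contDiff_real hf
    obtain ⟨l, hl, hgl⟩ := exists_eq_add_mul_of_contDiff_real hg
    have h4 : ∀ y, f y = f 0 + g 0 * y + y ^ 2 * l y := fun y => by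
      rw [hfg y, hgl y]
      ring
    obtain ⟨-, h5, h6⟩ := key l hl (f 0) (g 0) (Eventually.of_forall h4)
    rw [h2] at h5
    rw [h6] at h3
    refine ⟨l, hl, by simpa using h3, Eventually.of_forall fun y => ?_⟩
    rw [h4 y, h1, ← h5]
    ring

/-- `y ↦ (u y, v y)` is a regular parametrization of the singular set `g1 g2 = 1` through `p`. -/
structure IsSingularCurve (g1 g2 : ℝ → ℝ) (p : R2) (u v : ℝ → ℝ) : Prop where
  smooth_g1 : ContDiff ℝ ∞ g1
  smooth_g2 : ContDiff ℝ ∞ g2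
  smooth_u : ContDiff ℝ ∞ u
  smooth_v : ContDiff ℝ ∞ v
  u_zero : u 0 = p.1
  v_zero : v 0 = p.2
  mul_eq : ∀ᶠ y in 𝓝 0, g1 (u y) * g2 (v y) = 1
  deriv_g1_ne : deriv g1 p.1 ≠ 0
  deriv_g2_ne : deriv g2 p.2 ≠ 0
  deriv_u_ne : deriv u 0 ≠ 0

variable {g1 g2 w1 w2 u v φ1 φ2 : ℝ → ℝ} {p : R2}

/-- Logarithmic derivative of `g1` along the singular curve. -/
def logSpeed (g1 u : ℝ → ℝ) (y : ℝ) : ℝ := deriv u y * deriv g1 (u y) / g1 (u y)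

theorem IsSingularCurve.tendsto_u (h : IsSingularCurve g1 g2 p u v) :
    Tendsto u (𝓝 0) (𝓝 p.1) := by
  simpa [h.u_zero] using h.smooth_u.continuous.tendsto 0

theorem IsSingularCurve.tendsto_v (h : IsSingularCurve g1 g2 p u v) :
    Tendsto v (𝓝 0) (𝓝 p.2) := by
  simpa [h.v_zero] using h.smooth_v.continuous.tendsto 0

theorem IsSingularCurve.g1_ne (h : IsSingularCurve g1 g2 p u v) : g1 p.1 ≠ 0 := by
  have h1 := h.mul_eq.self_of_nhds
  rw [h.u_zero, h.v_zero] at h1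
  exact left_ne_zero_of_mul_eq_one h1

theorem IsSingularCurve.g2_ne (h : IsSingularCurve g1 g2 p u v) : g2 p.2 ≠ 0 := by
  have h1 := h.mul_eq.self_of_nhds
  rw [h.u_zero, h.v_zero] at h1
  exact right_ne_zero_of_mul_eq_one h1

theorem IsSingularCurve.eventually_ne (h : IsSingularCurve g1 g2 p u v) :
    ∀ᶠ y in 𝓝 0, deriv g1 (u y) ≠ 0 ∧ deriv g2 (v y) ≠ 0 := by
  have h1 := (contDiff_infty_iff_deriv.1 h.smooth_g1).2.continuous.tendsto p.1
  have h2 := (contDiff_infty_iff_deriv.1 h.smooth_g2).2.continuous.tendsto p.2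
  exact ((h1.comp h.tendsto_u).eventually_ne h.deriv_g1_ne).and
    ((h2.comp h.tendsto_v).eventually_ne h.deriv_g2_ne)

theorem IsSingularCurve.deriv_eq (h : IsSingularCurve g1 g2 p u v) :
    ∀ᶠ y in 𝓝 0, deriv u y = logSpeed g1 u y * (g1 (u y) / deriv g1 (u y)) ∧
      deriv v y = -(logSpeed g1 u y * (g2 (v y) / deriv g2 (v y))) := by
  filter_upwards [h.eventually_ne, h.mul_eq.eventually_nhds] with y hy hy1
  have h1 : HasDerivAt g1 (deriv g1 (u y)) (u y) :=
    (h.smooth_g1.differentiable (by simp) _).hasDerivAt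
  have h2 : HasDerivAt g2 (deriv g2 (v y)) (v y) :=
    (h.smooth_g2.differentiable (by simp) _).hasDerivAt
  have h3 : HasDerivAt u (deriv u y) y := (h.smooth_u.differentiable (by simp) _).hasDerivAt
  have h4 : HasDerivAt v (deriv v y) y := (h.smooth_v.differentiable (by simp) _).hasDerivAt
  have h5 := ((h1.comp y h3).mul (h2.comp y h4)).unique
    ((hasDerivAt_const y (1 : ℝ)).congr_of_eventuallyEq hy1)
  have h6 := hy1.self_of_nhds
  obtain ⟨h7, h8⟩ := hy
  have h9 := left_ne_zero_of_mul_eq_one h6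
  unfold logSpeed
  simp only [Function.comp_apply] at h5
  constructor
  · field_simp
  · field_simp
    linear_combination h5

theorem IsSingularCurve.hasDerivAt_add (h : IsSingularCurve g1 g2 p u v) :
    ∀ᶠ y in 𝓝 0, ∀ A B : ℝ → ℝ, DifferentiableAt ℝ A (u y) → DifferentiableAt ℝ B (v y) →
      HasDerivAt (fun y => A (u y) + B (v y)) (logSpeed g1 u y *
        (g1 (u y) / deriv g1 (u y) * deriv A (u y) -
          g2 (v y) / deriv g2 (v y) * deriv B (v y))) y := by
  filter_upwards [h.deriv_eq] with y hy A B hA hB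
  have h3 : HasDerivAt u (deriv u y) y := (h.smooth_u.differentiable (by simp) _).hasDerivAt
  have h4 : HasDerivAt v (deriv v y) y := (h.smooth_v.differentiable (by simp) _).hasDerivAt
  refine ((hA.hasDerivAt.comp y h3).add (hB.hasDerivAt.comp y h4)).congr_deriv ?_
  rw [hy.1, hy.2]
  ring

theorem IsSingularCurve.exists_sq_iff (h : IsSingularCurve g1 g2 p u v)
    (hφ1 : ContDiff ℝ ∞ φ1) (hφ2 : ContDiff ℝ ∞ φ2) (h1 : φ1 =ᶠ[𝓝 p.1] phiW g1 w1)
    (h2 : φ2 =ᶠ[𝓝 p.2] phiW g2 w2) :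
    (∃ l : ℝ → ℝ, ContDiff ℝ ∞ l ∧ l 0 ≠ 0 ∧
      ∀ᶠ y in 𝓝 0, φ1 (u y) + φ2 (v y) = y ^ 2 * l y) ↔
      phiW g1 w1 p.1 + phiW g2 w2 p.2 = 0 ∧ PhiW g1 w1 p.1 - PhiW g2 w2 p.2 = 0 ∧
       g1 p.1 / deriv g1 p.1 * deriv (PhiW g1 w1) p.1
         + g2 p.2 / deriv g2 p.2 * deriv (PhiW g2 w2) p.2 ≠ 0 := by
  have hχ : ContDiff ℝ ∞ fun y => φ1 (u y) + φ2 (v y) :=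
    (hφ1.comp h.smooth_u).add (hφ2.comp h.smooth_v)
  rw [exists_eq_sq_mul_iff hχ]
  have hdiff : ∀ {g w φ : ℝ → ℝ} {x : ℝ}, ContDiff ℝ ∞ g → ContDiff ℝ ∞ φ → φ =ᶠ[𝓝 x] phiW g w →
      deriv g x ≠ 0 → DifferentiableAt ℝ (PhiW g w) x := by
    intro g w φ x hg hφ h hx
    have h3 : PhiW g w =ᶠ[𝓝 x] fun t => g t / deriv g t * deriv φ t := by
      filter_upwards [h.deriv] with t ht
      rw [PhiW, ht]
    refine DifferentiableAt.congr_of_eventuallyEq ?_ h3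
    have h4 := (contDiff_infty_iff_deriv.1 hg).2.differentiable (by simp) x
    have h5 := (contDiff_infty_iff_deriv.1 hφ).2.differentiable (by simp) x
    exact ((hg.differentiable (by simp) x).div h4 hx).mul h5
  have hd1 := hdiff h.smooth_g1 hφ1 h1 h.deriv_g1_ne
  have hd2 := hdiff h.smooth_g2 hφ2 h2 h.deriv_g2_ne
  have hσ : logSpeed g1 u 0 ≠ 0 := by
    rw [logSpeed, h.u_zero]
    exact div_ne_zero (mul_ne_zero h.deriv_u_ne h.deriv_g1_ne) h.g1_ne
  have hσd : DifferentiableAt ℝ (logSpeed g1 u) 0 := by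
    have h3 := (contDiff_infty_iff_deriv.1 h.smooth_u).2.differentiable (by simp) 0
    have h4 := ((contDiff_infty_iff_deriv.1 h.smooth_g1).2.comp h.smooth_u).differentiable
      (by simp) 0
    have h5 := (h.smooth_g1.comp h.smooth_u).differentiable (by simp) 0
    have h6 : g1 (u 0) ≠ 0 := by
      rw [h.u_zero]
      exact h.g1_ne
    exact (h3.mul h4).div h5 h6
  have hderiv : deriv (fun y => φ1 (u y) + φ2 (v y)) =ᶠ[𝓝 0] fun y =>
      logSpeed g1 u y * (PhiW g1 w1 (u y) + -PhiW g2 w2 (v y)) := by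
    filter_upwards [h.hasDerivAt_add, h.tendsto_u.eventually h1.deriv,
      h.tendsto_v.eventually h2.deriv] with y hy hy1 hy2
    rw [(hy φ1 φ2 (hφ1.differentiable (by simp) _) (hφ2.differentiable (by simp) _)).deriv,
      hy1, hy2, PhiW, PhiW]
    ring
  have hχ0 : φ1 (u 0) + φ2 (v 0) = phiW g1 w1 p.1 + phiW g2 w2 p.2 := by
    rw [h.u_zero, h.v_zero, h1.self_of_nhds, h2.self_of_nhds]
  have hχ1 : deriv (fun y => φ1 (u y) + φ2 (v y)) 0 =
      logSpeed g1 u 0 * (PhiW g1 w1 p.1 - PhiW g2 w2 p.2) := by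
    rw [hderiv.self_of_nhds, ← h.u_zero, ← h.v_zero]
    ring
  have hχ2 : deriv (deriv fun y => φ1 (u y) + φ2 (v y)) 0 =
      deriv (logSpeed g1 u) 0 * (PhiW g1 w1 p.1 - PhiW g2 w2 p.2) +
      logSpeed g1 u 0 * (logSpeed g1 u 0 * (g1 p.1 / deriv g1 p.1 * deriv (PhiW g1 w1) p.1
         + g2 p.2 / deriv g2 p.2 * deriv (PhiW g2 w2) p.2)) := by
    have h3 := h.hasDerivAt_add.self_of_nhds (PhiW g1 w1) (fun t => -PhiW g2 w2 t)
      (by rwa [h.u_zero]) (by rw [h.v_zero]; exact hd2.neg)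
    have h4 := (hσd.hasDerivAt.mul h3).congr_of_eventuallyEq hderiv
    rw [h4.deriv, h.u_zero, h.v_zero]
    simp only [deriv.fun_neg]
    ring
  rw [hχ0, hχ1, hχ2, mul_eq_zero, or_iff_right hσ]
  refine and_congr_right fun _ => and_congr_right fun h3 => ?_
  rw [h3, mul_zero, zero_add]
  simp [hσ]

end SingularCurve

section Sufficiency

/-- Linear coordinates of `𝕃³` in which the null direction of slope `s` is the first axis. -/
def nullCoords (s : ℝ) : R3 →L[ℝ] R3 :=
  LinearMap.toContinuousLinearMap
    { toFun := fun y => (y.2.1 - y.1, y.2.2 - s * (y.2.1 - y.1),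
        -(y.1 + y.2.1) - 2 * s * y.2.2 + s ^ 2 * (y.2.1 - y.1))
      map_add' := fun x y => by
        ext <;> simp <;> ring
      map_smul' := fun c x => by
        ext <;> simp <;> ring }

theorem nullCoords_apply (s : ℝ) (y : R3) : nullCoords s y =
    (y.2.1 - y.1, y.2.2 - s * (y.2.1 - y.1),
      -(y.1 + y.2.1) - 2 * s * y.2.2 + s ^ 2 * (y.2.1 - y.1)) := rfl

theorem nullCoords_injective (s : ℝ) : Function.Injective (nullCoords s) := by
  refine (injective_iff_map_eq_zero _).2 fun y hy => ?_
  rw [nullCoords_apply, Prod.mk_eq_zero, Prod.mk_eq_zero] at hy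
  obtain ⟨h1, h2, h3⟩ := hy
  have h4 : y.2.2 = 0 := by linear_combination h2 + s * h1
  have h5 : y.1 = 0 := by
    linear_combination (-1 / 2 : ℝ) * h3 - s * h4 + (s ^ 2 / 2 - 1 / 2) * h1
  have h6 : y.2.1 = 0 := by linear_combination h1 + h5
  exact Prod.ext h5 (Prod.ext h6 h4)

variable {f : R2 → R3} {g1 g2 w1 w2 : ℝ → ℝ} {p : R2}

theorem fderiv_eq_pu_pv (f : R2 → R3) (q v : R2) :
    fderiv ℝ f q v = v.1 • pu f q + v.2 • pv f q := by
  have h : v = v.1 • ((1 : ℝ), (0 : ℝ)) + v.2 • ((0 : ℝ), (1 : ℝ)) := by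
    ext <;> simp
  nth_rewrite 1 [h]
  rw [map_add, map_smul, map_smul, pu, pv]

theorem IsGTMS.isNullSurface (hf : IsGTMS f g1 g2 w1 w2) (hw1 : ∀ u, w1 u ≠ 0)
    (hw2 : ∀ v, w2 v ≠ 0) (hp : g1 p.1 * g2 p.2 = 1) (hg1 : deriv g1 p.1 ≠ 0)
    (hg2 : deriv g2 p.2 ≠ 0) {h : ℝ → ℝ} (hh : ContDiff ℝ ∞ h)
    (hhg : ∀ᶠ t in 𝓝 p.2, h t = (g2 t)⁻¹) :
    IsNullSurface (fun q => nullCoords (g1 p.1) (f q - f p)) w1 (fun t => -(w2 t * g2 t ^ 2))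
      (fun t => g1 t - g1 p.1) (fun t => h t - g1 p.1) p := by
  have hg20 : g2 p.2 ≠ 0 := right_ne_zero_of_mul_eq_one hp
  refine ⟨(nullCoords _).contDiff.comp (hf.smooth_f.sub contDiff_const), hf.smooth_w1,
    (hf.smooth_w2.mul (hf.smooth_g2.pow 2)).neg, hf.smooth_g1.sub contDiff_const,
    hh.sub contDiff_const, by simp, by simp, ?_, ?_, hw1 _, ?_, ?_, ?_⟩
  · rw [hhg.self_of_nhds, eq_inv_of_mul_eq_one_left hp, sub_self]
  · have h1 : Tendsto (fun q : R2 => q.2) (𝓝 p) (𝓝 p.2) := continuous_snd.tendsto p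
    have h2 := hf.smooth_g2.continuous.tendsto p.2
    filter_upwards [h1.eventually hhg, h1.eventually (h2.eventually_ne hg20)] with q hq hq2 v
    have h3 : HasFDerivAt f (fderiv ℝ f q) q :=
      (hf.smooth_f.differentiable (by simp)).differentiableAt.hasFDerivAt
    have h4 := (nullCoords (g1 p.1)).hasFDerivAt.comp q (h3.sub_const (f p))
    have h5 : fderiv ℝ (fun q => nullCoords (g1 p.1) (f q - f p)) q v =
        nullCoords (g1 p.1) (fderiv ℝ f q v) := by
      have := h4.fderiv
      exact congrArg (fun A : R2 →L[ℝ] R3 => A v) this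
    rw [h5, fderiv_eq_pu_pv, hf.deriv_u, hf.deriv_v, nullCoords_apply, hq]
    ext
    · simp
      ring
    · simp
      field_simp
      ring
    · simp
      field_simp
      ring
  · exact neg_ne_zero.2 (mul_ne_zero (hw2 _) (pow_ne_zero 2 hg20))
  · simpa using hg1
  · rw [deriv_sub_const, (EventuallyEq.deriv_eq hhg)]
    have h1 := (hf.smooth_g2.differentiable (by simp) p.2).hasDerivAt
    rw [(h1.fun_inv hg20).deriv]
    exact div_ne_zero (neg_ne_zero.2 hg2) (pow_ne_zero 2 hg20)

theorem exists_eventually_rightInverse {S : ℝ → ℝ} (hS : ContDiff ℝ ∞ S) {x : ℝ} (hx : S x = 0)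
    (hd : deriv S x ≠ 0) : ∃ u : ℝ → ℝ, ContDiff ℝ ∞ u ∧ u 0 = x ∧ ∀ᶠ y in 𝓝 0, S (u y) = y := by
  obtain ⟨u, hu, h1, h2⟩ := exists_eventually_inverse hS (p := x) (by
    refine (injective_iff_map_eq_zero _).2 fun v hv => ?_
    rw [fderiv_eq_smul_deriv, smul_eq_mul] at hv
    exact (mul_eq_zero.1 hv).resolve_right hd)
  rw [hx] at h2
  exact ⟨u, hu, by simpa [hx] using h1.self_of_nhds, h2⟩

theorem IsGTMS.aequiv_fCBF (hf : IsGTMS f g1 g2 w1 w2) (hw1 : ∀ u, w1 u ≠ 0)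
    (hw2 : ∀ v, w2 v ≠ 0) (hp : g1 p.1 * g2 p.2 = 1)
    (h1 : phiW g1 w1 p.1 - phiW g2 w2 p.2 ≠ 0) (h2 : phiW g1 w1 p.1 + phiW g2 w2 p.2 = 0)
    (h3 : PhiW g1 w1 p.1 - PhiW g2 w2 p.2 = 0)
    (h4 : g1 p.1 / deriv g1 p.1 * deriv (PhiW g1 w1) p.1
      + g2 p.2 / deriv g2 p.2 * deriv (PhiW g2 w2) p.2 ≠ 0) : AEquiv f p fCBF (0, 0) := by
  have hφ1 : phiW g1 w1 p.1 ≠ 0 := fun h => h1 (by linear_combination 2 * h - h2)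
  have hφ2 : phiW g2 w2 p.2 ≠ 0 := fun h => h1 (by linear_combination h2 - 2 * h)
  have hg1 : deriv g1 p.1 ≠ 0 := fun h => hφ1 (by simp [phiW, h])
  have hg2 : deriv g2 p.2 ≠ 0 := fun h => hφ2 (by simp [phiW, h])
  have hg10 : g1 p.1 ≠ 0 := left_ne_zero_of_mul_eq_one hp
  have hg20 : g2 p.2 ≠ 0 := right_ne_zero_of_mul_eq_one hp
  obtain ⟨h, hh, hhg⟩ := exists_contDiff_eventuallyEq_inv hf.smooth_g2 hg20
  have hN := hf.isNullSurface hw1 hw2 hp hg1 hg2 hh hhg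
  obtain ⟨u, hu, hu0, hSu⟩ := exists_eventually_rightInverse hN.smooth_S hN.S_zero hN.deriv_S_ne
  obtain ⟨v, hv, hv0, hTv⟩ := exists_eventually_rightInverse hN.smooth_T hN.T_zero hN.deriv_T_ne
  have hvt : Tendsto v (𝓝 0) (𝓝 p.2) := by
    simpa [hv0] using hv.continuous.tendsto 0
  have hut : Tendsto u (𝓝 0) (𝓝 p.1) := by
    simpa [hu0] using hu.continuous.tendsto 0
  have hg2v : ∀ᶠ y in 𝓝 0, g2 (v y) ≠ 0 :=
    ((hf.smooth_g2.continuous.tendsto p.2).comp hvt).eventually_ne hg20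
  have hC : IsSingularCurve g1 g2 p u v := by
    refine ⟨hf.smooth_g1, hf.smooth_g2, hu, hv, hu0, hv0, ?_, hg1, hg2, ?_⟩
    · filter_upwards [hSu, hTv, hvt.eventually hhg, hg2v] with y h5 h6 h7 h8
      have h9 : g1 (u y) = (g2 (v y))⁻¹ := by linear_combination h5 - h6 + h7
      rw [h9, inv_mul_cancel₀ h8]
    · rw [(deriv_inv_of_eventually hN.smooth_S hu hSu).self_of_nhds, hu0]
      exact one_div_ne_zero hN.deriv_S_ne
  obtain ⟨φ1, hφs1, he1⟩ := exists_contDiff_eventuallyEq_phiW hf.smooth_g1 hf.smooth_w1 hg10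
    (hw1 p.1)
  obtain ⟨φ2, hφs2, he2⟩ := exists_contDiff_eventuallyEq_phiW hf.smooth_g2 hf.smooth_w2 hg20
    (hw2 p.2)
  obtain ⟨l, hl, hl0, hχ⟩ := (hC.exists_sq_iff hφs1 hφs2 he1 he2).2 ⟨h2, h3, h4⟩
  have hm0 : g1 (u 0) ^ 2 * φ1 (u 0) * φ2 (v 0) ≠ 0 := by
    rw [hu0, hv0, he1.self_of_nhds, he2.self_of_nhds]
    exact mul_ne_zero (mul_ne_zero (pow_ne_zero 2 hg10) hφ1) hφ2
  have hms : ContDiff ℝ ∞ fun y => g1 (u y) ^ 2 * φ1 (u y) * φ2 (v y) :=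
    (((hf.smooth_g1.comp hu).pow 2).mul (hφs1.comp hu)).mul (hφs2.comp hv)
  obtain ⟨m, hm, hme⟩ := exists_contDiff_eventuallyEq_inv hms hm0
  have hs : IsButterflySlope w1 (fun t => -(w2 t * g2 t ^ 2)) (fun t => g1 t - g1 p.1)
      (fun t => h t - g1 p.1) p u v (fun y => l y * m y) := by
    refine ⟨hu, hv, hl.mul hm, hu0, hv0, hSu, hTv, ?_, ?_⟩
    · filter_upwards [hχ, hme, hut.eventually he1, hvt.eventually he2, hC.mul_eq, hg2v,
        hC.eventually_ne, hvt.eventually (EventuallyEq.deriv hhg)] with y k1 k2 k3 k4 k5 k6 k7 k8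
      have h5 := (hf.smooth_g2.differentiable (by simp) (v y)).hasDerivAt
      rw [deriv_sub_const, deriv_sub_const, k8, (h5.fun_inv k6).deriv]
      rw [← mul_assoc, ← k1, k2, k3, k4, phiW, phiW, eq_inv_of_mul_eq_one_left k5]
      have := hw1 (u y)
      have := hw2 (v y)
      obtain ⟨k9, k10⟩ := k7
      field_simp
      ring
    · simp only [hme.self_of_nhds]
      exact mul_ne_zero hl0 (inv_ne_zero hm0)
  have hX : ContDiff ℝ ∞ fun x => nullCoords (g1 p.1) (x - f p) :=
    (nullCoords _).contDiff.comp (contDiff_id.sub contDiff_const)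
  refine hs.aequiv_fCBF hN hf.smooth_f hX ?_
  have h5 := (nullCoords (g1 p.1)).hasFDerivAt.comp (f p) ((hasFDerivAt_id (f p)).sub_const (f p))
  have h6 : fderiv ℝ (fun x => nullCoords (g1 p.1) (x - f p)) (f p) = nullCoords (g1 p.1) :=
    h5.fderiv
  rw [h6]
  exact nullCoords_injective _

end Sufficiency

section Necessity

theorem IsLocalDiffeoAt.exists_inverse {E F : Type} [NormedAddCommGroup E] [NormedSpace ℝ E]
    [NormedAddCommGroup F] [NormedSpace ℝ F] [FiniteDimensional ℝ F]
    {Φ : E → F} {p : E}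
    (h : IsLocalDiffeoAt Φ p) : ∃ χ : F → E, ContDiff ℝ ∞ χ ∧
      (∀ᶠ y in 𝓝 (Φ p), Function.Injective (fderiv ℝ χ y)) ∧
      (∀ᶠ x in 𝓝 p, χ (Φ x) = x) ∧ ∀ᶠ y in 𝓝 (Φ p), Φ (χ y) = y := by
  obtain ⟨U, V, Φinv, hU, hpU, hV, hpV, hΦ, hΦinv, hUV, hVU, hl, hr⟩ := h
  obtain ⟨χ, hχ, -, he⟩ := hΦinv.exists_hasCompactSupport_eventuallyEq hV hpV
  have hc : Tendsto Φ (𝓝 p) (𝓝 (Φ p)) := (hΦ.continuousOn.continuousAt (hU.mem_nhds hpU)).tendsto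
  have hr' : ∀ᶠ y in 𝓝 (Φ p), Φ (χ y) = y := by
    filter_upwards [he, hV.mem_nhds hpV] with y h1 h2
    rw [h1, hr y h2]
  refine ⟨χ, hχ, ?_, ?_, hr'⟩
  · filter_upwards [hr'.eventually_nhds, he, hV.mem_nhds hpV] with y h1 h2 h3
    have h4 : DifferentiableAt ℝ Φ (χ y) := by
      rw [h2]
      exact (hΦ.contDiffAt (hU.mem_nhds (hVU h3))).differentiableAt (by simp)
    have h5 := h4.hasFDerivAt.comp y (hχ.differentiable (by simp) y).hasFDerivAt
    have h6 := h5.unique ((hasFDerivAt_id y).congr_of_eventuallyEq h1)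
    refine (injective_iff_map_eq_zero _).2 fun v hv => ?_
    have h7 := congrArg (fun A : F →L[ℝ] F => A v) h6
    simpa [hv] using h7.symm
  · filter_upwards [hc.eventually he, hU.mem_nhds hpU] with x h1 h2
    rw [h1, hl x h2]

theorem AEquiv.exists_parametrization {f g : R2 → R3} {p q : R2} (hf : Continuous f)
    (h : AEquiv f p g q) : ∃ (χ : R2 → R2) (Θ : R3 → R3), ContDiff ℝ ∞ χ ∧ ContDiff ℝ ∞ Θ ∧
      χ q = p ∧ (∀ᶠ z in 𝓝 q, Function.Injective (fderiv ℝ χ z)) ∧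
      Function.Injective (fderiv ℝ Θ (g q)) ∧ ∀ᶠ z in 𝓝 q, f (χ z) = Θ (g z) := by
  obtain ⟨Φ, Ψ, hΦ, hΦp, hΨ, hΨp, he⟩ := h
  obtain ⟨χ, hχ, hχi, hχl, hχr⟩ := hΦ.exists_inverse
  obtain ⟨Θ, hΘ, hΘi, hΘl, -⟩ := hΨ.exists_inverse
  have hχq : χ q = p := by
    rw [← hΦp]
    exact hχl.self_of_nhds
  rw [hΦp] at hχi hχr
  rw [hΨp] at hΘi
  have h1 : Tendsto χ (𝓝 q) (𝓝 p) := by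
    simpa [hχq] using hχ.continuous.tendsto q
  refine ⟨χ, Θ, hχ, hΘ, hχq, hχi, hΘi.self_of_nhds, ?_⟩
  filter_upwards [h1.eventually he, h1.eventually ((hf.tendsto p).eventually hΘl), hχr]
    with z h2 h3 h4
  rw [← h3, h2, h4]

theorem eventuallyEq_of_sq_mul {f g : ℝ → ℝ} (hf : Continuous f) (hg : Continuous g)
    (h : ∀ᶠ y in 𝓝 0, y ^ 2 * f y = y ^ 2 * g y) : f =ᶠ[𝓝 0] g := by
  have h1 : f =ᶠ[𝓝[≠] 0] g := by
    filter_upwards [h.filter_mono nhdsWithin_le_nhds, self_mem_nhdsWithin] with y hy hy0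
    exact mul_left_cancel₀ (pow_ne_zero 2 hy0) hy
  exact (hf.continuousAt.eventuallyEq_nhds_iff_eventuallyEq_nhdsNE hg.continuousAt).1 h1

variable {f : R2 → R3} {g1 g2 w1 w2 : ℝ → ℝ} {p : R2}

theorem IsGTMS.mul_eq_one_of_fderiv_eq_zero (hf : IsGTMS f g1 g2 w1 w2) {q d : R2}
    (hw1 : w1 q.1 ≠ 0) (hw2 : w2 q.2 ≠ 0) (hd : d ≠ 0) (h : fderiv ℝ f q d = 0) :
    g1 q.1 * g2 q.2 = 1 := by
  rw [fderiv_eq_pu_pv, hf.deriv_u, hf.deriv_v] at h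
  simp only [Prod.smul_mk, Prod.mk_add_mk, Prod.mk_eq_zero, smul_eq_mul] at h
  obtain ⟨h1, h2, h3⟩ := h
  have e0 : d.1 * w1 q.1 = d.2 * w2 q.2 * g2 q.2 ^ 2 := by linear_combination h2 - h1
  have e1 : g1 q.1 * (d.1 * w1 q.1) = d.2 * w2 q.2 * g2 q.2 := by linear_combination h3
  have e2 : g1 q.1 ^ 2 * (d.1 * w1 q.1) = d.2 * w2 q.2 := by linear_combination -h2 - h1
  have hd1 : d.1 ≠ 0 := by
    intro h4
    rw [h4, zero_mul, mul_zero] at e2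
    have h5 : d.2 = 0 := by simpa [hw2] using e2.symm
    exact hd (Prod.ext h4 h5)
  have hne : d.1 * w1 q.1 ≠ 0 := mul_ne_zero hd1 hw1
  have hg : d.2 * w2 q.2 * g2 q.2 ≠ 0 := fun h4 => hne (by linear_combination e0 + g2 q.2 * h4)
  refine mul_left_cancel₀ hg ?_
  linear_combination e1 - g1 q.1 * e0

end Necessity

section SingularCurveOfButterfly

variable {f : R2 → R3} {g1 g2 w1 w2 : ℝ → ℝ} {p : R2}

theorem contDiff_fCBF : ContDiff ℝ ∞ fCBF := by
  unfold fCBF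
  fun_prop

theorem fderiv_fCBF_singular (y : ℝ) : fderiv ℝ fCBF (-10 * y ^ 3, y) (0, 1) = 0 := by
  have h1 := hasDerivAt_comp_line contDiff_fCBF (-10 * y ^ 3, y) (0, 1)
  have h3 : HasDerivAt (fun s : ℝ => y + s) 1 0 := (hasDerivAt_id (0 : ℝ)).const_add y
  have h4 := ((h3.pow 4).const_mul 5).add (h3.const_mul (2 * (-10 * y ^ 3)))
  have h5 := (((h3.pow 5).const_mul 4).add ((h3.pow 2).const_mul (-10 * y ^ 3))).sub_const
    ((-10 * y ^ 3) ^ 2)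
  have h6 := HasDerivAt.prodMk (hasDerivAt_const (0 : ℝ) (-10 * y ^ 3))
    (HasDerivAt.prodMk h4 h5)
  have h7 := h1.unique (h6.congr_of_eventuallyEq (Eventually.of_forall fun s => by
    simp [fCBF]))
  rw [h7]
  ext
  · rfl
  · simp
    ring
  · simp
    ring

theorem hasDerivAt_fCBF_singular (y : ℝ) : HasDerivAt (fun y : ℝ => fCBF (-10 * y ^ 3, y))
    (y ^ 2 • ((-30, -60 * y, -30 * y ^ 2 - 600 * y ^ 3) : R3)) y := by
  have h3 := hasDerivAt_id y
  have h0 := (h3.pow 3).const_mul (-10)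
  have h4 := ((h3.pow 4).const_mul 5).add ((h0.const_mul 2).mul h3)
  have h5 := (((h3.pow 5).const_mul 4).add (h0.mul (h3.pow 2))).sub (h0.pow 2)
  refine (HasDerivAt.prodMk h0 (HasDerivAt.prodMk h4 h5)).congr_deriv ?_
  ext
  · simp
    ring
  · simp
    ring
  · simp
    ring

/-- The velocity of the singular curve of a surface equivalent to the cuspidal butterfly is
`y²` times a smooth field whose derivative is independent of the field. -/
theorem exists_velocity {Θ : R3 → R3} (hΘ : ContDiff ℝ ∞ Θ) (L : R3 →L[ℝ] R3)
    (hL : Function.Injective L) (hi : Function.Injective (fderiv ℝ Θ (fCBF (0, 0)))) :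
    ∃ R : ℝ → R3, ContDiff ℝ ∞ R ∧
      (∀ y, HasDerivAt (fun y : ℝ => L (Θ (fCBF (-10 * y ^ 3, y)))) (y ^ 2 • R y) y) ∧
      ∀ c : ℝ, R 0 ≠ 0 ∧ deriv R 0 ≠ c • R 0 := by
  have hC : ContDiff ℝ ∞ fun y : ℝ => fCBF (-10 * y ^ 3, y) :=
    contDiff_fCBF.comp (by fun_prop : ContDiff ℝ ∞ fun y : ℝ => (-10 * y ^ 3, y))
  have hΘC : ContDiff ℝ ∞ fun y : ℝ => fderiv ℝ Θ (fCBF (-10 * y ^ 3, y)) :=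
    (hΘ.fderiv_right (m := ∞) (by simp)).comp hC
  obtain ⟨n, hn, hnd⟩ : ∃ n : ℝ → R3, ContDiff ℝ ∞ n ∧
      ∀ y, n y = (-30, -60 * y, -30 * y ^ 2 - 600 * y ^ 3) := ⟨_, by fun_prop, fun _ => rfl⟩
  obtain ⟨R, hR, hRd⟩ : ∃ R : ℝ → R3, ContDiff ℝ ∞ R ∧
      ∀ y, R y = L (fderiv ℝ Θ (fCBF (-10 * y ^ 3, y)) (n y)) :=
    ⟨_, L.contDiff.comp (hΘC.clm_apply hn), fun _ => rfl⟩
  have hC0 : fCBF (-10 * 0 ^ 3, 0) = fCBF (0, 0) := by norm_num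
  have hR0 : R 0 = L (fderiv ℝ Θ (fCBF (0, 0)) (-30, 0, 0)) := by
    rw [hRd, hnd, hC0]
    norm_num
  have hker : ∀ x, L (fderiv ℝ Θ (fCBF (0, 0)) x) = 0 → x = 0 := fun x hx =>
    (injective_iff_map_eq_zero _).1 hi _ ((injective_iff_map_eq_zero _).1 hL _ hx)
  refine ⟨R, hR, fun y => ?_, fun c => ⟨fun h => ?_, fun h => ?_⟩⟩
  · have h1 : HasFDerivAt Θ (fderiv ℝ Θ (fCBF (-10 * y ^ 3, y))) (fCBF (-10 * y ^ 3, y)) :=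
      (hΘ.differentiable (by simp)).differentiableAt.hasFDerivAt
    have h2 := L.hasFDerivAt.comp_hasDerivAt y (h1.comp_hasDerivAt y (hasDerivAt_fCBF_singular y))
    refine h2.congr_deriv ?_
    rw [map_smul, map_smul, hRd, hnd]
  · rw [hR0] at h
    simpa using congrArg Prod.fst (hker _ h)
  · have h1 : HasFDerivAt (fderiv ℝ Θ) (fderiv ℝ (fderiv ℝ Θ) (fCBF (-10 * 0 ^ 3, 0)))
        (fCBF (-10 * 0 ^ 3, 0)) :=
      ((hΘ.fderiv_right (m := ∞) (by simp)).differentiable (by simp)).differentiableAt.hasFDerivAt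
    have h2 := h1.comp_hasDerivAt (0 : ℝ) (hasDerivAt_fCBF_singular 0)
    have h3 : HasDerivAt n (0, -60, 0) 0 := by
      have h4 := hasDerivAt_id (0 : ℝ)
      have h5 := HasDerivAt.prodMk (hasDerivAt_const (0 : ℝ) (-30 : ℝ)) (HasDerivAt.prodMk
        (h4.const_mul (-60)) (((h4.pow 2).const_mul (-30)).sub ((h4.pow 3).const_mul 600)))
      refine (h5.congr_of_eventuallyEq (Eventually.of_forall hnd)).congr_deriv ?_
      simp
    have h6 := L.hasFDerivAt.comp_hasDerivAt (0 : ℝ) (h2.clm_apply h3)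
    have h7 := (h6.congr_of_eventuallyEq (Eventually.of_forall hRd)).deriv
    rw [h7, hR0] at h
    simp only [Function.comp_apply, hC0] at h
    have h8 : L (fderiv ℝ Θ (fCBF (0, 0)) ((0, -60, 0) - c • ((-30, 0, 0) : R3))) = 0 := by
      rw [map_sub, map_sub, map_smul, map_smul, ← h]
      simp
    have h9 := congrArg (fun x : R3 => x.2.1) (hker _ h8)
    norm_num at h9

theorem IsGTMS.exists_singularCurve (hf : IsGTMS f g1 g2 w1 w2) (hw1 : ∀ u, w1 u ≠ 0)
    (hw2 : ∀ v, w2 v ≠ 0) (h : AEquiv f p fCBF (0, 0)) :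
    ∃ u v r : ℝ → ℝ, IsSingularCurve g1 g2 p u v ∧ ContDiff ℝ ∞ r ∧ r 0 ≠ 0 ∧
      ∀ᶠ y in 𝓝 0, deriv u y * w1 (u y) - deriv v y * (w2 (v y) * g2 (v y) ^ 2) =
        y ^ 2 * r y := by
  obtain ⟨χ, Θ, hχ, hΘ, hχ0, hχi, hΘi, he⟩ := h.exists_parametrization hf.smooth_f.continuous
  obtain ⟨R, hR, hRd, hR0⟩ := exists_velocity hΘ (nullCoords 0) (nullCoords_injective 0) hΘi
  obtain ⟨z, hz, hzd⟩ : ∃ z : ℝ → R2, ContDiff ℝ ∞ z ∧ ∀ y, z y = (-10 * y ^ 3, y) :=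
    ⟨_, by fun_prop, fun _ => rfl⟩
  have hz0 : Tendsto z (𝓝 0) (𝓝 (0, 0)) := by
    simpa [hzd 0] using hz.continuous.tendsto 0
  have hγ : ContDiff ℝ ∞ fun y => χ (z y) := hχ.comp hz
  obtain ⟨u, hu, hud⟩ : ∃ u : ℝ → ℝ, ContDiff ℝ ∞ u ∧ ∀ y, u y = (χ (z y)).1 :=
    ⟨_, hγ.fst, fun _ => rfl⟩
  obtain ⟨v, hv, hvd⟩ : ∃ v : ℝ → ℝ, ContDiff ℝ ∞ v ∧ ∀ y, v y = (χ (z y)).2 :=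
    ⟨_, hγ.snd, fun _ => rfl⟩
  have huv : ∀ y, χ (z y) = (u y, v y) := fun y => by rw [hud, hvd]
  have hzz : z 0 = (0, 0) := by simp [hzd]
  have hu0 : u 0 = p.1 := by rw [hud, hzz, hχ0]
  have hv0 : v 0 = p.2 := by rw [hvd, hzz, hχ0]
  have hmul : ∀ᶠ y in 𝓝 0, g1 (u y) * g2 (v y) = 1 := by
    filter_upwards [hz0.eventually hχi, hz0.eventually he.eventually_nhds] with y h1 h2
    have h3 : HasFDerivAt f (fderiv ℝ f (χ (z y))) (χ (z y)) :=
      (hf.smooth_f.differentiable (by simp)).differentiableAt.hasFDerivAt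
    have h4 := h3.comp (z y) (hχ.differentiable (by simp) (z y)).hasFDerivAt
    have h5 : HasFDerivAt Θ (fderiv ℝ Θ (fCBF (z y))) (fCBF (z y)) :=
      (hΘ.differentiable (by simp)).differentiableAt.hasFDerivAt
    have h6 := h5.comp (z y) (contDiff_fCBF.differentiable (by simp) (z y)).hasFDerivAt
    have h7 := congrArg (fun A : R2 →L[ℝ] R3 => A (0, 1))
      (h4.unique (h6.congr_of_eventuallyEq h2))
    have h8 : fderiv ℝ f (χ (z y)) (fderiv ℝ χ (z y) (0, 1)) = 0 := by
      refine h7.trans ?_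
      rw [ContinuousLinearMap.comp_apply, hzd, fderiv_fCBF_singular, map_zero]
    rw [huv] at h8
    refine hf.mul_eq_one_of_fderiv_eq_zero (hw1 _) (hw2 _) (fun h9 => ?_) h8
    have h10 := (injective_iff_map_eq_zero _).1 h1 _ h9
    simpa using congrArg Prod.snd h10
  have hvel : ∀ᶠ y in 𝓝 0,
      deriv u y * w1 (u y) - deriv v y * (w2 (v y) * g2 (v y) ^ 2) = y ^ 2 * (R y).1 ∧
      g1 (u y) * (y ^ 2 * (R y).1) = y ^ 2 * (R y).2.1 ∧
      g1 (u y) ^ 2 * (y ^ 2 * (R y).1) = y ^ 2 * (R y).2.2 := by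
    filter_upwards [hmul, hz0.eventually he |>.eventually_nhds] with y h1 h2
    have h3 : HasFDerivAt f (fderiv ℝ f (u y, v y)) (u y, v y) :=
      (hf.smooth_f.differentiable (by simp)).differentiableAt.hasFDerivAt
    have h4 : HasDerivAt (fun y => (u y, v y)) (deriv u y, deriv v y) y :=
      (hu.differentiable (by simp)).differentiableAt.hasDerivAt.prodMk
        (hv.differentiable (by simp)).differentiableAt.hasDerivAt
    have h5 := (nullCoords 0).hasFDerivAt.comp_hasDerivAt y (h3.comp_hasDerivAt y h4)
    have h6 := h5.unique ((hRd y).congr_of_eventuallyEq (by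
      filter_upwards [h2] with t ht
      simp only [Function.comp_apply]
      rw [← huv, ht, hzd]))
    rw [fderiv_eq_pu_pv, hf.deriv_u, hf.deriv_v, nullCoords_apply] at h6
    have k1 := congrArg (fun x : R3 => x.1) h6
    have k2 := congrArg (fun x : R3 => x.2.1) h6
    have k3 := congrArg (fun x : R3 => x.2.2) h6
    simp only [Prod.smul_mk, Prod.mk_add_mk, smul_eq_mul, Prod.smul_fst, Prod.smul_snd]
      at k1 k2 k3
    refine ⟨by linear_combination k1, ?_, ?_⟩
    · rw [← k1, ← k2]
      linear_combination (-deriv v y * w2 (v y) * g2 (v y)) * h1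
    · rw [← k1, ← k3]
      linear_combination (-deriv v y * w2 (v y) * (g1 (u y) * g2 (v y) + 1)) * h1
  have hs : ContDiff ℝ ∞ fun y => g1 (u y) := hf.smooth_g1.comp hu
  have hR1 : (fun y => (R y).2.1) =ᶠ[𝓝 0] fun y => g1 (u y) * (R y).1 :=
    eventuallyEq_of_sq_mul hR.continuous.snd.fst (hs.continuous.mul hR.continuous.fst) (by
      filter_upwards [hvel] with y hy
      linear_combination -hy.2.1)
  have hR2 : (fun y => (R y).2.2) =ᶠ[𝓝 0] fun y => g1 (u y) ^ 2 * (R y).1 :=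
    eventuallyEq_of_sq_mul hR.continuous.snd.snd ((hs.continuous.pow 2).mul hR.continuous.fst) (by
      filter_upwards [hvel] with y hy
      linear_combination -hy.2.2)
  have hr0 : (R 0).1 ≠ 0 := fun h1 => (hR0 0).1 (by
    have h2 := hR1.self_of_nhds
    have h3 := hR2.self_of_nhds
    simp only [h1, mul_zero] at h2 h3
    exact Prod.ext h1 (Prod.ext h2 h3))
  have hsd : deriv (fun y => g1 (u y)) 0 ≠ 0 := by
    intro h1
    have h2 : HasDerivAt (fun y => g1 (u y)) 0 0 :=
      (hs.differentiable (by simp) 0).hasDerivAt.congr_deriv h1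
    have h3 := (hR.differentiable (by simp) 0).hasDerivAt
    have h4 := hasDerivAt_fst_comp h3
    have h5 := (hasDerivAt_fst_comp (hasDerivAt_snd_comp h3)).unique
      ((h2.mul h4).congr_of_eventuallyEq hR1)
    have h6 := (hasDerivAt_snd_comp (hasDerivAt_snd_comp h3)).unique
      (((h2.pow 2).mul h4).congr_of_eventuallyEq hR2)
    have h7 := hR1.self_of_nhds
    have h8 := hR2.self_of_nhds
    simp only at h7 h8
    refine (hR0 ((deriv R 0).1 / (R 0).1)).2 (Prod.ext ?_ (Prod.ext ?_ ?_))
    · simp [hr0]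
    · rw [h5, Prod.smul_snd, Prod.smul_fst, h7, smul_eq_mul]
      field_simp
      simp
    · rw [h6, Prod.smul_snd, Prod.smul_snd, h8, smul_eq_mul]
      field_simp
      simp
      ring
  have hg1 : HasDerivAt g1 (deriv g1 p.1) (u 0) := by
    rw [← hu0]
    exact (hf.smooth_g1.differentiable (by simp) _).hasDerivAt
  have hg2 : HasDerivAt g2 (deriv g2 p.2) (v 0) := by
    rw [← hv0]
    exact (hf.smooth_g2.differentiable (by simp) _).hasDerivAt
  have hdu := (hu.differentiable (by simp) 0).hasDerivAt
  have hdv := (hv.differentiable (by simp) 0).hasDerivAt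
  have hds := hg1.comp 0 hdu
  have hne : deriv g1 p.1 * deriv u 0 ≠ 0 := by
    rw [← hds.deriv]
    exact hsd
  refine ⟨u, v, fun y => (R y).1, ⟨hf.smooth_g1, hf.smooth_g2, hu, hv, hu0, hv0, hmul,
    left_ne_zero_of_mul hne, fun h1 => ?_, right_ne_zero_of_mul hne⟩, hR.fst, hr0,
    hvel.mono fun y hy => hy.1⟩
  have h2 := (hds.mul (hg2.comp 0 hdv)).unique
    ((hasDerivAt_const (0 : ℝ) (1 : ℝ)).congr_of_eventuallyEq hmul)
  rw [h1] at h2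
  simp only [Function.comp_apply, zero_mul, mul_zero, add_zero] at h2
  have h3 := hmul.self_of_nhds
  exact mul_ne_zero hne (right_ne_zero_of_mul_eq_one h3) h2

theorem IsGTMS.conditions_of_aequiv_fCBF (hf : IsGTMS f g1 g2 w1 w2) (hw1 : ∀ u, w1 u ≠ 0)
    (hw2 : ∀ v, w2 v ≠ 0) (h : AEquiv f p fCBF (0, 0)) :
    phiW g1 w1 p.1 - phiW g2 w2 p.2 ≠ 0 ∧
       phiW g1 w1 p.1 + phiW g2 w2 p.2 = 0 ∧
       PhiW g1 w1 p.1 - PhiW g2 w2 p.2 = 0 ∧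
       g1 p.1 / deriv g1 p.1 * deriv (PhiW g1 w1) p.1
         + g2 p.2 / deriv g2 p.2 * deriv (PhiW g2 w2) p.2 ≠ 0 := by
  obtain ⟨u, v, r, hC, hr, hr0, hvel⟩ := hf.exists_singularCurve hw1 hw2 h
  obtain ⟨φ1, hφs1, he1⟩ := exists_contDiff_eventuallyEq_phiW hf.smooth_g1 hf.smooth_w1 hC.g1_ne
    (hw1 p.1)
  obtain ⟨φ2, hφs2, he2⟩ := exists_contDiff_eventuallyEq_phiW hf.smooth_g2 hf.smooth_w2 hC.g2_ne
    (hw2 p.2)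
  have hφ1 : phiW g1 w1 p.1 ≠ 0 :=
    div_ne_zero hC.deriv_g1_ne (mul_ne_zero (pow_ne_zero 2 hC.g1_ne) (hw1 _))
  have hφ2 : phiW g2 w2 p.2 ≠ 0 :=
    div_ne_zero hC.deriv_g2_ne (mul_ne_zero (pow_ne_zero 2 hC.g2_ne) (hw2 _))
  have hm0 : deriv u 0 * deriv g1 (u 0) ≠ 0 := by
    rw [hC.u_zero]
    exact mul_ne_zero hC.deriv_u_ne hC.deriv_g1_ne
  have hdu := (contDiff_infty_iff_deriv.1 hC.smooth_u).2
  obtain ⟨m, hm, hme⟩ := exists_contDiff_eventuallyEq_inv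
    (hdu.mul ((contDiff_infty_iff_deriv.1 hC.smooth_g1).2.comp hC.smooth_u)) hm0
  obtain ⟨h1, h2, h3⟩ := (hC.exists_sq_iff hφs1 hφs2 he1 he2).1
    ⟨fun y => r y * (g1 (u y) ^ 2 * φ1 (u y) * φ2 (v y)) * m y,
      (hr.mul ((((hf.smooth_g1.comp hC.smooth_u).pow 2).mul (hφs1.comp hC.smooth_u)).mul
        (hφs2.comp hC.smooth_v))).mul hm, by
      simp only [hme.self_of_nhds, hC.u_zero, hC.v_zero, he1.self_of_nhds, he2.self_of_nhds]
      refine mul_ne_zero (mul_ne_zero hr0 (mul_ne_zero (mul_ne_zero (pow_ne_zero 2 hC.g1_ne) hφ1)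
        hφ2)) (inv_ne_zero ?_)
      exact hm0, by
      filter_upwards [hvel, hme, hC.tendsto_u.eventually he1, hC.tendsto_v.eventually he2,
        hC.mul_eq, hC.eventually_ne, hC.deriv_eq,
        (hdu.continuous.tendsto 0).eventually_ne hC.deriv_u_ne] with y k1 k2 k3 k4 k5 k6 k7 k8
      obtain ⟨k9, k10⟩ := k6
      have hg2 := right_ne_zero_of_mul_eq_one k5
      have hw1' := hw1 (u y)
      have hw2' := hw2 (v y)
      simp only [← mul_assoc, ← k1, k2, k3, k4, phiW]
      rw [k7.2, logSpeed, eq_inv_of_mul_eq_one_left k5]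
      simp only [Function.comp_apply]
      field_simp
      ring⟩
  exact ⟨fun h4 => hφ1 (by linear_combination (1 / 2 : ℝ) * (h1 + h4)), h1, h2, h3⟩

end SingularCurveOfButterfly

end CuspidalButterfly

/-- criterion for the cuspidal butterfly on a minface. -/
theorem cuspidal_butterfly_criterion
    (f : R2 → R3) (g1 g2 w1 w2 : ℝ → ℝ) (hf : IsGTMS f g1 g2 w1 w2)
    (hw1 : ∀ u, w1 u ≠ 0) (hw2 : ∀ v, w2 v ≠ 0)
    (p : R2) (hp : g1 p.1 * g2 p.2 = 1) :
    AEquiv f p fCBF (0, 0) ↔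
      (phiW g1 w1 p.1 - phiW g2 w2 p.2 ≠ 0 ∧
       phiW g1 w1 p.1 + phiW g2 w2 p.2 = 0 ∧
       PhiW g1 w1 p.1 - PhiW g2 w2 p.2 = 0 ∧
       g1 p.1 / deriv g1 p.1 * deriv (PhiW g1 w1) p.1
         + g2 p.2 / deriv g2 p.2 * deriv (PhiW g2 w2) p.2 ≠ 0) := by
  constructor
  · exact hf.conditions_of_aequiv_fCBF hw1 hw2
  · rintro ⟨h1, h2, h3, h4⟩
    exact hf.aequiv_fCBF hw1 hw2 hp h1 h2 h3 h4
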